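/- Sharp Ul'yanov inequality for mixed moduli: let f ∈ L_p^0(T²), 1<p<q<∞, θ = 1/p − 1/q, α₁,α₂>0, and δ₁,δ₂ ∈ (0,1). Then ω_{α₁,α₂}(f,δ₁,δ₂)_q ≲ (∫₀^{δ₁}∫₀^{δ₂} [(t₁t₂)^{−θ} ω_{α₁+θ,α₂+θ}(f,t₁,t₂)_p]^q (dt₁/t₁)(dt₂/t₂))^{1/q}, with a constant independent of f, δ₁, δ₂. -/

import Mathlib

open MeasureTheory Real
open scoped ENNReal

noncomputable section

/-- The `L_p` norm of a function of two variables over the period square `(0,2π]²`. -/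
def Lp2Norm (p : ℝ) (f : ℝ → ℝ → ℝ) : ℝ≥0∞ :=
  (∫⁻ x in Set.Ioc (0:ℝ) (2*π), ∫⁻ y in Set.Ioc (0:ℝ) (2*π),
      ENNReal.ofReal (|f x y| ^ p)) ^ (1/p)

/-- `f ∈ L_p^0(T²)`: measurable, `2π`-periodic in each variable, finite `L_p` norm,
and zero mean in each variable separately. -/
structure MemLp0 (p : ℝ) (f : ℝ → ℝ → ℝ) : Prop where
  meas : Measurable (Function.uncurry f)
  periodic_x : ∀ y, Function.Periodic (fun x => f x y) (2*π)
  periodic_y : ∀ x, Function.Periodic (f x) (2*π)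
  norm_ne_top : Lp2Norm p f ≠ ⊤
  mean_x : ∀ᵐ (y : ℝ) ∂volume, (∫ x in (0:ℝ)..(2*π), f x y) = 0
  mean_y : ∀ᵐ (x : ℝ) ∂volume, (∫ y in (0:ℝ)..(2*π), f x y) = 0

/-- Generalized (fractional) binomial coefficient `C(α,ν) = α(α-1)⋯(α-ν+1)/ν!`. -/
def fracBinom (α : ℝ) : ℕ → ℝ
  | 0 => 1
  | n+1 => fracBinom α n * (α - (n : ℝ)) / ((n : ℝ) + 1)

/-- Fractional difference of order `α` with step `h` in the first variable. -/
def diffX (α h : ℝ) (f : ℝ → ℝ → ℝ) : ℝ → ℝ → ℝ :=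
  fun x y => ∑' ν : ℕ, (-1 : ℝ) ^ ν * fracBinom α ν * f (x + (α - (ν : ℝ)) * h) y

/-- Fractional difference of order `α` with step `h` in the second variable. -/
def diffY (α h : ℝ) (f : ℝ → ℝ → ℝ) : ℝ → ℝ → ℝ :=
  fun x y => ∑' ν : ℕ, (-1 : ℝ) ^ ν * fracBinom α ν * f x (y + (α - (ν : ℝ)) * h)

/-- The mixed (fractional) modulus of smoothness `ω_{α₁,α₂}(f, δ₁, δ₂)_p`. -/
def mixedMod (p α₁ α₂ δ₁ δ₂ : ℝ) (f : ℝ → ℝ → ℝ) : ℝ≥0∞ :=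
  ⨆ (h₁ : ℝ) (_ : |h₁| ≤ δ₁) (h₂ : ℝ) (_ : |h₂| ≤ δ₂),
    Lp2Norm p (diffX α₁ h₁ (diffY α₂ h₂ f))

/-- If `x` grows at least geometrically with ratio `r⁻¹`, then `∑ min (x i) (x i)⁻¹` is bounded. -/
theorem sum_min_inv_le {r : ℝ≥0∞} (hr : r < 1) {x : ℕ → ℝ≥0∞}
    (hx : ∀ i, x i ≤ r * x (i + 1)) :
    ∑' i, min (x i) (x i)⁻¹ ≤ 2 * (1 - r)⁻¹ := by
  set D : ℝ≥0∞ := (1 - r)⁻¹ with hD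
  have h1r : 1 - r ≠ 0 := by simpa [tsub_eq_zero_iff_le] using hr
  have hDid : 1 + r * D = D := by
    have h2 : D * (1 - r) = 1 := ENNReal.inv_mul_cancel h1r (by simp)
    have h3 : (1 - r) + r = 1 := tsub_add_cancel_of_le hr.le
    calc 1 + r * D = D * (1 - r) + r * D := by rw [h2]
      _ = D * ((1 - r) + r) := by ring
      _ = D := by rw [h3, mul_one]
  have hD1 : 1 ≤ D := by rw [← hDid]; exact le_self_add
  have low : ∀ n, ∑ i ∈ Finset.range n, (if x i ≤ 1 then x i else 0) ≤ D ∧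
      ∑ i ∈ Finset.range n, (if x i ≤ 1 then x i else 0) ≤ D * (r * x n) := by
    intro n
    induction n with
    | zero => simp
    | succ n ih =>
      rw [Finset.sum_range_succ]
      have key : ∑ i ∈ Finset.range n, (if x i ≤ 1 then x i else 0) +
          (if x n ≤ 1 then x n else 0) ≤ D * x n ∧
          ∑ i ∈ Finset.range n, (if x i ≤ 1 then x i else 0) +
          (if x n ≤ 1 then x n else 0) ≤ D := by
        split_ifs with h
        · have : ∑ i ∈ Finset.range n, (if x i ≤ 1 then x i else 0) + x n ≤ D * x n := by
            calc _ ≤ D * (r * x n) + x n := by gcongr; exact ih.2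
              _ = (1 + r * D) * x n := by ring
              _ = D * x n := by rw [hDid]
          exact ⟨this, this.trans (by simpa using mul_le_mul_right h D)⟩
        · refine ⟨?_, by simpa using ih.1⟩
          push Not at h
          calc _ ≤ D := by simpa using ih.1
            _ = D * 1 := by simp
            _ ≤ D * x n := by gcongr
      exact ⟨key.2, key.1.trans (by gcongr; exact hx n)⟩
  have high : ∀ n, ∑ i ∈ Finset.range n, (if x i ≤ 1 then 0 else (x i)⁻¹) +
      D * min 1 (x n)⁻¹ ≤ D := by
    intro n
    induction n with
    | zero => simpa using mul_le_mul_right (min_le_left 1 (x 0)⁻¹) D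
    | succ n ih =>
      refine le_trans ?_ ih
      rw [Finset.sum_range_succ, add_assoc]
      gcongr
      split_ifs with h
      · have : 1 ≤ (x n)⁻¹ := by simpa using h
        rw [min_eq_left this, zero_add]
        gcongr
        exact min_le_left _ _
      · push Not at h
        have : (x n)⁻¹ ≤ 1 := by simpa using h.le
        rw [min_eq_right this]
        have h4 : (x (n+1))⁻¹ ≤ r * (x n)⁻¹ := by
          have h0 : x n ≠ 0 := (zero_lt_one.trans h).ne'
          rcases eq_or_ne r 0 with h5 | h5
          · have := hx n
            simp [h5] at this; exact absurd this h0
          rw [ENNReal.inv_le_iff_inv_le, ENNReal.mul_inv (Or.inl h5) (Or.inl (hr.trans_le le_top).ne),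
            inv_inv]
          rw [mul_comm, ← div_eq_mul_inv]
          exact ENNReal.div_le_of_le_mul' (hx n)
        calc (x n)⁻¹ + D * min 1 (x (n+1))⁻¹ ≤ (x n)⁻¹ + D * (r * (x n)⁻¹) := by
              gcongr; exact (min_le_right _ _).trans h4
          _ = (1 + r * D) * (x n)⁻¹ := by ring
          _ = _ := by rw [hDid]
  refine ENNReal.tsum_le_of_sum_range_le fun n => ?_
  calc ∑ i ∈ Finset.range n, min (x i) (x i)⁻¹
      ≤ ∑ i ∈ Finset.range n, ((if x i ≤ 1 then x i else 0) +
        (if x i ≤ 1 then 0 else (x i)⁻¹)) := by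
        gcongr with i
        split_ifs <;> simp
    _ ≤ D + D := by
        rw [Finset.sum_add_distrib]
        exact add_le_add (low n).1 (le_self_add.trans (high n))
    _ = 2 * D := by ring

/-- Power summation for sequences dominated by a geometrically growing one. -/
theorem exists_rpow_tsum_le {p q : ℝ} (hp : 0 < p) (hpq : p < q) {r : ℝ≥0∞} (hr : r < 1) :
    ∃ C : ℝ≥0∞, C ≠ ⊤ ∧ ∀ a Λ : ℕ → ℝ≥0∞, (∀ i, Λ i ≠ ⊤) → (∀ i, a i ^ q ≤ Λ i) →
      (∀ i, Λ i ≤ r * Λ (i + 1)) →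
      (∑' i, a i) ^ q ≤ C * ∑' i, a i ^ p * Λ i ^ (1 - p / q) := by
  have hq : 0 < q := hp.trans hpq
  set σ : ℝ := q / p - 1 with hσ
  have hσ0 : 0 < σ := by rw [hσ]; have := (one_lt_div hp).2 hpq; linarith
  set m : ℝ := min 1 σ / q with hm
  have hm0 : 0 < m := by positivity
  refine ⟨(2 * (1 - r ^ m)⁻¹) ^ q, ?_, fun a Λ hΛ haΛ hgrow => ?_⟩
  · refine ENNReal.rpow_ne_top_of_nonneg hq.le (ENNReal.mul_ne_top (by simp) ?_)
    have : r ^ m < 1 := ENNReal.rpow_lt_one hr hm0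
    simpa [tsub_eq_zero_iff_le] using this
  set X := ∑' i, a i ^ p * Λ i ^ (1 - p / q) with hX
  have h1pq : 0 < 1 - p / q := by have := (div_lt_one hq).2 hpq; linarith
  have hterm : ∀ i, a i ^ p * Λ i ^ (1 - p / q) ≤ X := fun i => ENNReal.le_tsum i
  have ha0 : ∀ i, Λ i = 0 → a i = 0 := fun i h => by
    have := haΛ i
    rw [h] at this
    simpa [hq, hq.not_gt] using this
  rcases eq_or_ne X 0 with hX0 | hX0
  · have : ∀ i, a i = 0 := fun i => by
      by_contra hne
      have h := hterm i
      rw [hX0, nonpos_iff_eq_zero, mul_eq_zero] at h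
      rcases h with h | h
      · exact hne (by simpa [hp, hp.not_gt] using h)
      · have : Λ i = 0 := by
          rw [ENNReal.rpow_eq_zero_iff] at h
          rcases h with h | h
          · exact h.1
          · exact absurd h.1 (hΛ i)
        exact hne (ha0 i this)
    simp [this, hq]
  rcases eq_or_ne X ⊤ with hXt | hXt
  · rw [hXt, ENNReal.mul_top]
    · exact le_top
    · have : (2 * (1 - r ^ m)⁻¹ : ℝ≥0∞) ≠ 0 := by simp
      simp only [ne_eq, ENNReal.rpow_eq_zero_iff, not_or, not_and]
      exact ⟨fun h => absurd h this, fun _ h => absurd h hq.not_gt⟩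
  set x : ℕ → ℝ≥0∞ := fun i => (Λ i / X) ^ m with hx
  have hgrowx : ∀ i, x i ≤ r ^ m * x (i + 1) := fun i => by
    simp only [hx]
    rw [← ENNReal.mul_rpow_of_nonneg _ _ hm0.le]
    gcongr
    rw [← mul_div_assoc]
    gcongr
    exact hgrow i
  have hS := sum_min_inv_le (ENNReal.rpow_lt_one hr hm0) hgrowx
  have hXi : ∀ s : ℝ, X ^ s ≠ 0 ∧ X ^ s ≠ ⊤ := fun s =>
    ⟨(ENNReal.rpow_pos (pos_iff_ne_zero.2 hX0) hXt).ne', ENNReal.rpow_ne_top_of_ne_zero hX0 hXt⟩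
  have hbound : ∀ i, a i ≤ X ^ (1 / q) * min (x i) (x i)⁻¹ := fun i => by
    rcases eq_or_ne (Λ i) 0 with h0 | h0
    · simp [ha0 i h0]
    have hL0 : Λ i / X ≠ 0 := ENNReal.div_ne_zero.2 ⟨h0, hXt⟩
    have hLt : Λ i / X ≠ ⊤ := ENNReal.div_ne_top (hΛ i) hX0
    have hLX : Λ i = X * (Λ i / X) := (ENNReal.mul_div_cancel hX0 hXt).symm
    have e1 : a i ≤ X ^ (1 / q) * (Λ i / X) ^ (1 / q) := by
      rw [← ENNReal.mul_rpow_of_nonneg _ _ (by positivity), ← hLX,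
        one_div, ENNReal.le_rpow_inv_iff hq]
      exact haΛ i
    have e2 : a i ≤ X ^ (1 / q) * (Λ i / X) ^ (-(σ / q)) := by
      have h5 : a i ^ p ≤ X * Λ i ^ (-(1 - p / q)) := by
        rw [ENNReal.rpow_neg, ← div_eq_mul_inv, ENNReal.le_div_iff_mul_le]
        · exact hterm i
        · right; exact hX0
        · right; exact hXt
      have h6 : a i ≤ (X * Λ i ^ (-(1 - p / q))) ^ (1 / p) := by
        rw [one_div, ENNReal.le_rpow_inv_iff hp]; exact h5
      refine h6.trans (le_of_eq ?_)
      rw [ENNReal.mul_rpow_of_nonneg _ _ (by positivity), ← ENNReal.rpow_mul]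
      conv_lhs => rw [hLX]
      rw [ENNReal.mul_rpow_of_ne_zero hX0 hL0, ← mul_assoc, ← ENNReal.rpow_add _ _ hX0 hXt]
      congr 2
      · field_simp; ring
      · rw [hσ]; field_simp
    rw [← min_mul_mul_left] 
    refine le_min ?_ ?_
    all_goals simp only [hx, ← ENNReal.rpow_neg]
    all_goals rcases le_total (Λ i / X) 1 with h | h
    · refine e1.trans ?_
      refine mul_le_mul_right ?_ _
      exact ENNReal.rpow_le_rpow_of_exponent_ge h (by rw [hm]; gcongr; exact min_le_left _ _)
    · refine e2.trans ?_
      refine mul_le_mul_right ?_ _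
      exact ENNReal.rpow_le_rpow_of_exponent_le h (by have : 0 < σ / q := by positivity
                                                      linarith)
    · refine e1.trans ?_
      refine mul_le_mul_right ?_ _
      exact ENNReal.rpow_le_rpow_of_exponent_ge h (by have : 0 < 1 / q := by positivity
                                                      linarith)
    · refine e2.trans ?_
      refine mul_le_mul_right ?_ _
      exact ENNReal.rpow_le_rpow_of_exponent_le h
        (by rw [hm]; gcongr; exact min_le_right _ _)
  calc (∑' i, a i) ^ q ≤ (∑' i, X ^ (1 / q) * min (x i) (x i)⁻¹) ^ q := by
        gcongr with i; exact hbound i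
    _ ≤ (X ^ (1 / q) * (2 * (1 - r ^ m)⁻¹)) ^ q := by
        rw [ENNReal.tsum_mul_left]; gcongr
    _ = _ := by
        rw [ENNReal.mul_rpow_of_nonneg _ _ hq.le, ← ENNReal.rpow_mul, one_div_mul_cancel hq.ne',
          ENNReal.rpow_one, mul_comm]

/-- Minkowski's integral inequality. -/
theorem lintegral_Lp_lintegral_le {X Y : Type*} [MeasurableSpace X] [MeasurableSpace Y]
    (μ : Measure X) (ν : Measure Y) [SFinite μ] [IsFiniteMeasure ν] {p : ℝ} (hp : 1 < p)
    {F : X → Y → ℝ≥0∞} (hF : Measurable (Function.uncurry F)) :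
    (∫⁻ y, (∫⁻ x, F x y ∂μ) ^ p ∂ν) ^ (1 / p) ≤ ∫⁻ x, (∫⁻ y, F x y ^ p ∂ν) ^ (1 / p) ∂μ := by
  have hp0 : 0 < p := zero_lt_one.trans hp
  have hconj := Real.HolderConjugate.conjExponent hp
  set p' := p.conjExponent
  set R := ∫⁻ x, (∫⁻ y, F x y ^ p ∂ν) ^ (1 / p) ∂μ
  set G : Y → ℝ≥0∞ := fun y => ∫⁻ x, F x y ∂μ with hG
  have hGm : Measurable G := hF.lintegral_prod_left'
  have key : ∀ n : ℕ, ∫⁻ y, (min (G y) n) ^ p ∂ν ≤ R ^ p := by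
    intro n
    set H : Y → ℝ≥0∞ := fun y => min (G y) n with hH
    have hHm : Measurable H := hGm.min measurable_const
    set N := ∫⁻ y, H y ^ p ∂ν with hN
    have hNt : N ≠ ⊤ := by
      refine ne_top_of_le_ne_top (b := ∫⁻ y, (n : ℝ≥0∞) ^ p ∂ν) ?_ ?_
      · rw [lintegral_const]
        exact ENNReal.mul_ne_top (ENNReal.rpow_ne_top_of_nonneg hp0.le (by simp)) (by simp)
      · exact lintegral_mono fun y => ENNReal.rpow_le_rpow (min_le_right _ _) hp0.le
    have h1 : N ≤ R * N ^ (1 / p') := by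
      calc N = ∫⁻ y, H y * H y ^ (p - 1) ∂ν := by
            rw [hN]; congr 1; ext y
            conv_rhs => rw [← ENNReal.rpow_one (H y), ← ENNReal.rpow_mul, one_mul,
              ← ENNReal.rpow_add_of_nonneg _ _ zero_le_one (by linarith)]
            congr 1; ring
        _ ≤ ∫⁻ y, G y * H y ^ (p - 1) ∂ν := by
            gcongr with y; exact min_le_left _ _
        _ = ∫⁻ y, ∫⁻ x, F x y * H y ^ (p - 1) ∂μ ∂ν := by
            congr 1; ext y
            rw [lintegral_mul_const]
            exact hF.comp (measurable_id.prodMk measurable_const)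
        _ = ∫⁻ x, ∫⁻ y, F x y * H y ^ (p - 1) ∂ν ∂μ := by
            refine (lintegral_lintegral_swap ?_).symm
            exact (hF.mul ((hHm.comp measurable_snd).pow_const _)).aemeasurable
        _ ≤ ∫⁻ x, (∫⁻ y, F x y ^ p ∂ν) ^ (1 / p) * N ^ (1 / p') ∂μ := by
            gcongr with x
            refine (ENNReal.lintegral_mul_le_Lp_mul_Lq ν hconj
              (hF.comp (measurable_const.prodMk measurable_id)).aemeasurable
              (hHm.pow_const _).aemeasurable).trans (le_of_eq ?_)
            congr 3
            ext y
            rw [← ENNReal.rpow_mul, hconj.sub_one_mul_conj]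
        _ = R * N ^ (1 / p') := by
            rw [lintegral_mul_const]
            exact ((hF.pow_const p).lintegral_prod_right').pow_const _
    rcases eq_or_ne N 0 with h0 | h0
    · simp [h0]
    have h2 : N ^ (1 / p) ≤ R := by
      have h3 : N ^ (1 / p) * N ^ (1 / p') = N := by
        rw [← ENNReal.rpow_add _ _ h0 hNt]
        have := hconj.inv_add_inv_eq_one
        simp only [one_div, this, ENNReal.rpow_one]
      rw [← h3] at h1
      refine (ENNReal.mul_le_mul_iff_left ?_ ?_).1 (by rw [h3]; rw [h3] at h1; exact h1)
      · exact (ENNReal.rpow_pos (pos_iff_ne_zero.2 h0) hNt).ne'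
      · exact ENNReal.rpow_ne_top_of_ne_zero h0 hNt
    calc N = (N ^ (1 / p)) ^ p := by
          rw [← ENNReal.rpow_mul, one_div_mul_cancel hp0.ne', ENNReal.rpow_one]
      _ ≤ R ^ p := by gcongr
  have hlim : ∫⁻ y, G y ^ p ∂ν = ⨆ n : ℕ, ∫⁻ y, (min (G y) n) ^ p ∂ν := by
    rw [← lintegral_iSup]
    · congr 1; ext y
      refine le_antisymm ?_ (iSup_le fun n => by gcongr; exact min_le_left _ _)
      have h1 : Filter.Tendsto (fun n : ℕ => (min (G y) n) ^ p) Filter.atTop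
          (nhds (G y ^ p)) := by
        have h2 : Filter.Tendsto (fun n : ℕ => min (G y) (n : ℝ≥0∞)) Filter.atTop
            (nhds (min (G y) ⊤)) := tendsto_const_nhds.min ENNReal.tendsto_nat_nhds_top
        rw [min_eq_left le_top] at h2
        exact (ENNReal.continuous_rpow_const.tendsto _).comp h2
      exact le_of_tendsto' h1 fun n => le_iSup (fun n : ℕ => (min (G y) n) ^ p) n
    · exact fun n => (hGm.min measurable_const).pow_const _
    · intro m n hmn y
      dsimp only
      gcongr
  rw [one_div, ENNReal.rpow_inv_le_iff hp0]
  rw [hlim]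
  exact iSup_le key

/-- Lebesgue measure on one period. -/
def perMeas : Measure ℝ := volume.restrict (Set.Ioc (0:ℝ) (2*π))

instance : IsFiniteMeasure perMeas := by
  unfold perMeas
  infer_instance

/-- Convolution of a nonnegative function with a measure. -/
def convMeas (κ : Measure ℝ) (v : ℝ → ℝ≥0∞) (x : ℝ) : ℝ≥0∞ := ∫⁻ s, v (x - s) ∂κ

/-- A positive kernel of mass at most `A` concentrated at scale `s⁻¹`. -/
structure GoodKernel (A s : ℝ≥0∞) (κ : Measure ℝ) : Prop where
  mass : κ Set.univ ≤ A
  sup_le : ∀ v : ℝ → ℝ≥0∞, Measurable v → Function.Periodic v (2*π) → ∀ x,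
    convMeas κ v x ≤ A * s * ∫⁻ y, v y ∂perMeas

theorem measurable_convMeas (κ : Measure ℝ) [SFinite κ] {v : ℝ → ℝ≥0∞} (hv : Measurable v) :
    Measurable (convMeas κ v) := by
  unfold convMeas
  exact Measurable.lintegral_prod_right' (f := fun z : ℝ × ℝ => v (z.1 - z.2))
    (hv.comp (measurable_fst.sub measurable_snd))

theorem lintegral_perMeas_sub {v : ℝ → ℝ≥0∞} (hper : Function.Periodic v (2*π)) (a : ℝ) :
    ∫⁻ x, v (x - a) ∂perMeas = ∫⁻ x, v x ∂perMeas := by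
  have hpos : (0:ℝ) < 2*π := by positivity
  have h1 : ∫⁻ x, v (x - a) ∂perMeas = ∫⁻ x in Set.Ioc (0 - a) (0 - a + 2*π), v x := by
    unfold perMeas
    have := (measurePreserving_sub_right (volume : Measure ℝ) a).setLIntegral_comp_preimage_emb
      (MeasurableEquiv.subRight a).measurableEmbedding v (Set.Ioc (0 - a) (0 - a + 2*π))
    rw [← this]
    congr 2
    ext x
    simp only [Set.mem_Ioc, Set.mem_preimage]
    constructor <;> rintro ⟨h1, h2⟩ <;> constructor <;> linarith
  rw [h1]
  have hf := (isAddFundamentalDomain_Ioc hpos (0 - a)).setLIntegral_eq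
    (isAddFundamentalDomain_Ioc hpos 0) v ?_
  · rw [hf]; unfold perMeas; rw [zero_add]
  · rintro ⟨g, hg⟩ x
    obtain ⟨n, rfl⟩ := AddSubgroup.mem_zmultiples_iff.1 hg
    have := hper.zsmul n x
    rw [add_comm] at this
    exact this

theorem lintegral_perMeas_add {v : ℝ → ℝ≥0∞} (hper : Function.Periodic v (2*π)) (a : ℝ) :
    ∫⁻ x, v (x + a) ∂perMeas = ∫⁻ x, v x ∂perMeas := by
  simpa using lintegral_perMeas_sub hper (-a)

theorem lintegral_convMeas (κ : Measure ℝ) [SFinite κ] {v : ℝ → ℝ≥0∞} (hv : Measurable v)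
    (hper : Function.Periodic v (2*π)) :
    ∫⁻ x, convMeas κ v x ∂perMeas = κ Set.univ * ∫⁻ x, v x ∂perMeas := by
  unfold convMeas
  rw [lintegral_lintegral_swap]
  · simp_rw [lintegral_perMeas_sub hper]
    rw [lintegral_const, mul_comm]
  · exact (hv.comp (measurable_fst.sub measurable_snd)).aemeasurable

theorem convMeas_rpow_le (κ : Measure ℝ) {v : ℝ → ℝ≥0∞} (hv : Measurable v) {r : ℝ}
    (hr : 1 ≤ r) (x : ℝ) :
    convMeas κ v x ^ r ≤ κ Set.univ ^ (r - 1) * convMeas κ (fun y => v y ^ r) x := by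
  unfold convMeas
  have hm : Measurable fun s => v (x - s) := hv.comp (measurable_const.sub measurable_id)
  rcases hr.eq_or_lt with rfl | hr1
  · simp
  have hr0 : 0 < r := by linarith
  have hconj := Real.HolderConjugate.conjExponent hr1
  have h := ENNReal.lintegral_mul_le_Lp_mul_Lq κ hconj hm.aemeasurable
    (aemeasurable_const (b := (1:ℝ≥0∞)))
  simp only [Pi.mul_apply, mul_one, ENNReal.one_rpow, lintegral_const, one_mul] at h
  calc _ ≤ _ := ENNReal.rpow_le_rpow h hr0.le
    _ = _ := by
      rw [ENNReal.mul_rpow_of_nonneg _ _ hr0.le, ← ENNReal.rpow_mul, ← ENNReal.rpow_mul,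
        one_div_mul_cancel hr0.ne', ENNReal.rpow_one, mul_comm]
      congr 2
      have := hconj.sub_one_mul_conj
      have h2 := hconj.symm.pos.ne'
      field_simp
      linarith

theorem GoodKernel.rpow_sup_le {A s : ℝ≥0∞} {κ : Measure ℝ} (h : GoodKernel A s κ)
    {v : ℝ → ℝ≥0∞} (hv : Measurable v) (hper : Function.Periodic v (2*π)) {r : ℝ}
    (hr : 1 ≤ r) (x : ℝ) :
    convMeas κ v x ^ r ≤ A ^ r * s * ∫⁻ y, v y ^ r ∂perMeas := by
  refine (convMeas_rpow_le κ hv hr x).trans ?_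
  have h1 := h.sup_le (fun y => v y ^ r) (hv.pow_const r) (fun y => by simp only [hper y]) x
  calc _ ≤ A ^ (r - 1) * (A * s * ∫⁻ y, v y ^ r ∂perMeas) := by
        gcongr ?_ * ?_
        exact ENNReal.rpow_le_rpow h.mass (by linarith)
    _ = A ^ (r - 1) * A * s * ∫⁻ y, v y ^ r ∂perMeas := by ring
    _ = _ := by
      congr 2
      conv_lhs => rw [← ENNReal.rpow_one A, ← ENNReal.rpow_mul, one_mul,
        ← ENNReal.rpow_add_of_nonneg _ _ (by linarith) zero_le_one]
      congr 1; ring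

theorem GoodKernel.lintegral_rpow_le {A s : ℝ≥0∞} {κ : Measure ℝ} [SFinite κ]
    (h : GoodKernel A s κ)
    {v : ℝ → ℝ≥0∞} (hv : Measurable v) (hper : Function.Periodic v (2*π)) {r : ℝ}
    (hr : 1 ≤ r) :
    ∫⁻ x, convMeas κ v x ^ r ∂perMeas ≤ A ^ r * ∫⁻ y, v y ^ r ∂perMeas := by
  have hm : Measurable fun y => v y ^ r := hv.pow_const r
  have hp : Function.Periodic (fun y => v y ^ r) (2*π) := fun y => by simp only [hper y]
  calc _ ≤ ∫⁻ x, κ Set.univ ^ (r - 1) * convMeas κ (fun y => v y ^ r) x ∂perMeas :=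
        lintegral_mono fun x => convMeas_rpow_le κ hv hr x
    _ = κ Set.univ ^ (r - 1) * (κ Set.univ * ∫⁻ y, v y ^ r ∂perMeas) := by
        rw [lintegral_const_mul _ (measurable_convMeas κ hm), lintegral_convMeas κ hm hp]
    _ = κ Set.univ ^ r * ∫⁻ y, v y ^ r ∂perMeas := by
        rw [← mul_assoc]
        congr 1
        conv_lhs => rw [← ENNReal.rpow_one (κ Set.univ), ← ENNReal.rpow_mul, one_mul,
          ← ENNReal.rpow_add_of_nonneg _ _ (by linarith) zero_le_one]
        congr 1; ring
    _ ≤ _ := by gcongr; exact h.mass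

/-- A sequence majorizing `B`, decaying no faster than `ρ ^ k`. -/
def geomMajorant (ρ : ℝ≥0∞) (B : ℕ → ℝ≥0∞) : ℕ → ℝ≥0∞
  | 0 => B 0
  | k + 1 => B (k + 1) + ρ * geomMajorant ρ B k

theorem le_geomMajorant (ρ : ℝ≥0∞) (B : ℕ → ℝ≥0∞) (k : ℕ) : B k ≤ geomMajorant ρ B k := by
  cases k with
  | zero => exact le_rfl
  | succ k => exact le_self_add

theorem tsum_geomMajorant_le {ρ : ℝ≥0∞} (hρ : ρ < 1) (B : ℕ → ℝ≥0∞) :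
    ∑' k, geomMajorant ρ B k ≤ (1 - ρ)⁻¹ * ∑' k, B k := by
  have h1r : 1 - ρ ≠ 0 := by simpa [tsub_eq_zero_iff_le] using hρ
  have hDid : 1 + ρ * (1 - ρ)⁻¹ = (1 - ρ)⁻¹ := by
    have h2 : (1 - ρ)⁻¹ * (1 - ρ) = 1 := ENNReal.inv_mul_cancel h1r (by simp)
    have h3 : (1 - ρ) + ρ = 1 := tsub_add_cancel_of_le hρ.le
    calc 1 + ρ * (1 - ρ)⁻¹ = (1 - ρ)⁻¹ * (1 - ρ) + ρ * (1 - ρ)⁻¹ := by rw [h2]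
      _ = (1 - ρ)⁻¹ * ((1 - ρ) + ρ) := by ring
      _ = _ := by rw [h3, mul_one]
  have key : ∀ n, ∑ k ∈ Finset.range (n + 1), geomMajorant ρ B k =
      ∑ k ∈ Finset.range (n + 1), B k + ρ * ∑ k ∈ Finset.range n, geomMajorant ρ B k := by
    intro n
    rw [Finset.sum_range_succ', Finset.sum_range_succ' (fun k => B k), Finset.mul_sum]
    simp only [geomMajorant, Finset.sum_add_distrib]
    ring
  refine ENNReal.tsum_le_of_sum_range_le fun n => ?_
  induction n with
  | zero => simp
  | succ n ih =>
    rw [key]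
    calc _ ≤ ∑' k, B k + ρ * ((1 - ρ)⁻¹ * ∑' k, B k) := by
          gcongr; exact ENNReal.sum_le_tsum _
      _ = (1 + ρ * (1 - ρ)⁻¹) * ∑' k, B k := by ring
      _ = _ := by rw [hDid]

theorem geomMajorant_ne_top {ρ : ℝ≥0∞} (hρ : ρ ≠ ⊤) {B : ℕ → ℝ≥0∞} (hB : ∀ k, B k ≠ ⊤) (k : ℕ) :
    geomMajorant ρ B k ≠ ⊤ := by
  induction k with
  | zero => exact hB 0
  | succ k ih => exact ENNReal.add_ne_top.2 ⟨hB _, ENNReal.mul_ne_top hρ ih⟩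

theorem dyadic_ne_zero {s : ℕ → ℝ≥0∞} (h0 : s 0 ≠ 0) (hs : ∀ i, s (i + 1) = 2 * s i) (i : ℕ) :
    s i ≠ 0 := by
  induction i with
  | zero => exact h0
  | succ i ih => rw [hs]; exact mul_ne_zero (by simp) ih

theorem dyadic_ne_top {s : ℕ → ℝ≥0∞} (h0 : s 0 ≠ ⊤) (hs : ∀ i, s (i + 1) = 2 * s i) (i : ℕ) :
    s i ≠ ⊤ := by
  induction i with
  | zero => exact h0
  | succ i ih => rw [hs]; exact ENNReal.mul_ne_top (by simp) ih

/-- Square-function-free estimate for a sum of positive operators at decreasing scales. -/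
theorem exists_high_freq_bound {p q : ℝ} (hp : 1 < p) (hpq : p < q) {A : ℝ≥0∞} (hA : A ≠ ⊤) :
    ∃ C : ℝ≥0∞, C ≠ ⊤ ∧ ∀ (s : ℕ → ℝ≥0∞) (κ : ℕ → Measure ℝ) (v : ℕ → ℝ → ℝ≥0∞),
      s 0 ≠ 0 → s 0 ≠ ⊤ → (∀ i, s (i + 1) = 2 * s i) → (∀ i, IsFiniteMeasure (κ i)) →
      (∀ i, GoodKernel A (s i) (κ i)) → (∀ i, Measurable (v i)) →
      (∀ i, Function.Periodic (v i) (2*π)) →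
      ∫⁻ x, (∑' i, convMeas (κ i) (v i) x) ^ q ∂perMeas ≤
        C * ∑' i, s i ^ (q / p - 1) * (∫⁻ x, v i x ^ p ∂perMeas) ^ (q / p) := by
  have hp0 : 0 < p := by linarith
  have hq0 : 0 < q := by linarith
  have hqp : 1 < q / p := (one_lt_div hp0).2 hpq
  have hpq1 : p / q < 1 := (div_lt_one hq0).2 hpq
  have hpq0 : 0 < p / q := by positivity
  set r : ℝ≥0∞ := 2⁻¹ ^ (1/2 : ℝ) with hr
  have hr1 : r < 1 := ENNReal.rpow_lt_one (by simp [ENNReal.inv_lt_one]) (by norm_num)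
  have hrr : r * r = 2⁻¹ := by
    rw [hr, ← ENNReal.rpow_add_of_nonneg _ _ (by norm_num) (by norm_num)]; norm_num
  have hr2 : 2 * r * r = 1 := by rw [mul_assoc, hrr, ENNReal.mul_inv_cancel (by simp) (by simp)]
  obtain ⟨C, hC, hS⟩ := exists_rpow_tsum_le hp0 hpq hr1
  have hD : (1 - r)⁻¹ ≠ ⊤ := by simpa [tsub_eq_zero_iff_le] using hr1
  refine ⟨C * A ^ q * (1 - r)⁻¹ + 1, ?_, fun s κ v h0 h1 hs hκ hg hv hper => ?_⟩
  · exact ENNReal.add_ne_top.2 ⟨ENNReal.mul_ne_top (ENNReal.mul_ne_top hC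
      (ENNReal.rpow_ne_top_of_nonneg hq0.le hA)) hD, by simp⟩
  have hs0 := dyadic_ne_zero h0 hs
  have hst := dyadic_ne_top h1 hs
  set P : ℕ → ℝ≥0∞ := fun i => ∫⁻ x, v i x ^ p ∂perMeas with hP
  set B : ℕ → ℝ≥0∞ := fun i => s i ^ (q / p - 1) * P i ^ (q / p) with hB
  change _ ≤ _ * ∑' i, B i
  rcases eq_or_ne (∑' i, B i) ⊤ with hBt | hBt
  · rw [hBt, ENNReal.mul_top (by simp)]; exact le_top
  have hBi : ∀ i, B i ≠ ⊤ := fun i => ne_top_of_le_ne_top hBt (ENNReal.le_tsum i)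
  set M := geomMajorant r B with hM
  have hMt : ∀ i, M i ≠ ⊤ := geomMajorant_ne_top (hr1.trans_le le_top).ne hBi
  have hAq : A ^ q ≠ ⊤ := ENNReal.rpow_ne_top_of_nonneg hq0.le hA
  have hF : ∀ i x, convMeas (κ i) (v i) x ^ q ≤ A ^ q * s i * M i := fun i x => by
    have e := (hg i).rpow_sup_le (hv i) (hper i) hp.le x
    calc convMeas (κ i) (v i) x ^ q = (convMeas (κ i) (v i) x ^ p) ^ (q / p) := by
          rw [← ENNReal.rpow_mul]; congr 1; field_simp
      _ ≤ (A ^ p * s i * P i) ^ (q / p) := by gcongr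
      _ = A ^ q * s i * B i := by
          rw [ENNReal.mul_rpow_of_nonneg _ _ (by positivity),
            ENNReal.mul_rpow_of_nonneg _ _ (by positivity), ← ENNReal.rpow_mul, hB]
          have : s i ^ (q / p) = s i * s i ^ (q / p - 1) := by
            conv_rhs => rw [← ENNReal.rpow_one (s i), ← ENNReal.rpow_mul, one_mul,
              ← ENNReal.rpow_add _ _ (hs0 i) (hst i)]
            congr 1; ring
          rw [this]
          have : p * (q / p) = q := by field_simp
          rw [this]; ring
      _ ≤ _ := by gcongr; exact le_geomMajorant r B i
  have hpt : ∀ x, (∑' i, convMeas (κ i) (v i) x) ^ q ≤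
      C * ∑' i, convMeas (κ i) (v i) x ^ p * (A ^ q * s i * M i) ^ (1 - p / q) := fun x => by
    refine hS _ _ (fun i => ?_) (fun i => hF i x) (fun i => ?_)
    · exact ENNReal.mul_ne_top (ENNReal.mul_ne_top hAq (hst i)) (hMt i)
    · rw [hs]
      calc A ^ q * s i * M i = (2 * r * r) * (A ^ q * s i * M i) := by rw [hr2, one_mul]
        _ = r * (A ^ q * (2 * s i) * (r * M i)) := by ring
        _ ≤ _ := by gcongr; exact le_add_self
  have hmeas : ∀ i, Measurable (convMeas (κ i) (v i)) := fun i => measurable_convMeas _ (hv i)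
  calc _ ≤ ∫⁻ x, C * ∑' i, convMeas (κ i) (v i) x ^ p * (A ^ q * s i * M i) ^ (1 - p / q)
          ∂perMeas := lintegral_mono hpt
    _ = C * ∑' i, (∫⁻ x, convMeas (κ i) (v i) x ^ p ∂perMeas) *
          (A ^ q * s i * M i) ^ (1 - p / q) := by
        rw [lintegral_const_mul, lintegral_tsum]
        · congr 2; ext i
          rw [lintegral_mul_const _ ((hmeas i).pow_const p)]
        · exact fun i => (((hmeas i).pow_const p).mul_const _).aemeasurable
        · exact Measurable.tsum fun i => ((hmeas i).pow_const p).mul_const _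
    _ ≤ C * ∑' i, A ^ q * M i := by
        refine mul_le_mul_right (ENNReal.tsum_le_tsum fun i => ?_) _
        calc _ ≤ A ^ p * P i * (A ^ q * s i * M i) ^ (1 - p / q) := by
              gcongr; exact (hg i).lintegral_rpow_le (hv i) (hper i) hp.le
          _ = A ^ q * (B i ^ (p / q) * M i ^ (1 - p / q)) := by
              rw [hB]
              simp only
              rw [ENNReal.mul_rpow_of_nonneg _ _ (by linarith),
                ENNReal.mul_rpow_of_nonneg _ _ (by linarith),
                ENNReal.mul_rpow_of_nonneg _ _ hpq0.le, ← ENNReal.rpow_mul, ← ENNReal.rpow_mul,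
                ← ENNReal.rpow_mul]
              have e1 : (q / p - 1) * (p / q) = 1 - p / q := by field_simp
              have e2 : q / p * (p / q) = 1 := by field_simp
              have e3 : A ^ q = A ^ p * A ^ (q * (1 - p / q)) := by
                rw [← ENNReal.rpow_add_of_nonneg _ _ hp0.le
                  (mul_nonneg hq0.le (by linarith))]
                congr 1; field_simp; ring
              rw [e1, e2, ENNReal.rpow_one, e3]; ring
          _ ≤ A ^ q * (M i ^ (p / q) * M i ^ (1 - p / q)) := by
              gcongr; exact le_geomMajorant r B i
          _ = A ^ q * M i := by
              rw [← ENNReal.rpow_add_of_nonneg _ _ hpq0.le (by linarith)]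
              simp
    _ ≤ C * (A ^ q * ((1 - r)⁻¹ * ∑' i, B i)) := by
        rw [ENNReal.tsum_mul_left]; gcongr; exact tsum_geomMajorant_le hr1 B
    _ = C * A ^ q * (1 - r)⁻¹ * ∑' i, B i := by ring
    _ ≤ _ := by gcongr; exact le_self_add

theorem exists_tsum_dyadic_le {γ : ℝ} (hγ : 0 < γ) :
    ∃ C : ℝ≥0∞, C ≠ ⊤ ∧ ∀ s : ℕ → ℝ≥0∞, s 0 ≠ 0 → s 0 ≠ ⊤ → (∀ i, s (i + 1) = 2 * s i) →
      ∀ Z : ℝ≥0∞, Z ≠ 0 → Z ≠ ⊤ → ∑' i, (if s i < Z then s i ^ γ else 0) ≤ C * Z ^ γ ∧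
        ∑' i, (if Z ≤ s i then s i ^ (-γ) else 0) ≤ C * Z ^ (-γ) := by
  have hr : (2⁻¹ : ℝ≥0∞) ^ γ < 1 := ENNReal.rpow_lt_one (by simp [ENNReal.inv_lt_one]) hγ
  refine ⟨2 * (1 - 2⁻¹ ^ γ)⁻¹, ?_, fun s h0 h1 hs Z hZ0 hZt => ?_⟩
  · exact ENNReal.mul_ne_top (by simp) (by simpa [tsub_eq_zero_iff_le] using hr)
  have hs0 := dyadic_ne_zero h0 hs
  have hst := dyadic_ne_top h1 hs
  have h2 : (2⁻¹ : ℝ≥0∞) * 2 = 1 := ENNReal.inv_mul_cancel (by simp) (by simp)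
  have hsum := sum_min_inv_le hr (x := fun i => (s i / Z) ^ γ) (fun i => by
    rw [← ENNReal.mul_rpow_of_nonneg _ _ hγ.le, hs, ← mul_div_assoc, ← mul_assoc, h2, one_mul])
  have hZγ : Z ^ γ ≠ ⊤ := ENNReal.rpow_ne_top_of_nonneg hγ.le hZt
  have e : ∀ i, s i = s i / Z * Z := fun i => (ENNReal.div_mul_cancel hZ0 hZt).symm
  constructor
  · calc _ ≤ ∑' i, min ((s i / Z) ^ γ) ((s i / Z) ^ γ)⁻¹ * Z ^ γ := by
          refine ENNReal.tsum_le_tsum fun i => ?_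
          split_ifs with h
          · have h3 : (s i / Z) ^ γ ≤ 1 :=
              ENNReal.rpow_le_one (ENNReal.div_le_of_le_mul (by simpa using h.le)) hγ.le
            rw [min_eq_left (h3.trans (by simpa using h3)),
              ← ENNReal.mul_rpow_of_nonneg _ _ hγ.le, ← e]
          · exact zero_le
      _ ≤ _ := by rw [ENNReal.tsum_mul_right]; gcongr
  · calc _ ≤ ∑' i, min ((s i / Z) ^ γ) ((s i / Z) ^ γ)⁻¹ * Z ^ (-γ) := by
          refine ENNReal.tsum_le_tsum fun i => ?_
          split_ifs with h
          · have h3 : 1 ≤ (s i / Z) ^ γ :=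
              ENNReal.one_le_rpow ((ENNReal.le_div_iff_mul_le (Or.inl hZ0) (Or.inl hZt)).2
                (by simpa using h)) hγ
            have h4 : ((s i / Z) ^ γ)⁻¹ ≤ (s i / Z) ^ γ :=
              le_trans (by simpa using h3) h3
            rw [min_eq_right h4, ← ENNReal.rpow_neg,
              ← ENNReal.mul_rpow_of_ne_zero (ENNReal.div_ne_zero.2 ⟨hs0 i, hZt⟩) hZ0, ← e]
          · exact zero_le
      _ ≤ _ := by rw [ENNReal.tsum_mul_right]; gcongr

theorem convMeas_add (κ : Measure ℝ) {v w : ℝ → ℝ≥0∞} (hv : Measurable v) (x : ℝ) :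
    convMeas κ (fun y => v y + w y) x = convMeas κ v x + convMeas κ w x := by
  unfold convMeas
  exact lintegral_add_left (hv.comp (measurable_const.sub measurable_id)) _

theorem convMeas_mono (κ : Measure ℝ) {v w : ℝ → ℝ≥0∞} (h : ∀ y, v y ≤ w y) (x : ℝ) :
    convMeas κ v x ≤ convMeas κ w x := lintegral_mono fun _ => h _

theorem convMeas_const_mul (κ : Measure ℝ) {v : ℝ → ℝ≥0∞} (hv : Measurable v) (c : ℝ≥0∞) (x : ℝ) :
    convMeas κ (fun y => c * v y) x = c * convMeas κ v x :=
  lintegral_const_mul _ (hv.comp (measurable_const.sub measurable_id))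

/-- Normalized form of `exists_low_freq_bound_of_ne_top`. -/
theorem exists_low_freq_bound_of_le_one {p q : ℝ} (hp : 1 < p) (hpq : p < q) {A : ℝ≥0∞}
    (hA : A ≠ ⊤) (hA0 : A ≠ 0) :
    ∃ C : ℝ≥0∞, C ≠ ⊤ ∧ ∀ (s : ℕ → ℝ≥0∞) (κ : ℕ → Measure ℝ) (v : ℝ → ℝ≥0∞),
      s 0 ≠ 0 → s 0 ≠ ⊤ → (∀ i, s (i + 1) = 2 * s i) → (∀ i, IsFiniteMeasure (κ i)) →
      (∀ i, GoodKernel A (s i) (κ i)) → Measurable v →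
      Function.Periodic v (2*π) → (∀ x, v x ≠ ⊤) → ∫⁻ x, v x ^ p ∂perMeas ≤ 1 →
      ∫⁻ x, (∑' i, s i ^ (-(1/p - 1/q)) * convMeas (κ i) v x) ^ q ∂perMeas ≤ C := by
  have hp0 : 0 < p := by linarith
  have hq0 : 0 < q := by linarith
  have hqp : 1 < q / p := (one_lt_div hp0).2 hpq
  have hpq1 : p / q < 1 := (div_lt_one hq0).2 hpq
  set θ := 1/p - 1/q with hθ
  have hθ0 : 0 < θ := by
    rw [hθ]; have := one_div_lt_one_div_of_lt hp0 hpq; linarith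
  have hr1 : (2⁻¹ : ℝ≥0∞) < 1 := by simp [ENNReal.inv_lt_one]
  set r := (p + q) / 2 with hr
  have hrp : p < r := by rw [hr]; linarith
  have hrq : r < q := by rw [hr]; linarith
  have hr0 : 0 < r := by linarith
  obtain ⟨C₁, hC₁, hS₁⟩ := exists_rpow_tsum_le one_pos (hp.trans hpq) hr1
  obtain ⟨C₂, hC₂, hS₂⟩ := exists_rpow_tsum_le hr0 hrq hr1
  have hγ₁ : 0 < 1 - 1/p := by have := (div_lt_one hp0).2 hp; linarith
  have hγ₂ : 0 < r/p - 1 := by have := (one_lt_div hp0).2 hrp; linarith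
  obtain ⟨D₁, hD₁, hG₁⟩ := exists_tsum_dyadic_le hγ₁
  obtain ⟨D₂, hD₂, hG₂⟩ := exists_tsum_dyadic_le hγ₂
  have hAq : A ^ q ≠ ⊤ := ENNReal.rpow_ne_top_of_nonneg hq0.le hA
  have hAA : ∀ u : ℝ, 0 < u → u < q → A ^ u * A ^ (q * (1 - u / q)) = A ^ q := fun u h0 h1 => by
    rw [← ENNReal.rpow_add _ _ hA0 hA]; congr 1; field_simp; ring
  refine ⟨2 ^ (q - 1) * (C₁ * (A ^ q * D₁) + C₂ * (A ^ q * D₂)), ?_,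
    fun s κ v h0 h1 hs hκ hg hv hper hvt hP => ?_⟩
  · refine ENNReal.mul_ne_top (ENNReal.rpow_ne_top_of_nonneg (by linarith) (by simp)) ?_
    exact ENNReal.add_ne_top.2 ⟨ENNReal.mul_ne_top hC₁ (ENNReal.mul_ne_top hAq hD₁),
      ENNReal.mul_ne_top hC₂ (ENNReal.mul_ne_top hAq hD₂)⟩
  have hs0 := dyadic_ne_zero h0 hs
  have hst := dyadic_ne_top h1 hs
  have h2 : (2⁻¹ : ℝ≥0∞) * 2 = 1 := ENNReal.inv_mul_cancel (by simp) (by simp)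
  set Λ : ℕ → ℝ≥0∞ := fun i => A ^ q * s i with hΛ
  have hΛt : ∀ i, Λ i ≠ ⊤ := fun i => ENNReal.mul_ne_top hAq (hst i)
  have hΛs : ∀ i, Λ i ≤ 2⁻¹ * Λ (i + 1) := fun i => by
    rw [hΛ]; simp only
    rw [hs, mul_left_comm, ← mul_assoc 2⁻¹, h2, one_mul]
  have hΛr : ∀ u : ℝ, u < q → 0 < u → ∀ i, Λ i ^ (1 - u / q) =
      A ^ (q * (1 - u / q)) * s i ^ (1 - u / q) := fun u hu hu0 i => by
    have : u / q < 1 := (div_lt_one hq0).2 hu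
    rw [hΛ]; simp only
    rw [ENNReal.mul_rpow_of_nonneg _ _ (by linarith), ← ENNReal.rpow_mul]
  have hvp : Measurable fun x => v x ^ p := hv.pow_const p
  -- the two pieces
  set v₁ : ℕ → ℝ → ℝ≥0∞ := fun i y => if s i < v y ^ p then v y else 0 with hv₁
  set v₂ : ℕ → ℝ → ℝ≥0∞ := fun i y => if v y ^ p ≤ s i then v y else 0 with hv₂
  have hm₁ : ∀ i, Measurable (v₁ i) := fun i =>
    Measurable.ite (measurableSet_lt measurable_const hvp) hv measurable_const
  have hm₂ : ∀ i, Measurable (v₂ i) := fun i =>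
    Measurable.ite (measurableSet_le hvp measurable_const) hv measurable_const
  have hp₁ : ∀ i, Function.Periodic (v₁ i) (2*π) := fun i y => by simp only [hv₁, hper y]
  have hp₂ : ∀ i, Function.Periodic (v₂ i) (2*π) := fun i y => by simp only [hv₂, hper y]
  have hle₁ : ∀ i y, v₁ i y ≤ v y := fun i y => by simp only [hv₁]; split_ifs <;> simp
  have hle₂ : ∀ i y, v₂ i y ≤ v y := fun i y => by simp only [hv₂]; split_ifs <;> simp
  set a₁ : ℕ → ℝ → ℝ≥0∞ := fun i x => s i ^ (-θ) * convMeas (κ i) (v₁ i) x with ha₁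
  set a₂ : ℕ → ℝ → ℝ≥0∞ := fun i x => s i ^ (-θ) * convMeas (κ i) (v₂ i) x with ha₂
  have hsplit : ∀ i x, s i ^ (-θ) * convMeas (κ i) v x = a₁ i x + a₂ i x := fun i x => by
    rw [ha₁, ha₂]; simp only
    rw [← mul_add, ← convMeas_add _ (hm₁ i)]
    congr 2
    ext y
    simp only [hv₁, hv₂]
    rcases lt_or_ge (s i) (v y ^ p) with h | h
    · simp [h, h.not_ge]
    · simp [h, h.not_gt]
  have hall : ∀ i x, s i ^ (-θ) * convMeas (κ i) v x ≤ Λ i ^ (1 / q) := fun i x => by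
    have e := (hg i).rpow_sup_le hv hper hp.le x
    have e2 : convMeas (κ i) v x ≤ A * s i ^ (1/p) := by
      calc convMeas (κ i) v x = (convMeas (κ i) v x ^ p) ^ (1 / p) := by
            rw [← ENNReal.rpow_mul, mul_one_div_cancel hp0.ne', ENNReal.rpow_one]
        _ ≤ (A ^ p * s i * 1) ^ (1 / p) := by
            refine ENNReal.rpow_le_rpow (e.trans ?_) (by positivity)
            exact mul_le_mul_right hP _
        _ = _ := by
            rw [mul_one, ENNReal.mul_rpow_of_nonneg _ _ (by positivity), ← ENNReal.rpow_mul,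
              mul_one_div_cancel hp0.ne', ENNReal.rpow_one]
    calc _ ≤ s i ^ (-θ) * (A * s i ^ (1/p)) := mul_le_mul_right e2 _
      _ = A * (s i ^ (-θ) * s i ^ (1/p)) := by ring
      _ = Λ i ^ (1 / q) := by
        rw [← ENNReal.rpow_add _ _ (hs0 i) (hst i), hΛ]
        simp only
        rw [ENNReal.mul_rpow_of_nonneg _ _ (by positivity), ← ENNReal.rpow_mul,
          mul_one_div_cancel hq0.ne', ENNReal.rpow_one, hθ]
        congr 2; ring
  have hall₁ : ∀ i x, a₁ i x ^ q ≤ Λ i := fun i x => by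
    rw [← ENNReal.le_rpow_inv_iff hq0, ← one_div]
    exact (mul_le_mul_right (convMeas_mono _ (hle₁ i) x) _).trans (hall i x)
  have hall₂ : ∀ i x, a₂ i x ^ q ≤ Λ i := fun i x => by
    rw [← ENNReal.le_rpow_inv_iff hq0, ← one_div]
    exact (mul_le_mul_right (convMeas_mono _ (hle₂ i) x) _).trans (hall i x)
  have hma₁ : ∀ i, Measurable (a₁ i) := fun i => (measurable_convMeas _ (hm₁ i)).const_mul _
  have hma₂ : ∀ i, Measurable (a₂ i) := fun i => (measurable_convMeas _ (hm₂ i)).const_mul _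
  have part₁ : ∫⁻ x, (∑' i, a₁ i x) ^ q ∂perMeas ≤ C₁ * (A ^ q * D₁) := by
    calc _ ≤ ∫⁻ x, C₁ * ∑' i, a₁ i x ^ (1:ℝ) * Λ i ^ (1 - 1/q) ∂perMeas :=
          lintegral_mono fun x => hS₁ _ _ hΛt (fun i => hall₁ i x) hΛs
      _ = C₁ * ∑' i, (∫⁻ x, a₁ i x ^ (1:ℝ) ∂perMeas) * Λ i ^ (1 - 1/q) := by
          rw [lintegral_const_mul, lintegral_tsum]
          · congr 2; ext i
            rw [lintegral_mul_const _ ((hma₁ i).pow_const _)]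
          · exact fun i => (((hma₁ i).pow_const _).mul_const _).aemeasurable
          · exact Measurable.tsum fun i => ((hma₁ i).pow_const _).mul_const _
      _ ≤ C₁ * ∑' i, A ^ q * (s i ^ (1 - 1/p) * ∫⁻ x, v₁ i x ∂perMeas) := by
          refine mul_le_mul_right (ENNReal.tsum_le_tsum fun i => ?_) _
          simp only [ENNReal.rpow_one, ha₁]
          rw [lintegral_const_mul _ (measurable_convMeas _ (hm₁ i)),
            lintegral_convMeas _ (hm₁ i) (hp₁ i), hΛr 1 (hp.trans hpq) one_pos,
            ← hAA 1 one_pos (hp.trans hpq), ENNReal.rpow_one]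
          have : s i ^ (1 - 1/p) = s i ^ (-θ) * s i ^ (1 - 1/q) := by
            rw [← ENNReal.rpow_add _ _ (hs0 i) (hst i), hθ]; congr 1; ring
          rw [this]
          calc _ ≤ s i ^ (-θ) * (A * ∫⁻ x, v₁ i x ∂perMeas) *
                (A ^ (q * (1 - 1/q)) * s i ^ (1 - 1/q)) := by
                refine mul_le_mul_left (mul_le_mul_right (mul_le_mul_left ?_ _) _) _
                exact (hg i).mass
            _ = _ := by ring
      _ = C₁ * (A ^ q * ∫⁻ x, ∑' i, s i ^ (1 - 1/p) * v₁ i x ∂perMeas) := by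
          rw [ENNReal.tsum_mul_left, lintegral_tsum]
          · congr 3; ext i
            rw [lintegral_const_mul _ (hm₁ i)]
          · exact fun i => ((hm₁ i).const_mul _).aemeasurable
      _ ≤ C₁ * (A ^ q * ∫⁻ x, D₁ * v x ^ p ∂perMeas) := by
          refine mul_le_mul_right (mul_le_mul_right (lintegral_mono fun x => ?_) _) _
          rcases eq_or_ne (v x) 0 with hx0 | hx0
          · simp [hv₁, hx0]
          have hvx0 : v x ^ p ≠ 0 := (ENNReal.rpow_pos (pos_iff_ne_zero.2 hx0) (hvt x)).ne'
          have hvxt : v x ^ p ≠ ⊤ := ENNReal.rpow_ne_top_of_nonneg hp0.le (hvt x)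
          have := (hG₁ s h0 h1 hs _ hvx0 hvxt).1
          calc ∑' i, s i ^ (1 - 1/p) * v₁ i x
              = (∑' i, if s i < v x ^ p then s i ^ (1 - 1/p) else 0) * v x := by
                rw [← ENNReal.tsum_mul_right]
                congr 1; ext i
                simp only [hv₁]; split_ifs <;> simp
            _ ≤ D₁ * (v x ^ p) ^ (1 - 1/p) * v x := by gcongr
            _ = _ := by
                rw [mul_assoc, ← ENNReal.rpow_mul]
                congr 1
                conv_lhs => rw [← ENNReal.rpow_one (v x), ← ENNReal.rpow_mul,
                  ← ENNReal.rpow_add _ _ hx0 (hvt x)]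
                congr 1; field_simp; ring
      _ ≤ _ := by
          rw [lintegral_const_mul _ hvp]
          refine mul_le_mul_right (mul_le_mul_right ?_ _) _
          simpa using mul_le_mul_right hP D₁
  have part₂ : ∫⁻ x, (∑' i, a₂ i x) ^ q ∂perMeas ≤ C₂ * (A ^ q * D₂) := by
    calc _ ≤ ∫⁻ x, C₂ * ∑' i, a₂ i x ^ r * Λ i ^ (1 - r/q) ∂perMeas :=
          lintegral_mono fun x => hS₂ _ _ hΛt (fun i => hall₂ i x) hΛs
      _ = C₂ * ∑' i, (∫⁻ x, a₂ i x ^ r ∂perMeas) * Λ i ^ (1 - r/q) := by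
          rw [lintegral_const_mul, lintegral_tsum]
          · congr 2; ext i
            rw [lintegral_mul_const _ ((hma₂ i).pow_const _)]
          · exact fun i => (((hma₂ i).pow_const _).mul_const _).aemeasurable
          · exact Measurable.tsum fun i => ((hma₂ i).pow_const _).mul_const _
      _ ≤ C₂ * ∑' i, A ^ q * (s i ^ (-(r/p - 1)) * ∫⁻ x, v₂ i x ^ r ∂perMeas) := by
          refine mul_le_mul_right (ENNReal.tsum_le_tsum fun i => ?_) _
          simp only [ha₂, ENNReal.mul_rpow_of_nonneg _ _ hr0.le]
          rw [lintegral_const_mul _ ((measurable_convMeas _ (hm₂ i)).pow_const _),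
            hΛr r hrq hr0, ← hAA r hr0 hrq]
          have : s i ^ (-(r/p - 1)) = (s i ^ (-θ)) ^ r * s i ^ (1 - r/q) := by
            rw [← ENNReal.rpow_mul, ← ENNReal.rpow_add _ _ (hs0 i) (hst i), hθ]; congr 1; ring
          rw [this]
          calc _ ≤ (s i ^ (-θ)) ^ r * (A ^ r * ∫⁻ x, v₂ i x ^ r ∂perMeas) *
                (A ^ (q * (1 - r/q)) * s i ^ (1 - r/q)) := by
                refine mul_le_mul_left (mul_le_mul_right ?_ _) _
                exact (hg i).lintegral_rpow_le (hm₂ i) (hp₂ i) (by linarith)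
            _ = _ := by ring
      _ = C₂ * (A ^ q * ∫⁻ x, ∑' i, s i ^ (-(r/p - 1)) * v₂ i x ^ r ∂perMeas) := by
          rw [ENNReal.tsum_mul_left, lintegral_tsum]
          · congr 3; ext i
            rw [lintegral_const_mul _ ((hm₂ i).pow_const _)]
          · exact fun i => (((hm₂ i).pow_const _).const_mul _).aemeasurable
      _ ≤ C₂ * (A ^ q * ∫⁻ x, D₂ * v x ^ p ∂perMeas) := by
          refine mul_le_mul_right (mul_le_mul_right (lintegral_mono fun x => ?_) _) _
          rcases eq_or_ne (v x) 0 with hx0 | hx0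
          · simp [hv₂, hx0, hr0]
          have hvx0 : v x ^ p ≠ 0 := (ENNReal.rpow_pos (pos_iff_ne_zero.2 hx0) (hvt x)).ne'
          have hvxt : v x ^ p ≠ ⊤ := ENNReal.rpow_ne_top_of_nonneg hp0.le (hvt x)
          have := (hG₂ s h0 h1 hs _ hvx0 hvxt).2
          calc ∑' i, s i ^ (-(r/p - 1)) * v₂ i x ^ r
              = (∑' i, if v x ^ p ≤ s i then s i ^ (-(r/p - 1)) else 0) * v x ^ r := by
                rw [← ENNReal.tsum_mul_right]
                congr 1; ext i
                simp only [hv₂]; split_ifs <;> simp [hr0]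
            _ ≤ D₂ * (v x ^ p) ^ (-(r/p - 1)) * v x ^ r := by gcongr
            _ = _ := by
                rw [mul_assoc, ← ENNReal.rpow_mul, ← ENNReal.rpow_add _ _ hx0 (hvt x)]
                congr 2; field_simp; ring
      _ ≤ _ := by
          rw [lintegral_const_mul _ hvp]
          refine mul_le_mul_right (mul_le_mul_right ?_ _) _
          simpa using mul_le_mul_right hP D₂
  calc _ = ∫⁻ x, (∑' i, a₁ i x + ∑' i, a₂ i x) ^ q ∂perMeas := by
        congr 1; ext x
        rw [← ENNReal.tsum_add]
        congr 2; ext i; exact hsplit i x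
    _ ≤ ∫⁻ x, 2 ^ (q - 1) * ((∑' i, a₁ i x) ^ q + (∑' i, a₂ i x) ^ q) ∂perMeas :=
        lintegral_mono fun x => ENNReal.rpow_add_le_mul_rpow_add_rpow _ _ (by linarith)
    _ = 2 ^ (q - 1) * (∫⁻ x, (∑' i, a₁ i x) ^ q ∂perMeas + ∫⁻ x, (∑' i, a₂ i x) ^ q ∂perMeas) := by
        have h1 : Measurable fun x => (∑' i, a₁ i x) ^ q := (Measurable.tsum hma₁).pow_const _
        have h2 : Measurable fun x => (∑' i, a₂ i x) ^ q := (Measurable.tsum hma₂).pow_const _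
        rw [← lintegral_add_left h1]
        exact lintegral_const_mul _ (h1.add h2)
    _ ≤ _ := by
        exact mul_le_mul_right (add_le_add part₁ part₂) _

/-- A Hardy–Littlewood–Sobolev type inequality for dyadic sums of positive kernels, acting on
finite-valued functions. -/
theorem exists_low_freq_bound_of_ne_top {p q : ℝ} (hp : 1 < p) (hpq : p < q) {A : ℝ≥0∞}
    (hA : A ≠ ⊤) (hA0 : A ≠ 0) :
    ∃ C : ℝ≥0∞, C ≠ ⊤ ∧ ∀ (s : ℕ → ℝ≥0∞) (κ : ℕ → Measure ℝ) (v : ℝ → ℝ≥0∞),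
      s 0 ≠ 0 → s 0 ≠ ⊤ → (∀ i, s (i + 1) = 2 * s i) → (∀ i, IsFiniteMeasure (κ i)) →
      (∀ i, GoodKernel A (s i) (κ i)) → Measurable v →
      Function.Periodic v (2*π) → (∀ x, v x ≠ ⊤) →
      ∫⁻ x, (∑' i, s i ^ (-(1/p - 1/q)) * convMeas (κ i) v x) ^ q ∂perMeas ≤
        C * (∫⁻ x, v x ^ p ∂perMeas) ^ (q / p) := by
  have hp0 : 0 < p := by linarith
  have hq0 : 0 < q := by linarith
  obtain ⟨C, hC, hS⟩ := exists_low_freq_bound_of_le_one hp hpq hA hA0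
  refine ⟨C + 1, by simp [hC], fun s κ v h0 h1 hs hκ hg hv hper hvt => ?_⟩
  set P := ∫⁻ x, v x ^ p ∂perMeas with hP
  rcases eq_or_ne P 0 with hP0 | hP0
  · have : ∀ i x, convMeas (κ i) v x = 0 := fun i x => by
      have := (hg i).rpow_sup_le hv hper hp.le x
      rw [← hP, hP0, mul_zero, nonpos_iff_eq_zero] at this
      simpa [hp0, hp0.not_gt] using this
    simp [this, hq0]
  rcases eq_or_ne P ⊤ with hPt | hPt
  · rw [hPt, ENNReal.top_rpow_of_pos (by positivity), ENNReal.mul_top (by simp)]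
    exact le_top
  set N := P ^ (1 / p) with hN
  have hN0 : N ≠ 0 := (ENNReal.rpow_pos (pos_iff_ne_zero.2 hP0) hPt).ne'
  have hNt : N ≠ ⊤ := ENNReal.rpow_ne_top_of_nonneg (by positivity) hPt
  have hNp : N ^ p = P := by
    rw [hN, ← ENNReal.rpow_mul, one_div_mul_cancel hp0.ne', ENNReal.rpow_one]
  have hNq : N ^ q = P ^ (q / p) := by
    rw [hN, ← ENNReal.rpow_mul]; congr 1; ring
  have hw : Measurable fun x => N⁻¹ * v x := hv.const_mul _
  have key := hS s κ (fun x => N⁻¹ * v x) h0 h1 hs hκ hg hw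
    (fun x => by simp only [hper x]) (fun x => ENNReal.mul_ne_top (by simpa using hN0) (hvt x)) (by
      simp only [ENNReal.mul_rpow_of_nonneg _ _ hp0.le]
      rw [lintegral_const_mul _ (hv.pow_const p), ← hP, ENNReal.inv_rpow, hNp,
        ENNReal.inv_mul_cancel hP0 hPt])
  have hm : Measurable fun x => (∑' i, s i ^ (-(1/p - 1/q)) * convMeas (κ i) v x) ^ q :=
    (Measurable.tsum fun i => (measurable_convMeas _ hv).const_mul _).pow_const _
  have e : ∀ x, (∑' i, s i ^ (-(1/p - 1/q)) * convMeas (κ i) (fun x => N⁻¹ * v x) x) ^ q =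
      N⁻¹ ^ q * (∑' i, s i ^ (-(1/p - 1/q)) * convMeas (κ i) v x) ^ q := fun x => by
    rw [← ENNReal.mul_rpow_of_nonneg _ _ hq0.le, ← ENNReal.tsum_mul_left]
    congr 2; ext i
    rw [convMeas_const_mul _ hv]; ring
  simp only [e] at key
  rw [lintegral_const_mul _ hm, ENNReal.inv_rpow, hNq] at key
  have hQ0 : P ^ (q / p) ≠ 0 := (ENNReal.rpow_pos (pos_iff_ne_zero.2 hP0) hPt).ne'
  have hQt : P ^ (q / p) ≠ ⊤ := ENNReal.rpow_ne_top_of_nonneg (by positivity) hPt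
  rw [mul_comm, ← div_eq_mul_inv, ENNReal.div_le_iff hQ0 hQt] at key
  exact key.trans (by gcongr; exact le_self_add)

/-- A Hardy–Littlewood–Sobolev type inequality for dyadic sums of positive kernels. -/
theorem exists_low_freq_bound {p q : ℝ} (hp : 1 < p) (hpq : p < q) {A : ℝ≥0∞}
    (hA : A ≠ ⊤) (hA0 : A ≠ 0) :
    ∃ C : ℝ≥0∞, C ≠ ⊤ ∧ ∀ (s : ℕ → ℝ≥0∞) (κ : ℕ → Measure ℝ) (v : ℝ → ℝ≥0∞),
      s 0 ≠ 0 → s 0 ≠ ⊤ → (∀ i, s (i + 1) = 2 * s i) → (∀ i, IsFiniteMeasure (κ i)) →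
      (∀ i, GoodKernel A (s i) (κ i)) → Measurable v → Function.Periodic v (2*π) →
      ∫⁻ x, (∑' i, s i ^ (-(1/p - 1/q)) * convMeas (κ i) v x) ^ q ∂perMeas ≤
        C * (∫⁻ x, v x ^ p ∂perMeas) ^ (q / p) := by
  have hp0 : 0 < p := by linarith
  have hq0 : 0 < q := by linarith
  obtain ⟨C, hC, hS⟩ := exists_low_freq_bound_of_ne_top hp hpq hA hA0
  refine ⟨C + 1, by simp [hC], fun s κ v h0 h1 hs hκ hg hv hper => ?_⟩
  rcases eq_or_ne (∫⁻ x, v x ^ p ∂perMeas) ⊤ with hPt | hPt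
  · rw [hPt, ENNReal.top_rpow_of_pos (by positivity), ENNReal.mul_top (by simp)]
    exact le_top
  have hae : ∀ᵐ x ∂perMeas, v x < ⊤ := by
    filter_upwards [ae_lt_top (hv.pow_const p) hPt] with x hx
    by_contra h
    rw [not_lt, top_le_iff] at h
    simp [h, hp0] at hx
  have hms : MeasurableSet {x | v x = ⊤} := hv (measurableSet_singleton _)
  set w : ℝ → ℝ≥0∞ := fun x => if v x = ⊤ then 0 else v x with hw
  set z : ℝ → ℝ≥0∞ := fun x => if v x = ⊤ then ⊤ else 0 with hz
  have hwm : Measurable w := Measurable.ite hms measurable_const hv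
  have hzm : Measurable z := Measurable.ite hms measurable_const measurable_const
  have hwp : Function.Periodic w (2*π) := fun x => by simp only [hw, hper x]
  have hzp : Function.Periodic z (2*π) := fun x => by simp only [hz, hper x]
  have hz0 : ∫⁻ x, z x ∂perMeas = 0 := by
    rw [lintegral_eq_zero_iff hzm]
    filter_upwards [hae] with x hx
    simp [hz, hx.ne]
  have hvw : ∀ i x, convMeas (κ i) v x = convMeas (κ i) w x := fun i x => by
    have h2 : convMeas (κ i) z x = 0 := by
      have := (hg i).sup_le z hzm hzp x
      rwa [hz0, mul_zero, nonpos_iff_eq_zero] at this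
    rw [← add_zero (convMeas (κ i) w x), ← h2, ← convMeas_add _ hwm]
    congr 1; ext y
    simp only [hw, hz]
    split_ifs with h <;> simp [h]
  have hIw : ∫⁻ x, v x ^ p ∂perMeas = ∫⁻ x, w x ^ p ∂perMeas := by
    refine lintegral_congr_ae ?_
    filter_upwards [hae] with x hx
    simp [hw, hx.ne]
  simp only [hvw, hIw]
  refine (hS s κ w h0 h1 hs hκ hg hwm hwp (fun x => ?_)).trans (by gcongr; exact le_self_add)
  simp only [hw]; split_ifs with h
  · simp
  · exact h

/-- The measure with density `t / (t² + x²)`. -/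
def cauchyMeas (t : ℝ) : Measure ℝ :=
  volume.withDensity fun x => ENNReal.ofReal (t / (t^2 + x^2))

theorem measurable_cauchyDensity (t : ℝ) :
    Measurable fun x : ℝ => ENNReal.ofReal (t / (t^2 + x^2)) := by fun_prop

theorem convMeas_cauchyMeas (t : ℝ) {v : ℝ → ℝ≥0∞} (hv : Measurable v) (x : ℝ) :
    convMeas (cauchyMeas t) v x = ∫⁻ s, ENNReal.ofReal (t / (t^2 + s^2)) * v (x - s) := by
  unfold convMeas cauchyMeas
  exact lintegral_withDensity_eq_lintegral_mul _ (measurable_cauchyDensity t)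
    (hv.comp (measurable_const.sub measurable_id))

theorem cauchyMeas_univ {t : ℝ} (ht : 0 < t) : cauchyMeas t Set.univ = ENNReal.ofReal π := by
  have h1 : Integrable fun x : ℝ => t / (t^2 + x^2) := by
    have := (integrable_inv_one_add_sq.comp_div ht.ne').const_mul t⁻¹
    refine this.congr (Filter.Eventually.of_forall fun x => ?_)
    simp only; field_simp
  have h2 : ∫ x : ℝ, t / (t^2 + x^2) = π := by
    have := Measure.integral_comp_div (fun x : ℝ => (1 + x^2)⁻¹) t
    rw [integral_univ_inv_one_add_sq, abs_of_pos ht] at this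
    calc _ = ∫ x : ℝ, t⁻¹ * (1 + (x / t)^2)⁻¹ := by
          congr 1; ext x; field_simp
      _ = _ := by
          rw [integral_const_mul, this, smul_eq_mul, inv_mul_cancel_left₀ ht.ne']
  unfold cauchyMeas
  rw [withDensity_apply _ MeasurableSet.univ, Measure.restrict_univ,
    ← ofReal_integral_eq_lintegral_ofReal h1 (Filter.Eventually.of_forall fun x => by positivity),
    h2]

theorem isFiniteMeasure_cauchyMeas {t : ℝ} (ht : 0 < t) : IsFiniteMeasure (cauchyMeas t) :=
  ⟨by rw [cauchyMeas_univ ht]; exact ENNReal.ofReal_lt_top⟩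

theorem lintegral_perMeas_neg {v : ℝ → ℝ≥0∞} (hper : Function.Periodic v (2*π)) :
    ∫⁻ x, v (-x) ∂perMeas = ∫⁻ x, v x ∂perMeas := by
  have h2 : ∀ w, v (-w) = v (2*π - w) := fun w => by rw [hper.sub_eq']
  unfold perMeas
  simp only [h2]
  rw [← setLIntegral_congr Ioo_ae_eq_Ioc, ← setLIntegral_congr Ioo_ae_eq_Ioc]
  have := ((volume : Measure ℝ).measurePreserving_sub_left
    (2*π)).setLIntegral_comp_preimage_emb
    (MeasurableEquiv.subLeft (2*π)).measurableEmbedding v (Set.Ioo 0 (2*π))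
  rw [← this]
  congr 2
  ext w; simp only [Set.mem_Ioo, Set.mem_preimage]
  constructor <;> rintro ⟨h1, h2⟩ <;> constructor <;> linarith

theorem lintegral_eq_tsum_perMeas (f : ℝ → ℝ≥0∞) :
    ∫⁻ x, f x = ∑' n : ℤ, ∫⁻ x, f (x + n * (2*π)) ∂perMeas := by
  have hpos : (0:ℝ) < 2*π := by positivity
  rw [← setLIntegral_univ, ← iUnion_Ioc_add_zsmul hpos 0,
    lintegral_iUnion (fun n => measurableSet_Ioc) (Set.pairwise_disjoint_Ioc_add_zsmul 0 (2*π))]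
  congr 1; ext n
  unfold perMeas
  have := (measurePreserving_add_right (volume : Measure ℝ)
      ((n:ℝ) * (2*π))).setLIntegral_comp_preimage_emb
      (MeasurableEquiv.addRight ((n:ℝ) * (2*π))).measurableEmbedding f
      (Set.Ioc (0 + n • (2*π)) (0 + (n + 1) • (2*π)))
  rw [← this]
  congr 2
  ext x
  simp only [Set.mem_Ioc, Set.mem_preimage, zsmul_eq_mul]
  push_cast
  constructor <;> rintro ⟨h1, h2⟩ <;> constructor <;> linarith

theorem exists_goodKernel_cauchyMeas : ∃ A : ℝ≥0∞, A ≠ ⊤ ∧ A ≠ 0 ∧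
    ∀ t : ℝ, 0 < t → t ≤ 2 → GoodKernel A (ENNReal.ofReal t)⁻¹ (cauchyMeas t) := by
  have hS : Summable fun k : ℤ => 3 / (1 + (k:ℝ)^2) := by
    have h2 : Summable fun k : ℤ => 3 * (1 / (k:ℝ)^2) :=
      (Real.summable_one_div_int_pow.2 one_lt_two).mul_left 3
    refine Summable.of_norm_bounded_eventually h2 ?_
    filter_upwards [(Set.finite_singleton (0:ℤ)).compl_mem_cofinite] with k hk
    have : (k:ℝ) ≠ 0 := by exact_mod_cast hk
    have h3 : 0 < (k:ℝ)^2 := by positivity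
    rw [Real.norm_of_nonneg (by positivity), mul_one_div]
    gcongr; linarith
  set B := ∑' k : ℤ, ENNReal.ofReal (3 / (1 + (k:ℝ)^2)) with hB
  have hBt : B ≠ ⊤ := hS.tsum_ofReal_ne_top
  refine ⟨ENNReal.ofReal π + B, by simp [hBt], by simp [pi_pos], fun t ht ht2 => ⟨?_, ?_⟩⟩
  · rw [cauchyMeas_univ ht]; exact le_self_add
  intro v hv hper x
  have hpos : (0:ℝ) < 2*π := by positivity
  have hsum : ∀ y : ℝ, ∑' n : ℤ, ENNReal.ofReal (t / (t^2 + (y + n * (2*π))^2)) ≤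
      B * (ENNReal.ofReal t)⁻¹ := fun y => by
    obtain ⟨m, hm, -⟩ := existsUnique_add_zsmul_mem_Ico hpos y 0
    set y₀ := y + m • (2*π) with hy
    rw [← (Equiv.addRight m).tsum_eq, hB, ← ENNReal.tsum_mul_right]
    refine ENNReal.tsum_le_tsum fun k => ?_
    rw [← ENNReal.ofReal_inv_of_pos ht, ← ENNReal.ofReal_mul (by positivity)]
    refine ENNReal.ofReal_le_ofReal ?_
    have e : y + ((Equiv.addRight m) k : ℤ) * (2*π) = y₀ + k * (2*π) := by
      rw [hy, zsmul_eq_mul]; simp only [Equiv.coe_addRight]; push_cast; ring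
    rw [e]
    have h0 := hm.1
    have h1 : y₀ < 2*π := by simpa using hm.2
    set z := y₀ + k * (2*π) with hz
    have hk : (k:ℝ) * (2*π) = z - y₀ := by rw [hz]; ring
    have hk2 : (k:ℝ)^2 * (4*π^2) ≤ 2*z^2 + 8*π^2 := by
      have : (k:ℝ)^2 * (4*π^2) = (z - y₀)^2 := by rw [← hk]; ring
      rw [this]; nlinarith [sq_nonneg (z + y₀)]
    have hpi : 3 < π := pi_gt_three
    have hk3 : 1 + (k:ℝ)^2 ≤ 3 * (1 + z^2 / 4) := by
      have h9 : 9 ≤ π^2 := by nlinarith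
      by_contra hcon
      push Not at hcon
      nlinarith [sq_nonneg z]
    have h4 : t^2 * (1 + z^2/4) ≤ t^2 + z^2 := by
      have : t^2 ≤ 4 := by nlinarith
      nlinarith [sq_nonneg z]
    rw [← div_eq_mul_inv, div_div, div_le_div_iff₀ (by positivity) (by positivity)]
    calc t * ((1 + (k:ℝ)^2) * t) = t^2 * (1 + (k:ℝ)^2) := by ring
      _ ≤ t^2 * (3 * (1 + z^2/4)) := by gcongr
      _ ≤ 3 * (t^2 + z^2) := by linarith
  rw [convMeas_cauchyMeas t hv, lintegral_eq_tsum_perMeas]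
  have hm0 : ∀ n : ℤ, Measurable fun u : ℝ => ENNReal.ofReal (t / (t^2 + (u + n * (2*π))^2)) :=
    fun n => by fun_prop
  have hvm : Measurable fun u : ℝ => v (x - u) := hv.comp (measurable_const.sub measurable_id)
  calc ∑' n : ℤ, ∫⁻ u, ENNReal.ofReal (t / (t^2 + (u + n * (2*π))^2)) * v (x - (u + n * (2*π)))
        ∂perMeas
      = ∫⁻ u, (∑' n : ℤ, ENNReal.ofReal (t / (t^2 + (u + n * (2*π))^2))) * v (x - u) ∂perMeas := by
        rw [← lintegral_tsum]
        · congr 1; ext u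
          rw [← ENNReal.tsum_mul_right]
          congr 1; ext n
          rw [← sub_sub, hper.sub_int_mul_eq]
        · intro n
          exact ((hm0 n).mul (hv.comp (by fun_prop))).aemeasurable
    _ ≤ ∫⁻ u, B * (ENNReal.ofReal t)⁻¹ * v (x - u) ∂perMeas := by
        refine lintegral_mono fun u => mul_le_mul_left (hsum u) _
    _ = B * (ENNReal.ofReal t)⁻¹ * ∫⁻ u, v u ∂perMeas := by
        rw [lintegral_const_mul _ hvm]
        congr 1
        have h1 : (fun u => v (x - u)) = fun u => (fun w => v (-w)) (u - x) := by
          ext u; simp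
        have hper' : Function.Periodic (fun w => v (-w)) (2*π) := fun w => by
          simp only [neg_add]; rw [← sub_eq_add_neg, hper.sub_eq]
        rw [h1, lintegral_perMeas_sub hper']
        exact lintegral_perMeas_neg hper
    _ ≤ _ := by gcongr; exact le_add_self

/-- The dyadic multiple of `η` lying in `[1, 2]`. -/
def topScale (η : ℝ) : ℝ := 2 ^ ⌈logb 2 (1 / η)⌉₊ * η

theorem topScale_mem {η : ℝ} (h0 : 0 < η) (h1 : η ≤ 1) : 1 ≤ topScale η ∧ topScale η ≤ 2 := by
  have hl : 0 ≤ logb 2 (1 / η) := logb_nonneg one_lt_two (by rw [le_div_iff₀ h0]; linarith)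
  have e : (2:ℝ) ^ logb 2 (1 / η) = 1 / η := rpow_logb two_pos (by norm_num) (by positivity)
  have a := Nat.le_ceil (logb 2 (1 / η))
  have b := (Nat.ceil_lt_add_one hl).le
  have a' := Real.rpow_le_rpow_of_exponent_le one_le_two a
  have b' := Real.rpow_le_rpow_of_exponent_le one_le_two b
  rw [e, rpow_natCast] at a'
  rw [rpow_add two_pos, e, rpow_natCast, rpow_one] at b'
  unfold topScale
  constructor
  · calc (1:ℝ) = 1 / η * η := by field_simp
      _ ≤ _ := by gcongr
  · calc _ ≤ 1 / η * 2 * η := by gcongr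
      _ = 2 := by field_simp

/-- The weight attached to the `k`-th scale. -/
def scaleWeight (γ η : ℝ) (k : ℕ) : ℝ≥0∞ := (ENNReal.ofReal (η / 2 ^ (k - 1)))⁻¹ ^ γ

/-- The positive operator majorizing a function in terms of its differences at all dyadic scales:
the entry `v 0` carries the low frequencies and `v (k + 1)` the frequencies around `2 ^ k / η`. -/
def majOp (θ η : ℝ) (v : ℕ → ℝ → ℝ≥0∞) (x : ℝ) : ℝ≥0∞ :=
  (ENNReal.ofReal η) ^ (-θ) * (∑' i : ℕ, (ENNReal.ofReal (topScale η / 2 ^ i)) ^ θ *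
    convMeas (cauchyMeas (topScale η / 2 ^ i)) (v 0) x) +
  ∑' k : ℕ, convMeas (cauchyMeas (η / 2 ^ k)) (v (k + 1)) x

theorem inv_ofReal_div_two_pow_succ {t : ℝ} (ht : 0 < t) (i : ℕ) :
    (ENNReal.ofReal (t / 2 ^ (i + 1)))⁻¹ = 2 * (ENNReal.ofReal (t / 2 ^ i))⁻¹ := by
  rw [← ENNReal.ofReal_inv_of_pos (by positivity), ← ENNReal.ofReal_inv_of_pos (by positivity),
    show (2:ℝ≥0∞) = ENNReal.ofReal 2 by simp, ← ENNReal.ofReal_mul (by norm_num)]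
  congr 1
  field_simp
  ring

instance (t : ℝ) : SFinite (cauchyMeas t) := by unfold cauchyMeas; infer_instance

theorem measurable_majOp (θ η : ℝ) {v : ℕ → ℝ → ℝ≥0∞} (hv : ∀ i, Measurable (v i)) :
    Measurable (majOp θ η v) :=
  ((Measurable.tsum fun _ => (measurable_convMeas _ (hv _)).const_mul _).const_mul _).add
    (Measurable.tsum fun _ => measurable_convMeas _ (hv _))

theorem exists_majOp_bound {p q : ℝ} (hp : 1 < p) (hpq : p < q) :
    ∃ C : ℝ≥0∞, C ≠ ⊤ ∧ ∀ (η : ℝ) (v : ℕ → ℝ → ℝ≥0∞), 0 < η → η ≤ 1 →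
      (∀ i, Measurable (v i)) → (∀ i, Function.Periodic (v i) (2*π)) →
      ∫⁻ x, (majOp (1/p - 1/q) η v x) ^ q ∂perMeas ≤
        C * ∑' k, scaleWeight (q / p - 1) η k * (∫⁻ x, v k x ^ p ∂perMeas) ^ (q / p) := by
  have hp0 : 0 < p := by linarith
  have hq0 : 0 < q := by linarith
  obtain ⟨A, hAt, hA0, hA⟩ := exists_goodKernel_cauchyMeas
  obtain ⟨C₁, hC₁, hL⟩ := exists_low_freq_bound hp hpq hAt hA0
  obtain ⟨C₂, hC₂, hH⟩ := exists_high_freq_bound hp hpq hAt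
  refine ⟨2 ^ (q - 1) * (C₁ + C₂), ?_, fun η v h0 h1 hv hper => ?_⟩
  · exact ENNReal.mul_ne_top (ENNReal.rpow_ne_top_of_nonneg (by linarith) (by simp))
      (by simp [hC₁, hC₂])
  obtain ⟨hT1, hT2⟩ := topScale_mem h0 h1
  have hT0 : 0 < topScale η := by linarith
  have hdiv : ∀ (t : ℝ) (i : ℕ), 0 < t → t / 2 ^ i ≤ t := fun t i ht =>
    div_le_self ht.le (one_le_pow₀ one_le_two)
  set θ := 1/p - 1/q with hθ
  have hL' := hL (fun i => (ENNReal.ofReal (topScale η / 2 ^ i))⁻¹)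
    (fun i => cauchyMeas (topScale η / 2 ^ i)) (v 0) (by simp) (by simp [hT0])
    (fun i => inv_ofReal_div_two_pow_succ hT0 i)
    (fun i => isFiniteMeasure_cauchyMeas (by positivity))
    (fun i => hA _ (by positivity) ((hdiv _ i hT0).trans hT2)) (hv 0) (hper 0)
  have hH' := hH (fun i => (ENNReal.ofReal (η / 2 ^ i))⁻¹)
    (fun i => cauchyMeas (η / 2 ^ i)) (fun i => v (i + 1)) (by simp) (by simp [h0])
    (fun i => inv_ofReal_div_two_pow_succ h0 i)
    (fun i => isFiniteMeasure_cauchyMeas (by positivity))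
    (fun i => hA _ (by positivity) ((hdiv _ i h0).trans (by linarith)))
    (fun i => hv _) (fun i => hper _)
  simp only [ENNReal.inv_rpow, ENNReal.rpow_neg, inv_inv] at hL'
  set a : ℝ → ℝ≥0∞ := fun x => (ENNReal.ofReal η) ^ (-θ) *
    (∑' i : ℕ, (ENNReal.ofReal (topScale η / 2 ^ i)) ^ θ *
    convMeas (cauchyMeas (topScale η / 2 ^ i)) (v 0) x) with ha
  set b : ℝ → ℝ≥0∞ := fun x => ∑' k : ℕ, convMeas (cauchyMeas (η / 2 ^ k)) (v (k + 1)) x with hb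
  have hcm : Measurable fun x => ∑' i : ℕ, (ENNReal.ofReal (topScale η / 2 ^ i)) ^ θ *
      convMeas (cauchyMeas (topScale η / 2 ^ i)) (v 0) x :=
    Measurable.tsum fun _ => (measurable_convMeas _ (hv _)).const_mul _
  have ham : Measurable a := hcm.const_mul _
  have hbm : Measurable b := Measurable.tsum fun _ => measurable_convMeas _ (hv _)
  have hw0 : ((ENNReal.ofReal η) ^ (-θ)) ^ q = scaleWeight (q / p - 1) η 0 := by
    unfold scaleWeight
    rw [← ENNReal.rpow_mul, ENNReal.inv_rpow, ← ENNReal.rpow_neg, hθ]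
    simp only [Nat.zero_sub, pow_zero, div_one]
    congr 1; field_simp
  have h3 : ∫⁻ x, a x ^ q ∂perMeas ≤ C₁ * (scaleWeight (q / p - 1) η 0 *
      (∫⁻ x, v 0 x ^ p ∂perMeas) ^ (q / p)) := by
    simp only [ha, ENNReal.mul_rpow_of_nonneg _ _ hq0.le]
    rw [lintegral_const_mul _ (hcm.pow_const q), hw0]
    calc _ ≤ scaleWeight (q / p - 1) η 0 * (C₁ * (∫⁻ x, v 0 x ^ p ∂perMeas) ^ (q / p)) :=
          mul_le_mul_right hL' _
      _ = _ := by ring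
  have h4 : ∫⁻ x, b x ^ q ∂perMeas ≤ C₂ * ∑' k, scaleWeight (q / p - 1) η (k + 1) *
      (∫⁻ x, v (k + 1) x ^ p ∂perMeas) ^ (q / p) := hH'
  have h5 : ∑' k, scaleWeight (q / p - 1) η k * (∫⁻ x, v k x ^ p ∂perMeas) ^ (q / p) =
      scaleWeight (q / p - 1) η 0 * (∫⁻ x, v 0 x ^ p ∂perMeas) ^ (q / p) +
      ∑' k, scaleWeight (q / p - 1) η (k + 1) * (∫⁻ x, v (k + 1) x ^ p ∂perMeas) ^ (q / p) :=
    tsum_eq_zero_add' ENNReal.summable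
  have h6 : Measurable fun x => a x ^ q := ham.pow_const q
  have h7 : Measurable fun x => b x ^ q := hbm.pow_const q
  calc _ ≤ ∫⁻ x, 2 ^ (q - 1) * (a x ^ q + b x ^ q) ∂perMeas :=
        lintegral_mono fun x => ENNReal.rpow_add_le_mul_rpow_add_rpow _ _ (by linarith)
    _ = 2 ^ (q - 1) * (∫⁻ x, a x ^ q ∂perMeas + ∫⁻ x, b x ^ q ∂perMeas) := by
        rw [← lintegral_add_left h6]
        exact lintegral_const_mul _ (h6.add h7)
    _ ≤ 2 ^ (q - 1) * ((C₁ + C₂) * ∑' k, scaleWeight (q / p - 1) η k *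
          (∫⁻ x, v k x ^ p ∂perMeas) ^ (q / p)) := by
        refine mul_le_mul_right ?_ _
        rw [h5]
        calc _ ≤ _ := add_le_add h3 h4
          _ ≤ _ := add_le_add (mul_le_mul_left le_self_add _) (mul_le_mul_left le_add_self _)
          _ = _ := (mul_add _ _ _).symm
    _ = _ := (mul_assoc _ _ _).symm

theorem tsum_Lp_le {Y : Type*} [MeasurableSpace Y] (ν : Measure Y) [IsFiniteMeasure ν] {p : ℝ}
    (hp : 1 < p) {F : ℕ → Y → ℝ≥0∞} (hF : ∀ i, Measurable (F i)) :
    (∫⁻ y, (∑' i, F i y) ^ p ∂ν) ^ (1 / p) ≤ ∑' i, (∫⁻ y, F i y ^ p ∂ν) ^ (1 / p) := by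
  have := lintegral_Lp_lintegral_le (Measure.count (α := ℕ)) ν hp (F := F)
    (measurable_from_prod_countable_right hF)
  simpa only [lintegral_count] using this

theorem const_mul_Lp {Y : Type*} [MeasurableSpace Y] (ν : Measure Y) {p : ℝ}
    (hp : 0 < p) {F : Y → ℝ≥0∞} (hF : Measurable F) (c : ℝ≥0∞) :
    (∫⁻ y, (c * F y) ^ p ∂ν) ^ (1 / p) = c * (∫⁻ y, F y ^ p ∂ν) ^ (1 / p) := by
  simp only [ENNReal.mul_rpow_of_nonneg _ _ hp.le]
  rw [lintegral_const_mul _ (hF.pow_const p), ENNReal.mul_rpow_of_nonneg _ _ (by positivity),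
    ← ENNReal.rpow_mul, mul_one_div_cancel hp.ne', ENNReal.rpow_one]

theorem convMeas_Lp_le (κ : Measure ℝ) [SFinite κ] {p : ℝ} (hp : 1 < p)
    {F : ℝ → ℝ → ℝ≥0∞} (hF : Measurable (Function.uncurry F)) (y : ℝ) :
    (∫⁻ x, (convMeas κ (F x) y) ^ p ∂perMeas) ^ (1 / p) ≤
      convMeas κ (fun y => (∫⁻ x, F x y ^ p ∂perMeas) ^ (1 / p)) y := by
  unfold convMeas
  refine lintegral_Lp_lintegral_le κ perMeas hp (F := fun s x => F x (y - s)) ?_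
  exact hF.comp (measurable_snd.prodMk (measurable_const.sub measurable_fst))

theorem measurable_convMeas_uncurry (κ : Measure ℝ) [SFinite κ]
    {F : ℝ → ℝ → ℝ≥0∞} (hF : Measurable (Function.uncurry F)) (y : ℝ) :
    Measurable fun x => convMeas κ (F x) y := by
  unfold convMeas
  exact Measurable.lintegral_prod_right' (f := fun z : ℝ × ℝ => F z.1 (y - z.2))
    (hF.comp (measurable_fst.prodMk (measurable_const.sub measurable_snd)))

theorem majOp_Lp_le {θ η p : ℝ} (hp : 1 < p) {F : ℕ → ℝ → ℝ → ℝ≥0∞}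
    (hF : ∀ k, Measurable (Function.uncurry (F k))) (y : ℝ) :
    (∫⁻ x, (majOp θ η (fun k => F k x) y) ^ p ∂perMeas) ^ (1 / p) ≤
      majOp θ η (fun k y => (∫⁻ x, F k x y ^ p ∂perMeas) ^ (1 / p)) y := by
  have hp0 : 0 < p := by linarith
  unfold majOp
  have hm := fun (t : ℝ) k => measurable_convMeas_uncurry (cauchyMeas t) (hF k) y
  have hm1 : Measurable fun x => ∑' i : ℕ, (ENNReal.ofReal (topScale η / 2 ^ i)) ^ θ *
    convMeas (cauchyMeas (topScale η / 2 ^ i)) (F 0 x) y :=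
    Measurable.tsum fun _ => (hm _ _).const_mul _
  refine (ENNReal.lintegral_Lp_add_le (hm1.const_mul _).aemeasurable
    (Measurable.tsum fun _ => hm _ _).aemeasurable hp.le).trans (add_le_add ?_ ?_)
  · rw [const_mul_Lp _ hp0 hm1]
    refine mul_le_mul_right ((tsum_Lp_le _ hp fun i => (hm _ _).const_mul _).trans ?_) _
    refine ENNReal.tsum_le_tsum fun i => ?_
    rw [const_mul_Lp _ hp0 (hm _ _)]
    exact mul_le_mul_right (convMeas_Lp_le _ hp (hF 0) y) _
  · refine (tsum_Lp_le _ hp fun i => hm _ _).trans ?_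
    exact ENNReal.tsum_le_tsum fun i => convMeas_Lp_le _ hp (hF _) y

/-- The coefficients `(-1)^ν C(γ,ν)` of the fractional difference of order `γ`. -/
def diffCoeff (γ : ℝ) (ν : ℕ) : ℝ := (-1) ^ ν * fracBinom γ ν

theorem fracBinom_eq_choose (γ : ℝ) (n : ℕ) : fracBinom γ n = Ring.choose γ n := by
  induction n with
  | zero => simp [fracBinom]
  | succ n ih =>
    rw [fracBinom, ih, Ring.choose_eq_smul, Ring.choose_eq_smul, descPochhammer_succ_right,
      Polynomial.smeval_mul, Nat.factorial_succ]
    simp only [Polynomial.smeval_sub, Polynomial.smeval_X, Polynomial.smeval_natCast, smul_eq_mul,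
      pow_one, pow_zero, nsmul_eq_mul, mul_one]
    push_cast
    have : ((n:ℝ) + 1) ≠ 0 := by positivity
    field_simp

theorem diffCoeff_succ (γ : ℝ) (n : ℕ) :
    diffCoeff γ (n + 1) * (n + 1) = diffCoeff γ n * (n - γ) := by
  have : ((n:ℝ) + 1) ≠ 0 := by positivity
  simp only [diffCoeff, fracBinom, pow_succ]
  field_simp
  ring

theorem summable_abs_diffCoeff {γ : ℝ} (hγ : 0 < γ) : Summable fun ν => |diffCoeff γ ν| := by
  obtain ⟨N, hN⟩ := exists_nat_gt γ
  rw [← summable_nat_add_iff N]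
  have key : ∀ n, γ * |diffCoeff γ (n + N)| =
      ((n + N : ℕ) : ℝ) * |diffCoeff γ (n + N)|
        - ((n + 1 + N : ℕ) : ℝ) * |diffCoeff γ (n + 1 + N)| := by
    intro n
    have h := congrArg abs (diffCoeff_succ γ (n + N))
    rw [abs_mul, abs_mul, abs_of_nonneg (by positivity : (0:ℝ) ≤ ((n + N : ℕ):ℝ) + 1),
      abs_of_nonneg (by push_cast; have : (0:ℝ) ≤ n := by positivity
                        linarith : (0:ℝ) ≤ ((n + N : ℕ):ℝ) - γ)] at h
    have e : n + 1 + N = n + N + 1 := by ring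
    rw [e]
    push_cast at h ⊢
    linarith
  refine summable_of_sum_range_le (c := (N * |diffCoeff γ N|) / γ) (fun n => abs_nonneg _) ?_
  intro n
  rw [le_div_iff₀ hγ, mul_comm, Finset.mul_sum, Finset.sum_congr rfl fun i _ => key i,
    Finset.sum_range_sub' (fun i => ((i + N : ℕ) : ℝ) * |diffCoeff γ (i + N)|)]
  have : 0 ≤ ((n + N : ℕ) : ℝ) * |diffCoeff γ (n + N)| := by positivity
  simp only [Nat.zero_add] at this ⊢
  linarith

theorem summable_diffCoeff {γ : ℝ} (hγ : 0 < γ) : Summable (diffCoeff γ) :=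
  summable_abs_iff.1 (summable_abs_diffCoeff hγ)

theorem hasSum_diffCoeff_real (γ : ℝ) {w : ℝ} (hw : |w| < 1) :
    HasSum (fun ν => diffCoeff γ ν * w ^ ν) ((1 - w) ^ γ) := by
  have h := (one_add_rpow_hasFPowerSeriesOnBall_zero (a := γ)).hasSum (y := -w)
    (by simpa [enorm_eq_nnnorm, ← NNReal.coe_lt_one] using hw)
  simp only [binomialSeries_apply, List.ofFn_const, List.prod_replicate, smul_eq_mul, zero_add] at h
  rw [← sub_eq_add_neg] at h
  have e : (fun ν => diffCoeff γ ν * w ^ ν) = fun n => Ring.choose γ n * (-w) ^ n := by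
    funext ν
    rw [diffCoeff, fracBinom_eq_choose, neg_pow]
    ring
  rw [e]
  exact h

theorem hasSum_diffCoeff_complex (γ : ℝ) {w : ℂ} (hw : ‖w‖ < 1) :
    HasSum (fun ν => (diffCoeff γ ν : ℂ) * w ^ ν) ((1 - w) ^ (γ : ℂ)) := by
  have h := (Complex.one_add_cpow_hasFPowerSeriesOnBall_zero (a := γ)).hasSum (y := -w)
    (by simpa [enorm_eq_nnnorm, ← NNReal.coe_lt_one] using hw)
  simp only [binomialSeries_apply, List.ofFn_const, List.prod_replicate, smul_eq_mul, zero_add] at h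
  rw [← sub_eq_add_neg] at h
  have e : (fun ν => (diffCoeff γ ν : ℂ) * w ^ ν) = fun n => Ring.choose (γ : ℂ) n * (-w) ^ n := by
    funext ν
    rw [diffCoeff, fracBinom_eq_choose, neg_pow, ← Complex.ofReal_choose]
    push_cast
    ring
  rw [e]
  exact h

theorem tsum_diffCoeff_complex {γ : ℝ} (hγ : 0 < γ) {w : ℂ} (hw : ‖w‖ ≤ 1) :
    ∑' ν, (diffCoeff γ ν : ℂ) * w ^ ν = (1 - w) ^ (γ : ℂ) := by
  have h1 : Filter.Tendsto (fun r : ℝ => ∑' ν, (diffCoeff γ ν : ℂ) * (r * w) ^ ν)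
      (nhdsWithin 1 (Set.Iio 1)) (nhds (∑' ν, (diffCoeff γ ν : ℂ) * w ^ ν)) := by
    refine tendsto_tsum_of_dominated_convergence (summable_abs_diffCoeff hγ) ?_ ?_
    · intro ν
      have : Continuous fun r : ℝ => (diffCoeff γ ν : ℂ) * (r * w) ^ ν := by fun_prop
      simpa using (this.tendsto 1).mono_left nhdsWithin_le_nhds
    · filter_upwards [self_mem_nhdsWithin,
        nhdsWithin_le_nhds (Ioi_mem_nhds (zero_lt_one : (0:ℝ) < 1))] with r hr hr' ν
      rw [norm_mul, Complex.norm_real, norm_eq_abs]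
      refine mul_le_of_le_one_right (abs_nonneg _) ?_
      rw [norm_pow, norm_mul, Complex.norm_real, norm_eq_abs, abs_of_pos hr']
      exact pow_le_one₀ (mul_nonneg (le_of_lt hr') (norm_nonneg _))
        (mul_le_one₀ (le_of_lt hr) (norm_nonneg _) hw)
  have h2 : Filter.Tendsto (fun r : ℝ => (1 - r * w) ^ (γ : ℂ))
      (nhdsWithin 1 (Set.Iio 1)) (nhds ((1 - w) ^ (γ : ℂ))) := by
    have hc : ContinuousAt (fun x : ℂ => x ^ (γ : ℂ)) (1 - w) := by
      refine Complex.continuousAt_cpow_const_of_re_pos (Or.inl ?_) (by simpa using hγ)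
      have := (Complex.re_le_norm w).trans hw
      simpa using this
    have hl : Filter.Tendsto (fun r : ℝ => 1 - (r:ℂ) * w) (nhdsWithin 1 (Set.Iio 1))
        (nhds (1 - w)) := by
      have : Continuous fun r : ℝ => 1 - (r:ℂ) * w := by fun_prop
      simpa using (this.tendsto 1).mono_left nhdsWithin_le_nhds
    exact hc.tendsto.comp hl
  refine tendsto_nhds_unique (h1.congr' ?_) h2
  filter_upwards [self_mem_nhdsWithin,
    nhdsWithin_le_nhds (Ioi_mem_nhds (zero_lt_one : (0:ℝ) < 1))] with r hr hr'
  refine (hasSum_diffCoeff_complex γ ?_).tsum_eq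
  rw [norm_mul, Complex.norm_real, norm_eq_abs, abs_of_pos hr']
  have hr1 : r < 1 := hr
  have hr0 : 0 < r := hr'
  nlinarith [norm_nonneg w]

theorem tsum_diffCoeff {γ : ℝ} (hγ : 0 < γ) : ∑' ν, diffCoeff γ ν = 0 := by
  have h := tsum_diffCoeff_complex hγ (w := 1) (by simp)
  simp only [one_pow, mul_one, sub_self] at h
  rw [Complex.zero_cpow (by exact_mod_cast hγ.ne')] at h
  exact_mod_cast h

theorem eq_zero_of_tsum_pow_eq_zero {a : ℕ → ℝ} (ha : Summable fun n => |a n|)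
    (h : ∀ w ∈ Set.Ioo (0:ℝ) 1, ∑' n, a n * w ^ n = 0) : a = 0 := by
  funext n
  induction n using Nat.strong_induction_on with
  | _ n ih =>
    have ha' : Summable fun j => |a (j + n)| := (summable_nat_add_iff n).2 ha
    have hz : ∀ w ∈ Set.Ioo (0:ℝ) 1, ∑' j, a (j + n) * w ^ j = 0 := by
      intro w hw
      have hs : Summable fun n => a n * w ^ n := by
        refine Summable.of_norm_bounded ha fun k => ?_
        rw [norm_mul, norm_eq_abs, norm_pow, norm_eq_abs, abs_of_pos hw.1]
        exact mul_le_of_le_one_right (abs_nonneg _) (pow_le_one₀ hw.1.le hw.2.le)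
      have e := hs.sum_add_tsum_nat_add n
      rw [h w hw, Finset.sum_eq_zero, zero_add] at e
      · have : ∑' i, a (i + n) * w ^ (i + n) = w ^ n * ∑' j, a (j + n) * w ^ j := by
          rw [← tsum_mul_left]
          congr 1; funext j; ring
        rw [this] at e
        exact (mul_eq_zero.1 e).resolve_left (pow_pos hw.1 _).ne'
      · intro i hi
        rw [ih i (Finset.mem_range.1 hi)]
        simp
    have hl : Filter.Tendsto (fun w : ℝ => ∑' j, a (j + n) * w ^ j)
        (nhdsWithin 0 (Set.Ioi 0)) (nhds (∑' j, a (j + n) * 0 ^ j)) := by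
      refine tendsto_tsum_of_dominated_convergence ha' ?_ ?_
      · intro j
        have : Continuous fun w : ℝ => a (j + n) * w ^ j := by fun_prop
        exact (this.tendsto 0).mono_left nhdsWithin_le_nhds
      · filter_upwards [self_mem_nhdsWithin,
          nhdsWithin_le_nhds (Iio_mem_nhds (zero_lt_one : (0:ℝ) < 1))] with w hw hw' j
        rw [norm_mul, norm_eq_abs, norm_pow, norm_eq_abs, abs_of_pos (a := w) hw]
        exact mul_le_of_le_one_right (abs_nonneg _) (pow_le_one₀ (le_of_lt hw) (le_of_lt hw'))
    have h0 : Filter.Tendsto (fun w : ℝ => ∑' j, a (j + n) * w ^ j)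
        (nhdsWithin 0 (Set.Ioi 0)) (nhds 0) := by
      refine tendsto_const_nhds.congr' ?_
      filter_upwards [self_mem_nhdsWithin,
          nhdsWithin_le_nhds (Iio_mem_nhds (zero_lt_one : (0:ℝ) < 1))] with w hw hw'
      exact (hz w ⟨hw, hw'⟩).symm
    have e := tendsto_nhds_unique hl h0
    rw [tsum_eq_single 0 (by intro j hj; simp [hj])] at e
    simpa using e

theorem summable_diffCoeff_mul_pow {γ : ℝ} (hγ : 0 < γ) {w : ℝ} (hw : |w| ≤ 1) :
    Summable fun ν => ‖diffCoeff γ ν * w ^ ν‖ := by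
  refine Summable.of_nonneg_of_le (fun _ => norm_nonneg _) (fun k => ?_) (summable_abs_diffCoeff hγ)
  rw [norm_mul, norm_eq_abs, norm_pow, norm_eq_abs]
  exact mul_le_of_le_one_right (abs_nonneg _) (pow_le_one₀ (abs_nonneg _) hw)

/-- Vandermonde's identity for the coefficients of fractional differences. -/
theorem sum_diffCoeff_mul {α θ : ℝ} (hα : 0 < α) (hθ : 0 < θ) (n : ℕ) :
    ∑ kl ∈ Finset.HasAntidiagonal.antidiagonal n, diffCoeff α kl.1 * diffCoeff θ kl.2 = diffCoeff (α + θ) n := by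
  have hs := summable_norm_sum_mul_antidiagonal_of_summable_norm
    (f := diffCoeff α) (g := diffCoeff θ) (summable_abs_diffCoeff hα) (summable_abs_diffCoeff hθ)
  have hz := eq_zero_of_tsum_pow_eq_zero
    (a := fun n => (∑ kl ∈ Finset.HasAntidiagonal.antidiagonal n, diffCoeff α kl.1 * diffCoeff θ kl.2)
      - diffCoeff (α + θ) n) ?_ ?_
  · exact sub_eq_zero.1 (congrFun hz n)
  · exact ((summable_norm_iff.1 hs).sub (summable_diffCoeff (add_pos hα hθ))).abs
  · intro w hw
    have hw' : |w| < 1 := by rw [abs_of_pos hw.1]; exact hw.2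
    have e := tsum_mul_tsum_eq_tsum_sum_antidiagonal_of_summable_norm
      (summable_diffCoeff_mul_pow hα hw'.le) (summable_diffCoeff_mul_pow hθ hw'.le)
    have hs' := summable_norm_sum_mul_antidiagonal_of_summable_norm
      (summable_diffCoeff_mul_pow hα hw'.le) (summable_diffCoeff_mul_pow hθ hw'.le)
    have hm : ∀ n, ∑ kl ∈ Finset.HasAntidiagonal.antidiagonal n,
        diffCoeff α kl.1 * w ^ kl.1 * (diffCoeff θ kl.2 * w ^ kl.2)
        = (∑ kl ∈ Finset.HasAntidiagonal.antidiagonal n, diffCoeff α kl.1 * diffCoeff θ kl.2) * w ^ n := by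
      intro n
      rw [Finset.sum_mul]
      refine Finset.sum_congr rfl fun kl hkl => ?_
      rw [← Finset.HasAntidiagonal.mem_antidiagonal.1 hkl, pow_add]
      ring
    simp only [hm] at e hs'
    rw [summable_norm_iff] at hs'
    simp only [sub_mul]
    rw [hs'.tsum_sub (hasSum_diffCoeff_real _ hw').summable, ← e,
      (hasSum_diffCoeff_real _ hw').tsum_eq, (hasSum_diffCoeff_real _ hw').tsum_eq,
      (hasSum_diffCoeff_real _ hw').tsum_eq, rpow_add (by linarith [hw.2]), sub_self]

theorem abs_fracBinom (α : ℝ) (n : ℕ) : |fracBinom α n| = |diffCoeff α n| := by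
  simp [diffCoeff, abs_mul]

/-- The identity `(1 + w)^α (1 - w)^α = (1 - w²)^α` on the level of coefficients. -/
theorem sum_fracBinom_mul_diffCoeff {α : ℝ} (hα : 0 < α) (n : ℕ) :
    ∑ kl ∈ Finset.HasAntidiagonal.antidiagonal n, fracBinom α kl.1 * diffCoeff α kl.2 =
      if Even n then diffCoeff α (n / 2) else 0 := by
  have hf : Summable fun n => ‖fracBinom α n‖ := by
    simp only [norm_eq_abs, abs_fracBinom]
    exact summable_abs_diffCoeff hα
  have hs := summable_norm_sum_mul_antidiagonal_of_summable_norm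
    (f := fracBinom α) (g := diffCoeff α) hf (summable_abs_diffCoeff hα)
  set d : ℕ → ℝ := fun n => if Even n then diffCoeff α (n / 2) else 0 with hd
  have hinj : Function.Injective fun k : ℕ => 2 * k := fun a b h => by simpa using h
  have hd0 : ∀ w : ℝ, ∀ x ∉ Set.range fun k : ℕ => 2 * k, d x * w ^ x = 0 := by
    intro w x hx
    have : ¬ Even x := fun ⟨k, hk⟩ => hx ⟨k, by simp only; omega⟩
    simp [hd, this]
  have hd2 : ∀ k, d (2 * k) = diffCoeff α k := by intro k; simp [hd]
  have hds : Summable fun n => |d n| := by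
    rw [← hinj.summable_iff (by intro x hx; simpa using hd0 1 x hx)]
    simpa [Function.comp_def, hd2] using summable_abs_diffCoeff hα
  have hz := eq_zero_of_tsum_pow_eq_zero
    (a := fun n => (∑ kl ∈ Finset.HasAntidiagonal.antidiagonal n, fracBinom α kl.1 * diffCoeff α kl.2)
      - d n) ((summable_norm_iff.1 hs).sub (summable_abs_iff.1 hds)).abs ?_
  · exact sub_eq_zero.1 (congrFun hz n)
  · intro w hw
    have hw' : |w| < 1 := by rw [abs_of_pos hw.1]; exact hw.2
    have hm' : ∀ n, diffCoeff α n * (-w) ^ n = fracBinom α n * w ^ n := by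
      intro n
      rw [diffCoeff, neg_pow w]
      have : (-1:ℝ) ^ n * (-1) ^ n = 1 := by rw [← mul_pow]; simp
      linear_combination (fracBinom α n * w ^ n) * this
    have hw'' : |-w| < 1 := by rwa [abs_neg]
    have hs1 := summable_diffCoeff_mul_pow hα hw''.le
    have hv1 := (hasSum_diffCoeff_real α hw'').tsum_eq
    simp only [hm'] at hs1 hv1
    have e := tsum_mul_tsum_eq_tsum_sum_antidiagonal_of_summable_norm
      hs1 (summable_diffCoeff_mul_pow hα hw'.le)
    have hs' := summable_norm_sum_mul_antidiagonal_of_summable_norm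
      hs1 (summable_diffCoeff_mul_pow hα hw'.le)
    have hm : ∀ n, ∑ kl ∈ Finset.HasAntidiagonal.antidiagonal n,
        fracBinom α kl.1 * w ^ kl.1 * (diffCoeff α kl.2 * w ^ kl.2)
        = (∑ kl ∈ Finset.HasAntidiagonal.antidiagonal n, fracBinom α kl.1 * diffCoeff α kl.2) * w ^ n := by
      intro n
      rw [Finset.sum_mul]
      refine Finset.sum_congr rfl fun kl hkl => ?_
      rw [← Finset.HasAntidiagonal.mem_antidiagonal.1 hkl, pow_add]
      ring
    simp only [hm] at e hs'
    rw [summable_norm_iff] at hs'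
    have hw2 : |w ^ 2| < 1 := by rw [abs_pow]; nlinarith [abs_nonneg w]
    have hd1 : HasSum (fun n => d n * w ^ n) ((1 - w ^ 2) ^ α) := by
      rw [← hinj.hasSum_iff (hd0 w)]
      convert hasSum_diffCoeff_real α hw2 using 1
      funext k
      simp [hd2, pow_mul]
    simp only [sub_mul]
    rw [hs'.tsum_sub hd1.summable, ← e, hv1,
      (hasSum_diffCoeff_real _ hw').tsum_eq, hd1.tsum_eq, ← mul_rpow (by linarith [hw.1])
      (by linarith [hw.2])]
    ring_nf

section FourierKernels

open scoped FourierTransform SchwartzMap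

/-- A fixed even smooth cut-off function. -/
def cutoff : ContDiffBump (0:ℝ) := ⟨1/16, 1/8, by norm_num, by norm_num⟩

/-- The cosine transform of the cut-off function. -/
def lowKer (x : ℝ) : ℝ := ∫ ξ, cutoff ξ * cos (2 * π * x * ξ)

/-- The dilated cut-off function as a Schwartz function. -/
def cutoffSchwartz (t : ℝ) (ht : t ≠ 0) : 𝓢(ℝ, ℂ) :=
  HasCompactSupport.toSchwartzMap (f := fun ξ : ℝ => ((cutoff (t * ξ) : ℝ) : ℂ))
    ((cutoff.hasCompactSupport.comp_smul ht).comp_left (g := fun r : ℝ => (r : ℂ)) (by simp))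
    (Complex.ofRealCLM.contDiff.comp (cutoff.contDiff.comp (contDiff_const.mul contDiff_id)))

theorem cutoffSchwartz_apply (t : ℝ) (ht : t ≠ 0) (ξ : ℝ) :
    cutoffSchwartz t ht ξ = (cutoff (t * ξ) : ℝ) := rfl

theorem cutoff_zero : cutoff (0:ℝ) = 1 :=
  cutoff.one_of_mem_closedBall (by simp [cutoff])

theorem cutoff_eq_zero {x : ℝ} (h : 1/8 ≤ |x|) : cutoff x = 0 :=
  cutoff.zero_of_le_dist (by simpa [cutoff] using h)

theorem cutoff_eq_one {x : ℝ} (h : |x| ≤ 1/16) : cutoff x = 1 :=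
  cutoff.one_of_mem_closedBall (by simpa [cutoff] using h)

theorem integrable_cutoff_mul {f : ℝ → ℝ} (hf : Continuous f) :
    Integrable fun ξ => cutoff ξ * f ξ :=
  (cutoff.continuous.mul hf).integrable_of_hasCompactSupport cutoff.hasCompactSupport.mul_right

theorem integral_cutoff_mul_sin (x : ℝ) : ∫ ξ, cutoff ξ * sin (2 * π * x * ξ) = 0 := by
  have h := integral_neg_eq_self (fun ξ => cutoff ξ * sin (2 * π * x * ξ)) volume
  simp only [cutoff.neg, mul_neg, sin_neg, integral_neg] at h
  linarith

theorem fourierInv_cutoffSchwartz {t : ℝ} (ht : 0 < t) (x : ℝ) :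
    𝓕⁻ (cutoffSchwartz t ht.ne') x = ((t⁻¹ * lowKer (x / t) : ℝ) : ℂ) := by
  rw [SchwartzMap.fourierInv_coe, Real.fourierInv_eq']
  have h1 : ∀ v : ℝ, Complex.exp (↑(2 * π * inner ℝ v x) * Complex.I) • cutoffSchwartz t ht.ne' v
      = (fun ξ : ℝ => ((cutoff ξ * cos (2 * π * (x / t) * ξ) : ℝ) : ℂ)
        + ((cutoff ξ * sin (2 * π * (x / t) * ξ) : ℝ) : ℂ) * Complex.I) (t * v) := by
    intro v
    have e : 2 * π * (x / t) * (t * v) = 2 * π * (x * v) := by field_simp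
    rw [Complex.exp_mul_I, cutoffSchwartz_apply]
    simp only [RCLike.inner_apply, conj_trivial, e]
    push_cast
    rw [smul_eq_mul]
    ring
  have hi1 := (integrable_cutoff_mul (f := fun ξ => cos (2 * π * (x / t) * ξ)) (by fun_prop))
  have hi2 := (integrable_cutoff_mul (f := fun ξ => sin (2 * π * (x / t) * ξ)) (by fun_prop))
  simp only [h1]
  rw [Measure.integral_comp_mul_left (fun ξ : ℝ => ((cutoff ξ * cos (2 * π * (x / t) * ξ) : ℝ) : ℂ)
        + ((cutoff ξ * sin (2 * π * (x / t) * ξ) : ℝ) : ℂ) * Complex.I),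
    integral_add hi1.ofReal (hi2.ofReal.mul_const _), integral_mul_const, integral_complex_ofReal,
    integral_complex_ofReal, integral_cutoff_mul_sin, abs_of_pos (inv_pos.2 ht)]
  simp [lowKer]

theorem lowKer_eq_fourierInv (x : ℝ) :
    (lowKer x : ℂ) = 𝓕⁻ (cutoffSchwartz 1 one_ne_zero) x := by
  rw [fourierInv_cutoffSchwartz zero_lt_one]
  simp

theorem continuous_lowKer : Continuous lowKer := by
  have : lowKer = fun x => (𝓕⁻ (cutoffSchwartz 1 one_ne_zero) x).re := by
    funext x
    rw [← lowKer_eq_fourierInv, Complex.ofReal_re]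
  rw [this]
  exact Complex.continuous_re.comp (SchwartzMap.continuous _)

theorem exists_abs_lowKer_le : ∃ C : ℝ, 0 < C ∧ ∀ x, |lowKer x| ≤ C / (1 + x ^ 2) := by
  obtain ⟨C0, h0, H0⟩ := (𝓕⁻ (cutoffSchwartz 1 one_ne_zero)).decay 0 0
  obtain ⟨C2, h2, H2⟩ := (𝓕⁻ (cutoffSchwartz 1 one_ne_zero)).decay 2 0
  refine ⟨C0 + C2, by positivity, fun x => ?_⟩
  have a := H0 x
  have b := H2 x
  rw [norm_iteratedFDeriv_zero, ← lowKer_eq_fourierInv, Complex.norm_real] at a b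
  rw [le_div_iff₀ (by positivity)]
  simp only [norm_eq_abs, pow_zero, one_mul, sq_abs] at a b
  linarith

theorem tsum_lowKer {t : ℝ} (ht : 1/8 ≤ t) (x : ℝ) :
    ∑' n : ℤ, t⁻¹ * lowKer ((x + n) / t) = 1 := by
  have ht0 : 0 < t := by linarith
  have h := SchwartzMap.tsum_eq_tsum_fourier (𝓕⁻ (cutoffSchwartz t ht0.ne')) x
  simp only [FourierTransform.fourier_fourierInv_eq, fourierInv_cutoffSchwartz ht0] at h
  rw [tsum_eq_single (f := fun n : ℤ => cutoffSchwartz t ht0.ne' n * fourier n (x : UnitAddCircle)) 0]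
    at h
  · rw [cutoffSchwartz_apply] at h
    simp only [Int.cast_zero, mul_zero, cutoff_zero, fourier_zero, Complex.ofReal_one, mul_one] at h
    exact_mod_cast h
  · intro n hn
    rw [cutoffSchwartz_apply, cutoff_eq_zero, Complex.ofReal_zero, zero_mul]
    rw [abs_mul, abs_of_pos ht0]
    have : (1:ℝ) ≤ |(n:ℝ)| := by exact_mod_cast Int.one_le_abs hn
    nlinarith

theorem integral_lowKer : ∫ x, lowKer x = 1 := by
  have h := congrArg (fun f : 𝓢(ℝ, ℂ) => f 0)
    (FourierTransform.fourier_fourierInv_eq (F := 𝓢(ℝ, ℂ)) (cutoffSchwartz 1 one_ne_zero))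
  simp only [SchwartzMap.fourier_coe, Real.fourier_eq', ← lowKer_eq_fourierInv, inner_zero_right,
    mul_zero, Complex.ofReal_zero, zero_mul, Complex.exp_zero, one_smul, cutoffSchwartz_apply,
    cutoff_zero, integral_complex_ofReal] at h
  exact_mod_cast h

/-- The smooth annular cut-off function. -/
def annulus (ξ : ℝ) : ℝ := cutoff (ξ / 2) - cutoff ξ

theorem annulus_eq_zero_of_le {ξ : ℝ} (h : |ξ| ≤ 1/16) : annulus ξ = 0 := by
  rw [annulus, cutoff_eq_one h, cutoff_eq_one, sub_self]
  rw [abs_div, abs_two]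
  linarith

theorem annulus_eq_zero_of_ge {ξ : ℝ} (h : 1/4 ≤ |ξ|) : annulus ξ = 0 := by
  rw [annulus, cutoff_eq_zero (x := ξ) (by linarith), cutoff_eq_zero, sub_self]
  rw [abs_div, abs_two]
  linarith

theorem contDiff_annulus {n : ℕ∞} : ContDiff ℝ n annulus :=
  (cutoff.contDiff.comp (contDiff_id.div_const 2)).sub cutoff.contDiff

theorem lowKer_sub (x : ℝ) :
    2 * lowKer (2 * x) - lowKer x = 2 * ∫ ξ in (1/32:ℝ)..(1/2), annulus ξ * cos (2 * π * x * ξ) := by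
  have h1 : 2 * lowKer (2 * x) = ∫ ξ, cutoff (ξ / 2) * cos (2 * π * x * ξ) := by
    have := Measure.integral_comp_mul_left
      (fun ξ => cutoff ξ * cos (2 * π * (2 * x) * ξ)) (2⁻¹ : ℝ)
    rw [inv_inv, abs_two, smul_eq_mul] at this
    rw [lowKer, ← this]
    congr 1; funext ξ
    congr 2 <;> ring
  have hi : Integrable fun ξ => cutoff (ξ / 2) * cos (2 * π * x * ξ) := by
    refine Continuous.integrable_of_hasCompactSupport ?_ ?_
    · exact (cutoff.continuous.comp (continuous_id.div_const 2)).mul (by fun_prop)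
    · refine HasCompactSupport.mul_right ?_
      have := cutoff.hasCompactSupport.comp_smul (c := (2⁻¹:ℝ)) (by norm_num)
      simpa [smul_eq_mul, mul_comm, div_eq_mul_inv] using this
  have habs : ∀ ξ, annulus ξ * cos (2 * π * x * ξ) = annulus |ξ| * cos (2 * π * x * |ξ|) := by
    intro ξ
    rcases abs_choice ξ with h | h
    · rw [h]
    · have e1 : annulus (-ξ) = annulus ξ := by
        rw [annulus, annulus, cutoff.neg, neg_div, cutoff.neg]
      rw [h, mul_neg, cos_neg, e1]
  rw [h1, lowKer, ← integral_sub hi (integrable_cutoff_mul (by fun_prop))]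
  simp only [← sub_mul]
  change ∫ ξ, annulus ξ * cos (2 * π * x * ξ) = _
  rw [integral_congr_ae (Filter.Eventually.of_forall habs),
    integral_comp_abs (f := fun ξ => annulus ξ * cos (2 * π * x * ξ)),
    intervalIntegral.integral_of_le (by norm_num),
    setIntegral_eq_of_subset_of_forall_sdiff_eq_zero measurableSet_Ioi
      (s := Set.Ioc (1/32:ℝ) (1/2))]
  · intro y hy
    exact lt_trans (by norm_num) hy.1
  · rintro y ⟨hy, hy'⟩
    have hy0 : 0 < y := hy
    rw [Set.mem_Ioc, not_and_or, not_lt, not_le] at hy'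
    rcases hy' with h | h
    · rw [annulus_eq_zero_of_le (by rw [abs_of_pos hy0]; linarith), zero_mul]
    · rw [annulus_eq_zero_of_ge (by rw [abs_of_pos hy0]; linarith), zero_mul]

end FourierKernels

/-- Decay of an oscillatory integral obtained by integrating by parts twice. -/
theorem norm_integral_mul_cexp_le {F F' F'' : ℝ → ℂ} {a b M : ℝ} (hab : a ≤ b) (hab1 : b - a ≤ 1)
    (hF : ∀ ξ ∈ Set.Icc a b, HasDerivAt F (F' ξ) ξ)
    (hF' : ∀ ξ ∈ Set.Icc a b, HasDerivAt F' (F'' ξ) ξ) (hF'' : ContinuousOn F'' (Set.Icc a b))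
    (ha : F a = 0) (hb : F b = 0) (ha' : F' a = 0) (hb' : F' b = 0)
    (hM : ∀ ξ ∈ Set.Icc a b, ‖F ξ‖ ≤ M) (hM'' : ∀ ξ ∈ Set.Icc a b, ‖F'' ξ‖ ≤ M) (x : ℝ) :
    ‖∫ ξ in a..b, F ξ * Complex.exp (2 * π * x * ξ * Complex.I)‖ ≤ 2 * M / (1 + x ^ 2) := by
  have hM0 : 0 ≤ M := (norm_nonneg _).trans (hM a ⟨le_rfl, hab⟩)
  have hu : Set.uIcc a b = Set.Icc a b := Set.uIcc_of_le hab
  have hn : ∀ ξ : ℝ, ‖Complex.exp (2 * π * x * ξ * Complex.I)‖ = 1 := by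
    intro ξ
    have := Complex.norm_exp_ofReal_mul_I (2 * π * x * ξ)
    push_cast at this
    exact this
  have hbd : ∀ G : ℝ → ℂ, (∀ ξ ∈ Set.Icc a b, ‖G ξ‖ ≤ M) →
      ‖∫ ξ in a..b, G ξ * Complex.exp (2 * π * x * ξ * Complex.I)‖ ≤ M := by
    intro G hG
    have h1 := intervalIntegral.norm_integral_le_of_norm_le_const (a := a) (b := b) (C := M)
      (f := fun ξ => G ξ * Complex.exp (2 * π * x * ξ * Complex.I)) (by
        intro ξ hξ
        rw [Set.uIoc_of_le hab] at hξ
        rw [norm_mul, hn, mul_one]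
        exact hG ξ ⟨hξ.1.le, hξ.2⟩)
    refine h1.trans (mul_le_of_le_one_right hM0 ?_)
    rw [abs_of_nonneg (by linarith)]
    exact hab1
  rcases le_or_gt |x| 1 with hx | hx
  · refine (hbd F hM).trans ?_
    rw [le_div_iff₀ (by positivity)]
    have : x ^ 2 ≤ 1 := by rw [← sq_abs]; exact pow_le_one₀ (abs_nonneg _) hx
    nlinarith
  · have hx0 : x ≠ 0 := by rintro rfl; simp at hx; linarith
    set c : ℂ := 2 * π * x * Complex.I with hc
    have hc0 : c ≠ 0 := by
      simp [hc, hx0, pi_ne_zero]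
    have hce : ∀ ξ : ℝ, (2 * π * x * ξ * Complex.I : ℂ) = c * ξ := by intro ξ; rw [hc]; ring
    simp only [hce]
    have hv : ∀ ξ : ℝ, HasDerivAt (fun ξ : ℝ => Complex.exp (c * ξ) / c) (Complex.exp (c * ξ)) ξ := by
      intro ξ
      have h1 : HasDerivAt (fun z : ℂ => Complex.exp (c * z) / c) (Complex.exp (c * ξ)) (ξ : ℂ) := by
        have := (((hasDerivAt_id (ξ : ℂ)).const_mul c).cexp).div_const c
        simp only [id_eq, mul_one] at this
        rwa [mul_div_assoc, div_self hc0, mul_one] at this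
      exact h1.comp_ofReal
    have hcont : Continuous fun ξ : ℝ => Complex.exp (c * ξ) := by fun_prop
    have hibp : ∀ G G' : ℝ → ℂ, (∀ ξ ∈ Set.Icc a b, HasDerivAt G (G' ξ) ξ) →
        ContinuousOn G' (Set.Icc a b) → G a = 0 → G b = 0 →
        ∫ ξ in a..b, G ξ * Complex.exp (c * ξ) = - (∫ ξ in a..b, G' ξ * Complex.exp (c * ξ)) / c := by
      intro G G' hG hG' hGa hGb
      have := intervalIntegral.integral_mul_deriv_eq_deriv_mul (a := a) (b := b) (u := G) (u' := G')
        (v := fun ξ : ℝ => Complex.exp (c * ξ) / c) (v' := fun ξ : ℝ => Complex.exp (c * ξ))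
        (by rwa [hu]) (fun ξ _ => hv ξ) (by
          apply ContinuousOn.intervalIntegrable
          rwa [hu]) (hcont.intervalIntegrable _ _)
      rw [this, hGa, hGb]
      simp only [← mul_div_assoc, intervalIntegral.integral_div]
      ring
    rw [hibp F F' hF (fun ξ hξ => (hF' ξ hξ).continuousAt.continuousWithinAt) ha hb,
      hibp F' F'' hF' hF'' ha' hb']
    have h2 := hbd F'' hM''
    simp only [hce] at h2
    rw [norm_div, norm_neg, norm_div, norm_neg]
    have hcn : ‖c‖ = 2 * π * |x| := by
      simp [hc, abs_of_pos pi_pos]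
    rw [hcn, div_div, div_le_div_iff₀ (by positivity) (by positivity)]
    have hx2 : 1 ≤ x ^ 2 := by
      rw [← sq_abs]; exact one_le_pow₀ hx.le
    have e : 2 * π * |x| * (2 * π * |x|) = 4 * π ^ 2 * x ^ 2 := by
      rw [← sq_abs x]; ring
    rw [e]
    have h3 : 1 + x ^ 2 ≤ 2 * (4 * π ^ 2 * x ^ 2) := by
      have h9 : 1 ≤ π ^ 2 := one_le_pow₀ (by linarith [pi_gt_three])
      nlinarith
    calc _ ≤ M * (1 + x ^ 2) := by gcongr
      _ ≤ M * (2 * (4 * π ^ 2 * x ^ 2)) := by gcongr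
      _ = _ := by ring

/-- The logarithm of the symbol `e^{iz} (1 - e^{-iz})`, `z = 2u`, of a difference. -/
def logSymbol (u : ℝ) : ℂ := (log (2 * sin u) : ℝ) + (π / 2 + u : ℝ) * Complex.I

theorem cexp_logSymbol_mul {γ u : ℝ} (hu : 0 < u) (hu2 : u ≤ π / 2) :
    Complex.exp (-γ * logSymbol u) * Complex.exp (2 * γ * u * Complex.I)
      * (1 - Complex.exp (-(2 * u * Complex.I))) ^ (γ : ℂ) = 1 := by
  have hs : 0 < 2 * sin u := by
    have := sin_pos_of_pos_of_lt_pi hu (by linarith [pi_pos])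
    positivity
  have h1 : 1 - Complex.exp (-(2 * u * Complex.I))
      = Complex.exp ((log (2 * sin u) : ℝ) + (π / 2 - u : ℝ) * Complex.I) := by
    have e1 : Complex.exp (-(2 * u * Complex.I))
        = Complex.exp (((-u : ℝ) : ℂ) * Complex.I) * Complex.exp (((-u : ℝ) : ℂ) * Complex.I) := by
      rw [← Complex.exp_add]; congr 1; push_cast; ring
    rw [Complex.exp_add, ← Complex.ofReal_exp, exp_log hs, e1, Complex.exp_mul_I, Complex.exp_mul_I,
      ← Complex.ofReal_cos, ← Complex.ofReal_sin, ← Complex.ofReal_cos, ← Complex.ofReal_sin,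
      cos_pi_div_two_sub, sin_pi_div_two_sub, cos_neg, sin_neg]
    have := sin_sq_add_cos_sq u
    apply Complex.ext
    · simp only [Complex.sub_re, Complex.mul_re, Complex.add_re, Complex.ofReal_re, Complex.I_re,
        Complex.I_im, Complex.ofReal_im, Complex.one_re, Complex.add_im, Complex.mul_im]
      nlinarith
    · simp only [Complex.sub_im, Complex.mul_re, Complex.add_re, Complex.ofReal_re, Complex.I_re,
        Complex.I_im, Complex.ofReal_im, Complex.one_im, Complex.add_im, Complex.mul_im]
      ring
  rw [h1, Complex.cpow_def_of_ne_zero (Complex.exp_ne_zero _), Complex.log_exp, ← Complex.exp_add,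
    ← Complex.exp_add, ← Complex.exp_zero]
  · congr 1
    rw [logSymbol]
    push_cast
    ring
  · simp; linarith [pi_pos]
  · simp; linarith [pi_pos]

theorem norm_cexp_logSymbol {γ u : ℝ} (hs : 0 < sin u) :
    ‖Complex.exp (-γ * logSymbol u)‖ = (2 * sin u) ^ (-γ) := by
  rw [Complex.norm_exp, rpow_def_of_pos (by positivity)]
  simp [logSymbol, mul_comm]

theorem hasDerivAt_logSymbol {u : ℝ} (hs : 0 < sin u) :
    HasDerivAt logSymbol ((cos u / sin u : ℝ) + Complex.I) u := by
  have h1 : HasDerivAt (fun u => log (2 * sin u)) (cos u / sin u) u := by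
    have := ((hasDerivAt_sin u).const_mul 2).log (by positivity)
    convert! this using 1
    field_simp
  have h2 : HasDerivAt (fun u : ℝ => π / 2 + u) 1 u := (hasDerivAt_id u).const_add _
  have := h1.ofReal_comp.add (h2.ofReal_comp.mul_const Complex.I)
  rw [Complex.ofReal_one, one_mul] at this
  exact this

theorem hasDerivAt_cot {u : ℝ} (hs : 0 < sin u) :
    HasDerivAt (fun u : ℝ => ((cos u / sin u : ℝ) + Complex.I : ℂ)) (-(1 / sin u ^ 2) : ℝ) u := by
  have h1 : HasDerivAt (fun u => cos u / sin u) (-(1 / sin u ^ 2)) u := by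
    have := (hasDerivAt_cos u).div (hasDerivAt_sin u) hs.ne'
    convert! this using 1
    have := sin_sq_add_cos_sq u
    field_simp
    nlinarith
  exact h1.ofReal_comp.add_const _

theorem deriv_annulus_eq_zero {x : ℝ} (h : annulus =ᶠ[nhds x] 0) : deriv annulus x = 0 := by
  rw [h.deriv_eq]; simp

theorem exists_annulus_bound : ∃ D : ℝ, 0 < D ∧ ∀ ξ ∈ Set.Icc (1/32:ℝ) (1/2),
    |annulus ξ| ≤ D ∧ |deriv annulus ξ| ≤ D ∧ |deriv (deriv annulus) ξ| ≤ D := by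
  have hb : ∀ f : ℝ → ℝ, Continuous f → ∃ D : ℝ, ∀ ξ ∈ Set.Icc (1/32:ℝ) (1/2), |f ξ| ≤ D := by
    intro f hf
    obtain ⟨D, hD⟩ := isCompact_Icc.exists_bound_of_continuousOn (s := Set.Icc (1/32:ℝ) (1/2))
      hf.continuousOn
    exact ⟨D, hD⟩
  have h2 : ContDiff ℝ 2 annulus := contDiff_annulus (n := 2)
  have h1 : ContDiff ℝ 1 (deriv annulus) := ContDiff.deriv' h2
  obtain ⟨D0, h0⟩ := hb annulus h2.continuous
  obtain ⟨D1, h1'⟩ := hb (deriv annulus) h1.continuous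
  obtain ⟨D2, h2'⟩ := hb (deriv (deriv annulus)) (h1.continuous_deriv le_rfl)
  refine ⟨|D0| + |D1| + |D2| + 1, by positivity, fun ξ hξ => ⟨?_, ?_, ?_⟩⟩
  · linarith [h0 ξ hξ, le_abs_self D0, abs_nonneg D1, abs_nonneg D2]
  · linarith [h1' ξ hξ, le_abs_self D1, abs_nonneg D0, abs_nonneg D2]
  · linarith [h2' ξ hξ, le_abs_self D2, abs_nonneg D1, abs_nonneg D0]

theorem sin_scaled_ge {s ξ : ℝ} (hs : s ∈ Set.Ioc (0:ℝ) 1) (hξ : ξ ∈ Set.Icc (1/32:ℝ) (1/2)) :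
    s / 16 ≤ sin (π * s * ξ) := by
  have h0 : 0 ≤ π * s * ξ := by have := hs.1; have := hξ.1; positivity
  have h1 : s * ξ ≤ 1 / 2 := by nlinarith [hs.1, hs.2, hξ.1, hξ.2]
  have h := mul_le_sin h0 (by nlinarith [pi_pos])
  have e : 2 / π * (π * s * ξ) = 2 * (s * ξ) := by field_simp
  rw [e] at h
  nlinarith [hs.1, hξ.1]

/-- The amplitude `2 ψ(ξ) exp (-γ ℓ(πsξ))` of the kernels inverting a difference operator. -/
def amplitude (γ s ξ : ℝ) : ℂ := 2 * annulus ξ * Complex.exp (-γ * logSymbol (π * s * ξ))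

theorem exists_norm_integral_amplitude_le {γ : ℝ} (hγ : 0 < γ) :
    ∃ C : ℝ, 0 < C ∧ ∀ s ∈ Set.Ioc (0:ℝ) 1, ∀ x : ℝ,
      ‖∫ ξ in (1/32:ℝ)..(1/2), amplitude γ s ξ * Complex.exp (2 * π * x * ξ * Complex.I)‖
        ≤ C * s ^ (-γ) / (1 + x ^ 2) := by
  obtain ⟨D, hD0, hD⟩ := exists_annulus_bound
  have h2 : ContDiff ℝ 2 annulus := contDiff_annulus (n := 2)
  have h1 : ContDiff ℝ 1 (deriv annulus) := ContDiff.deriv' h2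
  set L : ℝ := 17 * π with hL
  set Q : ℝ := (16 * π) ^ 2 with hQ
  set B : ℝ := 2 * (D + 2 * D * (γ * L) + D * (γ ^ 2 * L ^ 2 + γ * Q)) with hB
  have hL0 : 0 < L := by positivity
  have hQ0 : 0 < Q := by positivity
  have hBD : 2 * D ≤ B := by
    have : 0 ≤ 2 * D * (γ * L) + D * (γ ^ 2 * L ^ 2 + γ * Q) := by positivity
    linarith
  refine ⟨2 * (B * 8 ^ γ), by positivity, fun s hs x => ?_⟩
  have hs0 := hs.1
  set l1 : ℝ → ℂ := fun ξ => ((cos (π * s * ξ) / sin (π * s * ξ) : ℝ) + Complex.I) * (π * s : ℝ)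
    with hl1
  set l2 : ℝ → ℂ := fun ξ => ((-(1 / sin (π * s * ξ) ^ 2) : ℝ) : ℂ) * (π * s : ℝ) * (π * s : ℝ)
    with hl2
  set E : ℝ → ℂ := fun ξ => Complex.exp (-γ * logSymbol (π * s * ξ)) with hE
  have hlin : ∀ ξ : ℝ, HasDerivAt (fun ξ => π * s * ξ) (π * s) ξ := fun ξ => by
    simpa using (hasDerivAt_id ξ).const_mul (π * s)
  have hsin : ∀ ξ ∈ Set.Icc (1/32:ℝ) (1/2), 0 < sin (π * s * ξ) := fun ξ hξ =>
    lt_of_lt_of_le (by positivity) (sin_scaled_ge hs hξ)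
  have dl : ∀ ξ ∈ Set.Icc (1/32:ℝ) (1/2), HasDerivAt (fun ξ => logSymbol (π * s * ξ)) (l1 ξ) ξ := by
    intro ξ hξ
    have := (hasDerivAt_logSymbol (hsin ξ hξ)).scomp ξ (hlin ξ)
    convert! this using 1
    simp only [hl1, Complex.real_smul]; ring
  have dl1 : ∀ ξ ∈ Set.Icc (1/32:ℝ) (1/2), HasDerivAt l1 (l2 ξ) ξ := by
    intro ξ hξ
    have := ((hasDerivAt_cot (hsin ξ hξ)).scomp ξ (hlin ξ)).mul_const ((π * s : ℝ) : ℂ)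
    convert! this using 1
    simp only [hl2, Complex.real_smul]; ring
  have dE : ∀ ξ ∈ Set.Icc (1/32:ℝ) (1/2), HasDerivAt E (E ξ * (-γ * l1 ξ)) ξ := fun ξ hξ =>
    ((dl ξ hξ).const_mul (-γ : ℂ)).cexp
  have da : ∀ ξ : ℝ, HasDerivAt (fun ξ => (2 * annulus ξ : ℂ)) (2 * deriv annulus ξ : ℂ) ξ :=
    fun ξ => ((h2.differentiable (by norm_num)) ξ).hasDerivAt.ofReal_comp.const_mul 2
  have da1 : ∀ ξ : ℝ, HasDerivAt (fun ξ => (2 * deriv annulus ξ : ℂ))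
      (2 * deriv (deriv annulus) ξ : ℂ) ξ :=
    fun ξ => ((h1.differentiable (by norm_num)) ξ).hasDerivAt.ofReal_comp.const_mul 2
  set F' : ℝ → ℂ := fun ξ => 2 * deriv annulus ξ * E ξ + 2 * annulus ξ * (E ξ * (-γ * l1 ξ))
    with hF'
  set F'' : ℝ → ℂ := fun ξ => (2 * deriv (deriv annulus) ξ * E ξ
      + 2 * deriv annulus ξ * (E ξ * (-γ * l1 ξ))) + (2 * deriv annulus ξ * (E ξ * (-γ * l1 ξ))
      + 2 * annulus ξ * (E ξ * (-γ * l1 ξ) * (-γ * l1 ξ) + E ξ * (-γ * l2 ξ))) with hF''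
  have dF : ∀ ξ ∈ Set.Icc (1/32:ℝ) (1/2), HasDerivAt (amplitude γ s) (F' ξ) ξ := fun ξ hξ =>
    (da ξ).mul (dE ξ hξ)
  have dF' : ∀ ξ ∈ Set.Icc (1/32:ℝ) (1/2), HasDerivAt F' (F'' ξ) ξ := fun ξ hξ =>
    ((da1 ξ).mul (dE ξ hξ)).add
      ((da ξ).mul ((dE ξ hξ).mul ((dl1 ξ hξ).const_mul (-γ : ℂ))))
  have cE : ContinuousOn E (Set.Icc (1/32:ℝ) (1/2)) := fun ξ hξ =>
    (dE ξ hξ).continuousAt.continuousWithinAt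
  have cl1 : ContinuousOn l1 (Set.Icc (1/32:ℝ) (1/2)) := fun ξ hξ =>
    (dl1 ξ hξ).continuousAt.continuousWithinAt
  have cl2 : ContinuousOn l2 (Set.Icc (1/32:ℝ) (1/2)) := by
    have h : ContinuousOn (fun ξ => -(1 / sin (π * s * ξ) ^ 2)) (Set.Icc (1/32:ℝ) (1/2)) := by
      refine (continuousOn_const.div (by fun_prop) fun ξ hξ => ?_).neg
      exact (pow_pos (hsin ξ hξ) 2).ne'
    exact ((Complex.continuous_ofReal.comp_continuousOn h).mul continuousOn_const).mul
      continuousOn_const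
  have ca : Continuous fun ξ => (annulus ξ : ℂ) := Complex.continuous_ofReal.comp h2.continuous
  have ca1 : Continuous fun ξ => ((deriv annulus ξ : ℝ) : ℂ) :=
    Complex.continuous_ofReal.comp h1.continuous
  have ca2 : Continuous fun ξ => ((deriv (deriv annulus) ξ : ℝ) : ℂ) :=
    Complex.continuous_ofReal.comp (h1.continuous_deriv le_rfl)
  have cF'' : ContinuousOn F'' (Set.Icc (1/32:ℝ) (1/2)) := by
    have ca' := ca.continuousOn (s := Set.Icc (1/32:ℝ) (1/2))
    have ca1' := ca1.continuousOn (s := Set.Icc (1/32:ℝ) (1/2))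
    have ca2' := ca2.continuousOn (s := Set.Icc (1/32:ℝ) (1/2))
    simp only [hF'']
    fun_prop
  have za : annulus =ᶠ[nhds (1/32:ℝ)] 0 := by
    filter_upwards [Ioo_mem_nhds (show (0:ℝ) < 1/32 by norm_num)
      (show (1/32:ℝ) < 1/16 by norm_num)] with ξ hξ
    exact annulus_eq_zero_of_le (by rw [abs_of_pos hξ.1]; exact hξ.2.le)
  have zb : annulus =ᶠ[nhds (1/2:ℝ)] 0 := by
    filter_upwards [Ioi_mem_nhds (show (1/4:ℝ) < 1/2 by norm_num)] with ξ hξ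
    exact annulus_eq_zero_of_ge (le_trans (le_of_lt hξ) (le_abs_self _))
  have nE : ∀ ξ ∈ Set.Icc (1/32:ℝ) (1/2), ‖E ξ‖ ≤ 8 ^ γ * s ^ (-γ) := by
    intro ξ hξ
    rw [hE]
    simp only
    rw [norm_cexp_logSymbol (hsin ξ hξ)]
    have h8 : s / 8 ≤ 2 * sin (π * s * ξ) := by linarith [sin_scaled_ge hs hξ]
    calc (2 * sin (π * s * ξ)) ^ (-γ) ≤ (s / 8) ^ (-γ) :=
          rpow_le_rpow_of_nonpos (by positivity) h8 (by linarith)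
      _ = 8 ^ γ * s ^ (-γ) := by
          rw [div_rpow hs0.le (by norm_num), rpow_neg (by norm_num : (0:ℝ) ≤ 8)]
          field_simp
  have nl1 : ∀ ξ ∈ Set.Icc (1/32:ℝ) (1/2), ‖l1 ξ‖ ≤ L := by
    intro ξ hξ
    have a := sin_scaled_ge hs hξ
    have b := hsin ξ hξ
    rw [hl1]
    simp only
    rw [norm_mul, Complex.norm_real, norm_eq_abs, abs_of_pos (by positivity)]
    have h3 : ‖((cos (π * s * ξ) / sin (π * s * ξ) : ℝ) + Complex.I : ℂ)‖ ≤ 16 / s + 1 := by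
      refine (norm_add_le _ _).trans ?_
      rw [Complex.norm_real, Complex.norm_I, norm_eq_abs, abs_div, abs_of_pos b]
      refine add_le_add ?_ le_rfl
      rw [div_le_div_iff₀ b hs0]
      nlinarith [abs_cos_le_one (π * s * ξ)]
    calc _ ≤ (16 / s + 1) * (π * s) := by gcongr
      _ = π * (16 + s) := by field_simp
      _ ≤ π * (16 + 1) := by gcongr; exact hs.2
      _ = L := by rw [hL]; ring
  have nl2 : ∀ ξ ∈ Set.Icc (1/32:ℝ) (1/2), ‖l2 ξ‖ ≤ Q := by
    intro ξ hξ
    have a := sin_scaled_ge hs hξ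
    have b := hsin ξ hξ
    rw [hl2]
    simp only
    rw [norm_mul, norm_mul, Complex.norm_real, Complex.norm_real, norm_eq_abs, norm_eq_abs,
      abs_of_pos (a := π * s) (by positivity), abs_neg, abs_of_pos (by positivity)]
    calc 1 / sin (π * s * ξ) ^ 2 * (π * s) * (π * s)
        ≤ 1 / (s / 16) ^ 2 * (π * s) * (π * s) := by gcongr
      _ = Q := by rw [hQ]; field_simp
  have n0 : ∀ (c r : ℝ), 0 ≤ r → |c| ≤ D → ‖(2 * c : ℂ)‖ ≤ 2 * D := by
    intro c r _ hc
    rw [norm_mul, Complex.norm_real, Complex.norm_two, norm_eq_abs]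
    linarith
  set Z : ℝ := 8 ^ γ * s ^ (-γ) with hZ
  have hZ0 : 0 < Z := by positivity
  have nγ : ‖(-γ : ℂ)‖ = γ := by simp [abs_of_pos hγ]
  have za0 : annulus (1/32) = 0 := za.eq_of_nhds
  have zb0 : annulus (1/2) = 0 := zb.eq_of_nhds
  have h := norm_integral_mul_cexp_le (F := amplitude γ s) (F' := F') (F'' := F'')
    (a := 1/32) (b := 1/2) (M := B * Z) (by norm_num) (by norm_num) dF dF' cF''
    (by rw [amplitude, za0]; simp) (by rw [amplitude, zb0]; simp)
    (by simp only [hF']; rw [za0, deriv_annulus_eq_zero za]; simp)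
    (by simp only [hF']; rw [zb0, deriv_annulus_eq_zero zb]; simp) ?_ ?_ x
  · refine h.trans (le_of_eq ?_)
    rw [hZ]; ring
  · intro ξ hξ
    change ‖(2 * annulus ξ : ℂ) * E ξ‖ ≤ _
    rw [norm_mul]
    exact mul_le_mul ((n0 _ 0 le_rfl (hD ξ hξ).1).trans hBD) (nE ξ hξ) (norm_nonneg _)
      (by positivity)
  · intro ξ hξ
    have m0 := n0 _ 0 le_rfl (hD ξ hξ).1
    have m1 := n0 _ 0 le_rfl (hD ξ hξ).2.1
    have m2 := n0 _ 0 le_rfl (hD ξ hξ).2.2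
    have e1 : ‖E ξ * (-γ * l1 ξ)‖ ≤ Z * (γ * L) := by
      rw [norm_mul, norm_mul, nγ]
      have := nE ξ hξ
      have := nl1 ξ hξ
      gcongr
    have e2 : ‖E ξ * (-γ * l1 ξ) * (-γ * l1 ξ) + E ξ * (-γ * l2 ξ)‖
        ≤ Z * (γ * L) * (γ * L) + Z * (γ * Q) := by
      refine (norm_add_le _ _).trans (add_le_add ?_ ?_)
      · rw [norm_mul, norm_mul (-γ : ℂ), nγ]
        have := nl1 ξ hξ
        gcongr
      · rw [norm_mul, norm_mul, nγ]
        have := nE ξ hξ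
        have := nl2 ξ hξ
        gcongr
    have t1 : ‖(2 * deriv annulus ξ : ℂ) * (E ξ * (-γ * l1 ξ))‖ ≤ 2 * D * (Z * (γ * L)) := by
      rw [norm_mul]; gcongr
    have t2 : ‖(2 * deriv (deriv annulus) ξ : ℂ) * E ξ‖ ≤ 2 * D * Z := by
      rw [norm_mul]; have := nE ξ hξ; gcongr
    have t3 : ‖(2 * annulus ξ : ℂ) * (E ξ * (-γ * l1 ξ) * (-γ * l1 ξ) + E ξ * (-γ * l2 ξ))‖
        ≤ 2 * D * (Z * (γ * L) * (γ * L) + Z * (γ * Q)) := by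
      rw [norm_mul]; gcongr
    have := norm_add_le (2 * deriv (deriv annulus) ξ * E ξ
      + 2 * deriv annulus ξ * (E ξ * (-γ * l1 ξ))) (2 * deriv annulus ξ * (E ξ * (-γ * l1 ξ))
      + 2 * annulus ξ * (E ξ * (-γ * l1 ξ) * (-γ * l1 ξ) + E ξ * (-γ * l2 ξ)))
    have u1 := norm_add_le (2 * deriv (deriv annulus) ξ * E ξ)
      (2 * deriv annulus ξ * (E ξ * (-γ * l1 ξ)))
    have u2 := norm_add_le (2 * deriv annulus ξ * (E ξ * (-γ * l1 ξ)))
      (2 * annulus ξ * (E ξ * (-γ * l1 ξ) * (-γ * l1 ξ) + E ξ * (-γ * l2 ξ)))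
    calc ‖F'' ξ‖ ≤ _ := this
      _ ≤ 2 * D * Z + 2 * D * (Z * (γ * L)) + (2 * D * (Z * (γ * L))
          + 2 * D * (Z * (γ * L) * (γ * L) + Z * (γ * Q))) := by linarith
      _ = B * Z := by rw [hB]; ring

theorem continuousOn_amplitude (γ : ℝ) {s : ℝ} (hs : s ∈ Set.Ioc (0:ℝ) 1) :
    ContinuousOn (amplitude γ s) (Set.Icc (1/32:ℝ) (1/2)) := by
  intro ξ hξ
  have hsin : 0 < sin (π * s * ξ) := by
    have := sin_scaled_ge hs hξ
    have := hs.1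
    linarith
  have hl : ContinuousAt (fun ξ => logSymbol (π * s * ξ)) ξ := by
    refine ContinuousAt.comp (f := fun ξ => π * s * ξ) (g := logSymbol)
      (hasDerivAt_logSymbol hsin).continuousAt (by fun_prop)
  have ha : ContinuousAt (fun ξ => (annulus ξ : ℂ)) ξ :=
    (Complex.continuous_ofReal.comp (contDiff_annulus (n := 2)).continuous).continuousAt
  refine ContinuousAt.continuousWithinAt ?_
  exact (continuousAt_const.mul ha).mul (continuousAt_const.mul hl).cexp

theorem hasSum_diffCoeff_amplitude {γ s ξ : ℝ} (hγ : 0 < γ) (hs : s ∈ Set.Ioc (0:ℝ) 1)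
    (hξ : ξ ∈ Set.Icc (1/32:ℝ) (1/2)) (x : ℝ) :
    HasSum (fun ν : ℕ => (diffCoeff γ ν : ℂ) * (amplitude γ s ξ
      * Complex.exp (2 * π * ((x + (γ - ν) * s : ℝ) : ℂ) * ξ * Complex.I)))
      (2 * annulus ξ * Complex.exp (2 * π * x * ξ * Complex.I)) := by
  set w : ℂ := Complex.exp (-(2 * (π * s * ξ : ℝ) * Complex.I)) with hw
  have hwn : ‖w‖ ≤ 1 := by
    have e : (-(2 * (π * s * ξ : ℝ) * Complex.I)) = ((-(2 * (π * s * ξ)) : ℝ) : ℂ) * Complex.I := by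
      push_cast; ring
    rw [hw, e, Complex.norm_exp_ofReal_mul_I]
  have hS : HasSum (fun ν : ℕ => (diffCoeff γ ν : ℂ) * w ^ ν) ((1 - w) ^ (γ : ℂ)) := by
    rw [← tsum_diffCoeff_complex hγ hwn]
    refine Summable.hasSum (Summable.of_norm_bounded (g := fun ν => |diffCoeff γ ν|)
      (summable_abs_diffCoeff hγ) fun ν => ?_)
    rw [norm_mul, norm_pow, Complex.norm_real, norm_eq_abs]
    exact mul_le_of_le_one_right (abs_nonneg _) (pow_le_one₀ (norm_nonneg _) hwn)
  have hu0 : 0 < π * s * ξ := by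
    have := hs.1; have : 0 < ξ := by linarith [hξ.1]
    positivity
  have hu1 : π * s * ξ ≤ π / 2 := by
    have : s * ξ ≤ 1 * (1/2) := mul_le_mul hs.2 hξ.2 (by linarith [hξ.1]) zero_le_one
    nlinarith [pi_pos]
  have key := cexp_logSymbol_mul (γ := γ) hu0 hu1
  rw [← hw] at key
  have h := hS.mul_left (2 * annulus ξ * Complex.exp (2 * π * x * ξ * Complex.I)
    * (Complex.exp (-γ * logSymbol (π * s * ξ)) * Complex.exp (2 * γ * (π * s * ξ : ℝ) * Complex.I)))
  have e2 : 2 * annulus ξ * Complex.exp (2 * π * x * ξ * Complex.I)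
    * (Complex.exp (-γ * logSymbol (π * s * ξ)) * Complex.exp (2 * γ * (π * s * ξ : ℝ) * Complex.I))
    * (1 - w) ^ (γ : ℂ) = 2 * annulus ξ * Complex.exp (2 * π * x * ξ * Complex.I) := by
    rw [mul_assoc, key, mul_one]
  rw [e2] at h
  refine h.congr_fun fun ν => ?_
  have e3 : Complex.exp (2 * π * ((x + (γ - ν) * s : ℝ) : ℂ) * ξ * Complex.I)
      = Complex.exp (2 * π * x * ξ * Complex.I) * Complex.exp (2 * γ * (π * s * ξ : ℝ) * Complex.I)
        * w ^ ν := by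
    rw [hw, ← Complex.exp_nat_mul, ← Complex.exp_add, ← Complex.exp_add]
    congr 1
    push_cast
    ring
  rw [e3, amplitude]
  ring

/-- A kernel with quadratic decay which inverts the difference operator of order `γ` and step `s`
on a fixed frequency band. -/
theorem exists_inverse_kernel {γ : ℝ} (hγ : 0 < γ) : ∃ C : ℝ, 0 < C ∧ ∀ s ∈ Set.Ioc (0:ℝ) 1,
    ∃ K : ℝ → ℝ, Continuous K ∧ (∀ x, |K x| ≤ C * s ^ (-γ) / (1 + x ^ 2)) ∧
      ∀ x, ∑' ν : ℕ, diffCoeff γ ν * K (x + (γ - ν) * s) = 2 * lowKer (2 * x) - lowKer x := by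
  obtain ⟨C, hC, hK⟩ := exists_norm_integral_amplitude_le hγ
  refine ⟨C, hC, fun s hs => ?_⟩
  have cA := continuousOn_amplitude γ hs
  obtain ⟨M, hM⟩ := isCompact_Icc.exists_bound_of_continuousOn cA
  have hI : Set.uIoc (1/32:ℝ) (1/2) = Set.Ioc (1/32:ℝ) (1/2) := Set.uIoc_of_le (by norm_num)
  have hsub : Set.Ioc (1/32:ℝ) (1/2) ⊆ Set.Icc (1/32:ℝ) (1/2) := Set.Ioc_subset_Icc_self
  have hn : ∀ x ξ : ℝ, ‖Complex.exp (2 * π * x * ξ * Complex.I)‖ = 1 := fun x ξ => by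
    have e : (2 * π * x * ξ * Complex.I : ℂ) = ((2 * π * x * ξ : ℝ) : ℂ) * Complex.I := by
      push_cast; ring
    rw [e, Complex.norm_exp_ofReal_mul_I]
  have cG : ∀ x : ℝ, ContinuousOn (fun ξ : ℝ => amplitude γ s ξ
      * Complex.exp (2 * π * x * ξ * Complex.I)) (Set.Icc (1/32:ℝ) (1/2)) := fun x =>
    cA.mul (by fun_prop)
  have mG : ∀ x : ℝ, AEStronglyMeasurable (fun ξ : ℝ => amplitude γ s ξ
      * Complex.exp (2 * π * x * ξ * Complex.I))
      (volume.restrict (Set.uIoc (1/32:ℝ) (1/2))) := fun x => by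
    rw [hI]
    exact ((cG x).mono hsub).aestronglyMeasurable measurableSet_Ioc
  have bG : ∀ x : ℝ, ∀ ξ ∈ Set.uIoc (1/32:ℝ) (1/2),
      ‖amplitude γ s ξ * Complex.exp (2 * π * x * ξ * Complex.I)‖ ≤ M := fun x ξ hξ => by
    rw [hI] at hξ
    rw [norm_mul, hn, mul_one]
    exact hM ξ (hsub hξ)
  refine ⟨fun x => (∫ ξ in (1/32:ℝ)..(1/2), amplitude γ s ξ
    * Complex.exp (2 * π * x * ξ * Complex.I)).re, ?_, fun x => ?_, fun x => ?_⟩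
  · refine Complex.continuous_re.comp ?_
    refine intervalIntegral.continuous_of_dominated_interval (bound := fun _ => M) mG
      (fun x => Filter.Eventually.of_forall fun ξ hξ => bG x ξ hξ) (by simp) ?_
    exact Filter.Eventually.of_forall fun ξ _ => by fun_prop
  · exact (Complex.abs_re_le_norm _).trans (hK s hs x)
  · have hsum := intervalIntegral.hasSum_integral_of_dominated_convergence
      (μ := volume) (a := 1/32) (b := 1/2)
      (F := fun (ν : ℕ) (ξ : ℝ) => (diffCoeff γ ν : ℂ) * (amplitude γ s ξ
        * Complex.exp (2 * π * ((x + (γ - ν) * s : ℝ) : ℂ) * ξ * Complex.I)))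
      (f := fun ξ => 2 * annulus ξ * Complex.exp (2 * π * x * ξ * Complex.I))
      (bound := fun ν _ => |diffCoeff γ ν| * M) (fun ν => (mG _).const_mul _)
      (fun ν => Filter.Eventually.of_forall fun ξ hξ => by
        rw [norm_mul, Complex.norm_real, norm_eq_abs]
        exact mul_le_mul_of_nonneg_left (bG _ ξ hξ) (abs_nonneg _))
      (Filter.Eventually.of_forall fun ξ _ => (summable_abs_diffCoeff hγ).mul_right M)
      (by simp)
      (Filter.Eventually.of_forall fun ξ hξ => by
        rw [hI] at hξ
        exact hasSum_diffCoeff_amplitude hγ hs (hsub hξ) x)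
    have hre := (Complex.hasSum_re hsum).tsum_eq
    have ci : IntervalIntegrable (fun ξ : ℝ => (2 * annulus ξ
        * Complex.exp (2 * π * x * ξ * Complex.I) : ℂ)) volume (1/32) (1/2) := by
      have ha : Continuous (fun ξ => (annulus ξ : ℂ)) :=
        (Complex.continuous_ofReal.comp (contDiff_annulus (n := 2)).continuous)
      refine Continuous.intervalIntegrable ?_ _ _
      fun_prop
    rw [lowKer_sub]
    have e1 : ∀ ν : ℕ, diffCoeff γ ν * (∫ ξ in (1/32:ℝ)..(1/2), amplitude γ s ξ
        * Complex.exp (2 * π * ((x + (γ - ν) * s : ℝ) : ℂ) * ξ * Complex.I)).re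
        = (∫ ξ in (1/32:ℝ)..(1/2), (diffCoeff γ ν : ℂ) * (amplitude γ s ξ
        * Complex.exp (2 * π * ((x + (γ - ν) * s : ℝ) : ℂ) * ξ * Complex.I))).re := fun ν => by
      rw [intervalIntegral.integral_const_mul, Complex.re_ofReal_mul]
    rw [tsum_congr e1, hre, ← intervalIntegral.integral_const_mul]
    have e2 := Complex.reCLM.intervalIntegral_comp_comm ci
    simp only [Complex.reCLM_apply] at e2
    rw [← e2]
    refine intervalIntegral.integral_congr fun ξ _ => ?_
    have e3 : (2 * annulus ξ * Complex.exp (2 * π * x * ξ * Complex.I) : ℂ)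
        = ((2 * annulus ξ : ℝ) : ℂ) * Complex.exp (((2 * π * x * ξ : ℝ) : ℂ) * Complex.I) := by
      push_cast; ring
    rw [e3, Complex.re_ofReal_mul, Complex.exp_ofReal_mul_I_re]
    ring

theorem lowKer_neg (x : ℝ) : lowKer (-x) = lowKer x := by
  unfold lowKer
  congr 1
  ext ξ
  rw [show 2 * π * -x * ξ = -(2 * π * x * ξ) by ring, cos_neg]

/-- A continuous kernel with quadratic decay. -/
structure DecayKernel (M : ℝ) (K : ℝ → ℝ) : Prop where
  cont : Continuous K
  nonneg : 0 ≤ M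
  bound : ∀ x, |K x| ≤ M / (1 + x ^ 2)

theorem exists_decayKernel_lowKer : ∃ M : ℝ, DecayKernel M lowKer := by
  obtain ⟨C, hC, h⟩ := exists_abs_lowKer_le
  exact ⟨C, continuous_lowKer, hC.le, h⟩

theorem exists_inverse_decayKernel {γ : ℝ} (hγ : 0 < γ) : ∃ C : ℝ, 0 < C ∧ ∀ s : ℝ, s ≠ 0 →
    |s| ≤ 1 → ∃ K : ℝ → ℝ, DecayKernel (C * |s| ^ (-γ)) K ∧
      ∀ x, ∑' ν : ℕ, diffCoeff γ ν * K (x + (γ - ν) * s) = 2 * lowKer (2 * x) - lowKer x := by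
  obtain ⟨C, hC, h⟩ := exists_inverse_kernel hγ
  refine ⟨C, hC, fun s hs0 hs1 => ?_⟩
  obtain ⟨K, hKc, hKb, hKs⟩ := h |s| ⟨abs_pos.2 hs0, hs1⟩
  rcases lt_or_gt_of_ne hs0 with hs | hs
  · refine ⟨fun x => K (-x), ⟨hKc.comp continuous_neg, by positivity, fun x => ?_⟩, fun x => ?_⟩
    · have := hKb (-x)
      rwa [neg_sq] at this
    · have := hKs (-x)
      rw [abs_of_neg hs, mul_neg, lowKer_neg, lowKer_neg] at this
      rw [← this]
      refine tsum_congr fun ν => ?_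
      congr 2
      ring_nf
  · rw [abs_of_pos hs] at hKb hKs ⊢
    exact ⟨K, ⟨hKc, by positivity, hKb⟩, hKs⟩

/-- The `L¹`-normalized dilation of a kernel. -/
def dilate (t : ℝ) (K : ℝ → ℝ) (x : ℝ) : ℝ := t⁻¹ * K (x / t)

/-- Convolution over the line. -/
def lineConv (K g : ℝ → ℝ) (x : ℝ) : ℝ := ∫ u, K (x - u) * g u

/-- The fractional difference of a function of one variable. -/
def diffOne (γ h : ℝ) (g : ℝ → ℝ) (x : ℝ) : ℝ :=
  ∑' ν : ℕ, diffCoeff γ ν * g (x + (γ - ν) * h)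

/-- Periodic functions integrable over a period. -/
structure PeriodicL1 (g : ℝ → ℝ) : Prop where
  meas : Measurable g
  per : Function.Periodic g (2 * π)
  fin : ∫⁻ x, ENNReal.ofReal |g x| ∂perMeas ≠ ⊤

theorem PeriodicL1.absper {g : ℝ → ℝ} (hg : PeriodicL1 g) :
    Function.Periodic (fun x => ENNReal.ofReal |g x|) (2 * π) := fun x => by
  simp only [hg.per x]

theorem PeriodicL1.absmeas {g : ℝ → ℝ} (hg : PeriodicL1 g) :
    Measurable (fun x => ENNReal.ofReal |g x|) := by
  have := hg.meas
  fun_prop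

theorem PeriodicL1.shift {g : ℝ → ℝ} (hg : PeriodicL1 g) (a : ℝ) :
    PeriodicL1 (fun x => g (x + a)) ∧
    ∫⁻ x, ENNReal.ofReal |g (x + a)| ∂perMeas = ∫⁻ x, ENNReal.ofReal |g x| ∂perMeas := by
  have e := lintegral_perMeas_add hg.absper a
  refine ⟨⟨hg.meas.comp (measurable_id.add_const a), fun x => ?_, ?_⟩, e⟩
  · rw [← hg.per (x + a)]
    congr 1
    ring
  · rw [e]; exact hg.fin

theorem DecayKernel.continuous_dilate {M : ℝ} {K : ℝ → ℝ} (hK : DecayKernel M K) (t : ℝ) :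
    Continuous (dilate t K) := by
  have := hK.cont
  unfold dilate
  fun_prop

theorem DecayKernel.lintegral_le {M : ℝ} {K : ℝ → ℝ} (hK : DecayKernel M K) {t : ℝ}
    (ht : 0 < t) {g : ℝ → ℝ} (hg : Measurable g) (x : ℝ) :
    ∫⁻ u, ‖dilate t K (x - u) * g u‖ₑ
      ≤ ENNReal.ofReal M * convMeas (cauchyMeas t) (fun y => ENNReal.ofReal |g y|) x := by
  have hm : Measurable fun y => ENNReal.ofReal |g y| := by fun_prop
  rw [convMeas_cauchyMeas t hm, ← lintegral_const_mul _ (by fun_prop),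
    ← lintegral_sub_left_eq_self (fun u => ‖dilate t K (x - u) * g u‖ₑ) x]
  refine lintegral_mono fun s => ?_
  simp only [sub_sub_cancel]
  rw [← mul_assoc, ← ENNReal.ofReal_mul hK.nonneg, enorm_mul, enorm_eq_ofReal_abs,
    enorm_eq_ofReal_abs]
  refine mul_le_mul_left (ENNReal.ofReal_le_ofReal ?_) _
  unfold dilate
  rw [abs_mul, abs_of_pos (inv_pos.2 ht)]
  calc t⁻¹ * |K (s / t)| ≤ t⁻¹ * (M / (1 + (s / t) ^ 2)) := by
        have := hK.bound (s / t); gcongr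
    _ = M * (t / (t ^ 2 + s ^ 2)) := by field_simp

theorem exists_lintegral_dilate_le : ∃ A : ℝ≥0∞, A ≠ ⊤ ∧ ∀ {t : ℝ}, 0 < t → t ≤ 2 →
    ∀ {M : ℝ} {K : ℝ → ℝ}, DecayKernel M K → ∀ {g : ℝ → ℝ}, PeriodicL1 g → ∀ x,
      ∫⁻ u, ‖dilate t K (x - u) * g u‖ₑ ≤ ENNReal.ofReal M *
        (A * (ENNReal.ofReal t)⁻¹ * ∫⁻ y, ENNReal.ofReal |g y| ∂perMeas) := by
  obtain ⟨A, hA, -, h⟩ := exists_goodKernel_cauchyMeas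
  refine ⟨A, hA, fun {t} ht0 ht2 M K hK g hg x => (hK.lintegral_le ht0 hg.meas x).trans ?_⟩
  gcongr
  exact (h t ht0 ht2).sup_le _ hg.absmeas hg.absper x

theorem DecayKernel.integrable {M : ℝ} {K : ℝ → ℝ} (hK : DecayKernel M K) {t : ℝ}
    (ht : 0 < t) (ht2 : t ≤ 2) {g : ℝ → ℝ} (hg : PeriodicL1 g) (x : ℝ) :
    Integrable (fun u => dilate t K (x - u) * g u) := by
  obtain ⟨A, hA, h⟩ := exists_lintegral_dilate_le
  have hm := hg.meas
  have hc := hK.continuous_dilate t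
  refine ⟨by fun_prop, lt_of_le_of_lt (h ht ht2 hK hg x) ?_⟩
  have h1 : (ENNReal.ofReal t)⁻¹ ≠ ⊤ := by simpa using ht
  exact (ENNReal.mul_ne_top ENNReal.ofReal_ne_top
    (ENNReal.mul_ne_top (ENNReal.mul_ne_top hA h1) hg.fin)).lt_top

theorem DecayKernel.lineConv_le {M : ℝ} {K : ℝ → ℝ} (hK : DecayKernel M K) {t : ℝ}
    (ht : 0 < t) {g : ℝ → ℝ} (hg : Measurable g) (x : ℝ) :
    ENNReal.ofReal |lineConv (dilate t K) g x|
      ≤ ENNReal.ofReal M * convMeas (cauchyMeas t) (fun y => ENNReal.ofReal |g y|) x := by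
  rw [← enorm_eq_ofReal_abs]
  exact (enorm_integral_le_lintegral_enorm _).trans (hK.lintegral_le ht hg x)

/-- Uniform bound for the integrals of a kernel against the translates of a function. -/
theorem DecayKernel.exists_integral_norm_le {M : ℝ} {K : ℝ → ℝ} (hK : DecayKernel M K) {t : ℝ}
    (ht : 0 < t) (ht2 : t ≤ 2) {g : ℝ → ℝ} (hg : PeriodicL1 g) :
    ∃ B : ℝ, ∀ a x, ∫ u, ‖dilate t K (x - u) * g (u + a)‖ ≤ B := by
  obtain ⟨A, hA, h⟩ := exists_lintegral_dilate_le
  have h1 : (ENNReal.ofReal t)⁻¹ ≠ ⊤ := by simpa using ht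
  have hfin := ENNReal.mul_ne_top (a := ENNReal.ofReal M) ENNReal.ofReal_ne_top
    (ENNReal.mul_ne_top (ENNReal.mul_ne_top hA h1) hg.fin)
  refine ⟨(ENNReal.ofReal M * (A * (ENNReal.ofReal t)⁻¹
    * ∫⁻ y, ENNReal.ofReal |g y| ∂perMeas)).toReal, fun a x => ?_⟩
  rw [integral_norm_eq_lintegral_enorm (hK.integrable ht ht2 (hg.shift a).1 x).1]
  refine ENNReal.toReal_mono hfin ?_
  have := h ht ht2 hK (hg.shift a).1 x
  rwa [(hg.shift a).2] at this

theorem lineConv_dilate_diffOne {γ t h M : ℝ} {K R g : ℝ → ℝ} (hγ : 0 < γ) (ht : 0 < t)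
    (ht2 : t ≤ 2) (hK : DecayKernel M K)
    (hR : ∀ x, ∑' ν : ℕ, diffCoeff γ ν * K (x + (γ - ν) * (h / t)) = R x)
    (hg : PeriodicL1 g) (x : ℝ) :
    lineConv (dilate t K) (diffOne γ h g) x = lineConv (dilate t R) g x := by
  obtain ⟨B, hB⟩ := hK.exists_integral_norm_le ht ht2 hg
  set a : ℕ → ℝ := fun ν => (γ - ν) * h with ha
  set F : ℕ → ℝ → ℝ := fun ν w => diffCoeff γ ν * (dilate t K (x - w) * g (w + a ν)) with hF
  set F' : ℕ → ℝ → ℝ := fun ν u => diffCoeff γ ν * (dilate t K (x + a ν - u) * g u) with hF'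
  have iF : ∀ ν, Integrable (F ν) := fun ν =>
    (hK.integrable ht ht2 (hg.shift (a ν)).1 x).const_mul _
  have iF' : ∀ ν, Integrable (F' ν) := fun ν =>
    (hK.integrable ht ht2 hg (x + a ν)).const_mul _
  have sB := (summable_abs_diffCoeff hγ).mul_right B
  have sF : Summable fun ν => ∫ w, ‖F ν w‖ := by
    refine Summable.of_nonneg_of_le (fun ν => integral_nonneg fun _ => norm_nonneg _)
      (fun ν => ?_) sB
    simp only [hF]
    simp_rw [norm_mul (diffCoeff γ ν), integral_const_mul, norm_eq_abs (diffCoeff γ ν)]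
    exact mul_le_mul_of_nonneg_left (hB (a ν) x) (abs_nonneg _)
  have sF' : Summable fun ν => ∫ w, ‖F' ν w‖ := by
    refine Summable.of_nonneg_of_le (fun ν => integral_nonneg fun _ => norm_nonneg _)
      (fun ν => ?_) sB
    simp only [hF']
    simp_rw [norm_mul (diffCoeff γ ν), integral_const_mul, norm_eq_abs (diffCoeff γ ν)]
    have := hB 0 (x + a ν)
    simp only [add_zero] at this
    exact mul_le_mul_of_nonneg_left this (abs_nonneg _)
  have e1 : lineConv (dilate t K) (diffOne γ h g) x = ∫ w, ∑' ν, F ν w := by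
    unfold lineConv
    congr 1; ext w
    simp only [diffOne, hF]
    rw [← tsum_mul_left]
    exact tsum_congr fun ν => by ring
  have e2 : lineConv (dilate t R) g x = ∫ u, ∑' ν, F' ν u := by
    unfold lineConv
    congr 1; ext u
    unfold dilate
    rw [← hR, ← tsum_mul_left, ← tsum_mul_right]
    refine tsum_congr fun ν => ?_
    simp only [hF', ha, dilate]
    rw [show (x + (γ - ν) * h - u) / t = (x - u) / t + (γ - ν) * (h / t) by ring]
    ring
  rw [e1, e2, ← integral_tsum_of_summable_integral_norm iF sF,
    ← integral_tsum_of_summable_integral_norm iF' sF']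
  refine tsum_congr fun ν => ?_
  rw [← integral_sub_right_eq_self (F ν) (a ν)]
  congr 1; ext u
  simp only [hF, hF', sub_add_cancel]
  rw [show x - (u - a ν) = x + a ν - u by ring]

theorem lineConv_dilate_lowKer_sub {t : ℝ} (ht : 0 < t) (ht2 : t ≤ 2) {g : ℝ → ℝ}
    (hg : PeriodicL1 g) (x : ℝ) :
    lineConv (dilate t fun x => 2 * lowKer (2 * x) - lowKer x) g x
      = lineConv (dilate (t / 2) lowKer) g x - lineConv (dilate t lowKer) g x := by
  obtain ⟨M, hM⟩ := exists_decayKernel_lowKer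
  unfold lineConv
  rw [← integral_sub (hM.integrable (by positivity) (by linarith) hg x)
    (hM.integrable ht ht2 hg x)]
  congr 1; ext u
  unfold dilate
  rw [show (x - u) / (t / 2) = 2 * ((x - u) / t) by field_simp]
  field_simp

theorem lineConv_dilate_lowKer_eq_zero {T : ℝ} (hT1 : 1 ≤ T) (hT2 : T ≤ 2) {g : ℝ → ℝ}
    (hg : PeriodicL1 g) (h0 : ∫ x, g x ∂perMeas = 0) (x : ℝ) :
    lineConv (dilate T lowKer) g x = 0 := by
  obtain ⟨M, hM⟩ := exists_decayKernel_lowKer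
  have hp : (0:ℝ) < 2 * π := by positivity
  have hint := hM.integrable (by linarith) hT2 hg x
  set f : ℝ → ℝ := fun u => dilate T lowKer (x - u) * g u with hf
  set F : ℝ → ℝ := fun v => f (2 * π * v) with hFdef
  have iF : Integrable F := hint.comp_mul_left' hp.ne'
  have hgn : ∀ (v : ℝ) (n : ℤ), g (2 * π * (v + n)) = g (2 * π * v) := fun v n => by
    have := hg.per.int_mul n (2 * π * v)
    rw [← this]; congr 1; ring
  have e1 : ∫ u, f u = 2 * π * ∫ v, F v := by
    rw [hFdef, Measure.integral_comp_mul_left, smul_eq_mul, abs_of_pos (inv_pos.2 hp)]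
    field_simp
  have s1 := iF.hasSum_intervalIntegral_comp_add_int
  have s2 := iF.norm.hasSum_intervalIntegral_comp_add_int.summable
  have iF' : ∀ n : ℤ, Integrable (fun v : ℝ => F (v + n)) (volume.restrict (Set.Ioc (0:ℝ) 1)) :=
    fun n => (iF.comp_add_right (n:ℝ)).restrict
  simp_rw [intervalIntegral.integral_of_le (zero_le_one (α := ℝ))] at s1 s2
  have s3 := integral_tsum_of_summable_integral_norm iF' s2
  rw [s1.tsum_eq] at s3
  have key : ∀ v : ℝ, ∑' n : ℤ, F (v + n) = (2 * π)⁻¹ * g (2 * π * v) := by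
    intro v
    have ht := tsum_lowKer (t := T / (2 * π))
      (by rw [div_le_div_iff₀ (by norm_num) hp]; nlinarith [pi_le_four]) (x / (2 * π) - v)
    rw [← (Equiv.neg ℤ).tsum_eq] at ht
    have e3 : ∀ n : ℤ, F (v + n) = (2 * π)⁻¹ * g (2 * π * v) * ((T / (2 * π))⁻¹
        * lowKer ((x / (2 * π) - v + ((Equiv.neg ℤ n : ℤ) : ℝ)) / (T / (2 * π)))) := by
      intro n
      simp only [hFdef, hf, hgn, dilate, Equiv.neg_apply, Int.cast_neg]
      have : (x - 2 * π * (v + n)) / T = (x / (2 * π) - v + -n) / (T / (2 * π)) := by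
        field_simp; ring
      rw [this]
      field_simp
    rw [tsum_congr e3, tsum_mul_left, ht, mul_one]
  simp_rw [key] at s3
  have e4 : ∫ v in Set.Ioc (0:ℝ) 1, g (2 * π * v) = 0 := by
    rw [← intervalIntegral.integral_of_le zero_le_one,
      intervalIntegral.integral_comp_mul_left _ hp.ne', mul_zero, mul_one,
      intervalIntegral.integral_of_le hp.le]
    have : ∫ x in Set.Ioc 0 (2 * π), g x = 0 := h0
    rw [this, smul_zero]
  rw [integral_const_mul, e4, mul_zero] at s3
  change ∫ u, f u = 0
  rw [e1, s3, mul_zero]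

theorem PeriodicL1.integrableOn {g : ℝ → ℝ} (hg : PeriodicL1 g) :
    Integrable g perMeas := by
  refine ⟨hg.meas.aestronglyMeasurable, ?_⟩
  have := hg.fin.lt_top
  simpa only [HasFiniteIntegral, enorm_eq_ofReal_abs] using this

theorem PeriodicL1.integrable_indicator {g : ℝ → ℝ} (hg : PeriodicL1 g) :
    Integrable ((Set.Ioc (-(2 * π)) (4 * π)).indicator g) := by
  rw [integrable_indicator_iff measurableSet_Ioc]
  have h1 : IntervalIntegrable g volume 0 (0 + 2 * π) := by
    rw [intervalIntegrable_iff_integrableOn_Ioc_of_le (by linarith [pi_pos]), zero_add]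
    exact hg.integrableOn
  have h2 := hg.per.intervalIntegrable (by linarith [pi_pos]) h1 (-(2 * π)) (4 * π)
  rwa [intervalIntegrable_iff_integrableOn_Ioc_of_le (by linarith [pi_pos])] at h2

theorem PeriodicL1.tendsto_translate {g : ℝ → ℝ} (hg : PeriodicL1 g) :
    Filter.Tendsto (fun s => ∫⁻ x, ‖g (x - s) - g x‖ₑ ∂perMeas) (nhds 0) (nhds 0) := by
  set G := (Set.Ioc (-(2 * π)) (4 * π)).indicator g with hG
  have iG : Integrable G := hg.integrable_indicator
  rw [ENNReal.tendsto_nhds_zero]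
  intro ε hε
  obtain ⟨δ, hδ0, hδ⟩ : ∃ δ : ℝ≥0∞, δ ≠ 0 ∧ 4 * δ ≤ ε := by
    refine ⟨ε / 4, ?_, (ENNReal.mul_div_cancel (by simp) (by simp)).le⟩
    simp [hε.ne', ENNReal.div_eq_zero_iff]
  have hV : perMeas Set.univ ≠ ⊤ := measure_ne_top _ _
  obtain ⟨φ, hφc, hφ, hcont, hφi⟩ := iG.exists_hasCompactSupport_lintegral_sub_le hδ0
  obtain ⟨r, hr0, hr⟩ : ∃ r : ℝ, 0 < r ∧ ENNReal.ofReal r * perMeas Set.univ ≤ δ := by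
    rcases eq_or_ne δ ⊤ with rfl | hδt
    · exact ⟨1, one_pos, le_top⟩
    refine ⟨δ.toReal / ((perMeas Set.univ).toReal + 1), ?_, ?_⟩
    · have := ENNReal.toReal_pos hδ0 hδt
      positivity
    · rw [← ENNReal.ofReal_toReal hV, ← ENNReal.ofReal_mul (by positivity)]
      refine ENNReal.ofReal_le_of_le_toReal ?_
      rw [ENNReal.toReal_ofReal ENNReal.toReal_nonneg, div_mul_eq_mul_div]
      rw [div_le_iff₀ (by positivity)]
      nlinarith [ENNReal.toReal_nonneg (a := δ), ENNReal.toReal_nonneg (a := perMeas Set.univ)]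
  have hu := hcont.uniformContinuous_of_tendsto_cocompact hφc.is_zero_at_infty
  obtain ⟨ρ, hρ0, hρ⟩ := Metric.uniformContinuous_iff.1 hu r hr0
  have hρ1 : 0 < min ρ 1 := by positivity
  filter_upwards [Metric.ball_mem_nhds (0:ℝ) hρ1] with s hs
  rw [Metric.mem_ball, dist_zero_right, norm_eq_abs, lt_min_iff] at hs
  have hGm : Measurable G := hg.meas.indicator measurableSet_Ioc
  have hφm : Measurable φ := hcont.measurable
  have hle : ∀ w : ℝ → ℝ≥0∞, ∫⁻ x, w x ∂perMeas ≤ ∫⁻ x, w x := fun w => by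
    unfold perMeas
    exact setLIntegral_le_lintegral _ _
  calc ∫⁻ x, ‖g (x - s) - g x‖ₑ ∂perMeas
      = ∫⁻ x, ‖G (x - s) - G x‖ₑ ∂perMeas := by
        unfold perMeas
        refine setLIntegral_congr_fun measurableSet_Ioc fun x hx => ?_
        have h1 := abs_lt.1 hs.2
        have := pi_gt_three
        have m1 : x - s ∈ Set.Ioc (-(2 * π)) (4 * π) :=
          ⟨by linarith [hx.1], by linarith [hx.2]⟩
        have m2 : x ∈ Set.Ioc (-(2 * π)) (4 * π) := ⟨by linarith [hx.1], by linarith [hx.2]⟩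
        simp only [hG, Set.indicator_of_mem m1, Set.indicator_of_mem m2]
    _ ≤ ∫⁻ x, (‖G (x - s) - φ (x - s)‖ₑ + ENNReal.ofReal r + ‖G x - φ x‖ₑ) ∂perMeas := by
        refine lintegral_mono fun x => ?_
        have h3 : ‖φ (x - s) - φ x‖ₑ ≤ ENNReal.ofReal r := by
          rw [enorm_eq_ofReal_abs]
          refine ENNReal.ofReal_le_ofReal ?_
          have := (hρ (a := x - s) (b := x) (by
            rw [dist_eq]; simpa using hs.1)).le
          rwa [dist_eq] at this
        calc ‖G (x - s) - G x‖ₑ = ‖(G (x - s) - φ (x - s)) + (φ (x - s) - φ x) - (G x - φ x)‖ₑ := by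
              congr 1; ring
          _ ≤ ‖G (x - s) - φ (x - s)‖ₑ + ‖φ (x - s) - φ x‖ₑ + ‖G x - φ x‖ₑ :=
              enorm_sub_le.trans (add_le_add_left (enorm_add_le _ _) _)
          _ ≤ _ := by gcongr
    _ = ∫⁻ x, ‖G (x - s) - φ (x - s)‖ₑ ∂perMeas + ENNReal.ofReal r * perMeas Set.univ
          + ∫⁻ x, ‖G x - φ x‖ₑ ∂perMeas := by
        rw [lintegral_add_left (by fun_prop), lintegral_add_left (by fun_prop), lintegral_const]
    _ ≤ δ + δ + δ := by
        refine add_le_add (add_le_add ((hle _).trans ?_) hr) ((hle _).trans hφ)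
        rw [lintegral_sub_right_eq_self (fun x => ‖G x - φ x‖ₑ) s]
        exact hφ
    _ ≤ 4 * δ := by
        rw [show (4:ℝ≥0∞) = 1 + 1 + 1 + 1 by norm_num, add_mul, add_mul, add_mul, one_mul]
        exact le_self_add
    _ ≤ ε := hδ

theorem lineConv_dilate_eq {t : ℝ} (ht : 0 < t) (K g : ℝ → ℝ) (x : ℝ) :
    lineConv (dilate t K) g x = ∫ s, K s * g (x - t * s) := by
  have h1 : lineConv (dilate t K) g x = ∫ u, dilate t K u * g (x - u) := by
    unfold lineConv
    rw [← integral_sub_left_eq_self (fun u => dilate t K (x - u) * g u) volume x]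
    simp only [sub_sub_cancel]
  have h2 := Measure.integral_comp_mul_left (fun u => dilate t K u * g (x - u)) t
  rw [h1]
  rw [abs_of_pos (inv_pos.2 ht), smul_eq_mul] at h2
  have h3 : ∫ u, dilate t K u * g (x - u) = t * ∫ s, dilate t K (t * s) * g (x - t * s) := by
    rw [h2]; field_simp
  rw [h3, ← integral_const_mul]
  congr 1; ext s
  unfold dilate
  rw [mul_div_cancel_left₀ _ ht.ne']
  field_simp

theorem integrable_lowKer : Integrable lowKer := by
  obtain ⟨M, hM⟩ := exists_decayKernel_lowKer
  refine Integrable.mono' (integrable_inv_one_add_sq.const_mul M)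
    hM.cont.aestronglyMeasurable (Filter.Eventually.of_forall fun x => ?_)
  rw [norm_eq_abs, ← div_eq_mul_inv]
  exact hM.bound x

theorem tendsto_lintegral_lineConv_sub {g : ℝ → ℝ} (hg : PeriodicL1 g) {t : ℕ → ℝ}
    (ht : ∀ n, 0 < t n) (ht2 : ∀ n, t n ≤ 2) (h0 : Filter.Tendsto t Filter.atTop (nhds 0)) :
    Filter.Tendsto (fun n => ∫⁻ x, ‖lineConv (dilate (t n) lowKer) g x - g x‖ₑ ∂perMeas)
      Filter.atTop (nhds 0) := by
  obtain ⟨M, hM⟩ := exists_decayKernel_lowKer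
  have hgm := hg.meas
  have hlm := continuous_lowKer.measurable
  set ω : ℝ → ℝ≥0∞ := fun s => ∫⁻ x, ‖g (x - s) - g x‖ₑ ∂perMeas with hω
  have hωm : Measurable ω :=
    Measurable.lintegral_prod_right' (f := fun z : ℝ × ℝ => ‖g (z.2 - z.1) - g z.2‖ₑ)
      (by fun_prop)
  set N : ℝ≥0∞ := ∫⁻ x, ENNReal.ofReal |g x| ∂perMeas with hN
  have hωb : ∀ s, ω s ≤ 2 * N := fun s => by
    calc ω s ≤ ∫⁻ x, (ENNReal.ofReal |g (x - s)| + ENNReal.ofReal |g x|) ∂perMeas := by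
          refine lintegral_mono fun x => ?_
          rw [← enorm_eq_ofReal_abs, ← enorm_eq_ofReal_abs]
          exact enorm_sub_le
      _ = 2 * N := by
          rw [lintegral_add_left (by fun_prop), lintegral_perMeas_sub hg.absper, two_mul]
  have hbound : ∀ n, ∫⁻ x, ‖lineConv (dilate (t n) lowKer) g x - g x‖ₑ ∂perMeas
      ≤ ∫⁻ s, ‖lowKer s‖ₑ * ω (t n * s) := fun n => by
    calc ∫⁻ x, ‖lineConv (dilate (t n) lowKer) g x - g x‖ₑ ∂perMeas
        ≤ ∫⁻ x, (∫⁻ s, ‖lowKer s * (g (x - t n * s) - g x)‖ₑ) ∂perMeas := by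
          refine lintegral_mono fun x => ?_
          have e : lineConv (dilate (t n) lowKer) g x - g x
              = ∫ s, lowKer s * (g (x - t n * s) - g x) := by
            rw [lineConv_dilate_eq (ht n)]
            simp_rw [mul_sub]
            rw [integral_sub, integral_mul_const, integral_lowKer, one_mul]
            · have := hM.integrable (ht n) (ht2 n) hg x
              have h2 := (this.comp_sub_left x).comp_mul_left' (ht n).ne'
              refine ((h2.const_mul (t n)).congr (Filter.Eventually.of_forall fun s => ?_))
              simp only [dilate, sub_sub_cancel]
              rw [mul_div_cancel_left₀ _ (ht n).ne']
              have := (ht n).ne'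
              field_simp
            · exact integrable_lowKer.mul_const _
          simp only [e]
          exact enorm_integral_le_lintegral_enorm _
      _ = ∫⁻ s, ∫⁻ x, ‖lowKer s * (g (x - t n * s) - g x)‖ₑ ∂perMeas := by
          rw [lintegral_lintegral_swap]
          refine Measurable.aemeasurable ?_
          unfold Function.uncurry
          fun_prop
      _ = ∫⁻ s, ‖lowKer s‖ₑ * ω (t n * s) := by
          refine lintegral_congr fun s => ?_
          simp_rw [enorm_mul]
          rw [lintegral_const_mul _ (by fun_prop)]
  refine tendsto_of_tendsto_of_tendsto_of_le_of_le tendsto_const_nhds ?_ (fun _ => bot_le)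
    hbound
  have hdct := tendsto_lintegral_of_dominated_convergence (μ := (volume : Measure ℝ))
    (F := fun n s => ‖lowKer s‖ₑ * ω (t n * s)) (f := fun _ => 0)
    (fun s => ‖lowKer s‖ₑ * (2 * N))
    (fun n => by fun_prop)
    (fun n => Filter.Eventually.of_forall fun s => mul_le_mul_right (hωb _) _)
    (by
      rw [lintegral_mul_const _ (by fun_prop)]
      exact ENNReal.mul_ne_top integrable_lowKer.2.ne (ENNReal.mul_ne_top (by simp) hg.fin))
    (Filter.Eventually.of_forall fun s => by
      have h1 : Filter.Tendsto (fun n => t n * s) Filter.atTop (nhds 0) := by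
        simpa using h0.mul_const s
      have := ENNReal.Tendsto.const_mul (a := ‖lowKer s‖ₑ) (hg.tendsto_translate.comp h1)
        (Or.inr enorm_ne_top)
      simpa using this)
  simpa using hdct

theorem exists_seq_tendsto_lineConv {g : ℝ → ℝ} (hg : PeriodicL1 g) {t : ℕ → ℝ}
    (ht : ∀ n, 0 < t n) (ht2 : ∀ n, t n ≤ 2) (h0 : Filter.Tendsto t Filter.atTop (nhds 0)) :
    ∃ φ : ℕ → ℕ, StrictMono φ ∧ ∀ᵐ x ∂perMeas, Filter.Tendsto
      (fun n => lineConv (dilate (t (φ n)) lowKer) g x) Filter.atTop (nhds (g x)) := by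
  have hgm := hg.meas
  have hm : ∀ n, StronglyMeasurable (lineConv (dilate (t n) lowKer) g) := fun n => by
    obtain ⟨M, hM⟩ := exists_decayKernel_lowKer
    have hc := (hM.continuous_dilate (t n)).measurable
    have : Measurable fun z : ℝ × ℝ => dilate (t n) lowKer (z.1 - z.2) * g z.2 := by fun_prop
    exact this.stronglyMeasurable.integral_prod_right'
  have h1 : TendstoInMeasure perMeas (fun n => lineConv (dilate (t n) lowKer) g)
      Filter.atTop g := by
    refine tendstoInMeasure_of_tendsto_eLpNorm (p := 1) one_ne_zero
      (fun n => (hm n).aestronglyMeasurable) hgm.aestronglyMeasurable ?_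
    simp_rw [eLpNorm_one_eq_lintegral_enorm]
    exact tendsto_lintegral_lineConv_sub hg ht ht2 h0
  exact h1.exists_seq_tendsto_ae

theorem measurable_diffOne (γ h : ℝ) {g : ℝ → ℝ} (hg : Measurable g) :
    Measurable (diffOne γ h g) := by
  unfold diffOne
  exact Measurable.tsum fun ν => by fun_prop

/-- The differences of order `θ` at step `h` and of order `β` at the dyadic steps `h / 2 ^ k`. -/
def diffSeq (θ β h : ℝ) (g : ℝ → ℝ) : ℕ → ℝ → ℝ≥0∞
  | 0 => fun x => ENNReal.ofReal |diffOne θ h g x|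
  | k + 1 => fun x => ENNReal.ofReal |diffOne β (h / 2 ^ k) g x|

/-- A frequency band of a periodic function is controlled by its fractional difference. -/
theorem exists_band_le {γ : ℝ} (hγ : 0 < γ) : ∃ C : ℝ, 0 < C ∧ ∀ t h : ℝ, 0 < t → t ≤ 2 →
    h ≠ 0 → |h| ≤ t → ∀ g : ℝ → ℝ, PeriodicL1 g → ∀ x,
      ENNReal.ofReal |lineConv (dilate (t / 2) lowKer) g x - lineConv (dilate t lowKer) g x| ≤
        ENNReal.ofReal (C * (|h| / t) ^ (-γ)) *
          convMeas (cauchyMeas t) (fun y => ENNReal.ofReal |diffOne γ h g y|) x := by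
  obtain ⟨C, hC, H⟩ := exists_inverse_decayKernel hγ
  refine ⟨C, hC, fun t h ht ht2 hh hht g hg x => ?_⟩
  have e : |h / t| = |h| / t := by rw [abs_div, abs_of_pos ht]
  obtain ⟨K, hK, hR⟩ := H (h / t) (div_ne_zero hh ht.ne') (by
    rw [e, div_le_one ht]; exact hht)
  rw [e] at hK
  rw [← lineConv_dilate_lowKer_sub ht ht2 hg, ← lineConv_dilate_diffOne hγ ht ht2 hK hR hg]
  exact hK.lineConv_le ht (measurable_diffOne γ h hg.meas) x

theorem ofReal_abs_sum_range_sub_le (f : ℕ → ℝ) (n : ℕ) :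
    ENNReal.ofReal |f n| ≤ ENNReal.ofReal |f 0|
      + ∑ i ∈ Finset.range n, ENNReal.ofReal |f (i + 1) - f i| := by
  rw [← ENNReal.ofReal_sum_of_nonneg (fun _ _ => abs_nonneg _),
    ← ENNReal.ofReal_add (abs_nonneg _) (Finset.sum_nonneg fun _ _ => abs_nonneg _)]
  refine ENNReal.ofReal_le_ofReal ?_
  have h := Finset.sum_range_sub f n
  calc |f n| = |f 0 + ∑ i ∈ Finset.range n, (f (i + 1) - f i)| := by rw [h]; congr 1; ring
    _ ≤ |f 0| + |∑ i ∈ Finset.range n, (f (i + 1) - f i)| := abs_add_le _ _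
    _ ≤ _ := add_le_add le_rfl (Finset.abs_sum_le_sum_abs _ _)

theorem exists_low_band_le {θ : ℝ} (hθ : 0 < θ) : ∃ C : ℝ, 0 < C ∧ ∀ h : ℝ, h ≠ 0 → |h| ≤ 1 →
    ∀ g : ℝ → ℝ, PeriodicL1 g → ∫ x, g x ∂perMeas = 0 → ∀ x,
      ENNReal.ofReal |lineConv (dilate |h| lowKer) g x| ≤ ENNReal.ofReal C *
        (ENNReal.ofReal |h| ^ (-θ) * ∑' i : ℕ, ENNReal.ofReal (topScale |h| / 2 ^ i) ^ θ *
          convMeas (cauchyMeas (topScale |h| / 2 ^ i))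
            (fun y => ENNReal.ofReal |diffOne θ h g y|) x) := by
  obtain ⟨C, hC, H⟩ := exists_band_le hθ
  refine ⟨C, hC, fun h hh hh1 g hg h0 x => ?_⟩
  have hη : 0 < |h| := abs_pos.2 hh
  obtain ⟨hT1, hT2⟩ := topScale_mem hη hh1
  obtain ⟨J, hJ⟩ : ∃ J : ℕ, topScale |h| = 2 ^ J * |h| := ⟨_, rfl⟩
  generalize topScale |h| = T at *
  have hT0 : 0 < T := by linarith
  have h1 := ofReal_abs_sum_range_sub_le (fun i => lineConv (dilate (T / 2 ^ i) lowKer) g x) J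
  have e1 : T / 2 ^ J = |h| := by rw [hJ]; field_simp
  simp only [e1, pow_zero, div_one] at h1
  rw [lineConv_dilate_lowKer_eq_zero hT1 hT2 hg h0, abs_zero, ENNReal.ofReal_zero, zero_add] at h1
  refine h1.trans ?_
  rw [← ENNReal.tsum_mul_left, ← ENNReal.tsum_mul_left]
  refine le_trans (Finset.sum_le_sum fun i hi => ?_) (ENNReal.sum_le_tsum (Finset.range J))
  have hi' : i < J := Finset.mem_range.1 hi
  have ht0 : 0 < T / 2 ^ i := by positivity
  have h2 := H (T / 2 ^ i) h ht0 ((div_le_self hT0.le (one_le_pow₀ one_le_two)).trans hT2) hh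
    (by
      rw [le_div_iff₀ (by positivity), hJ, mul_comm]
      exact mul_le_mul_of_nonneg_right (pow_le_pow_right₀ one_le_two hi'.le) hη.le) g hg x
  rw [div_div, ← pow_succ] at h2
  refine h2.trans (le_of_eq ?_)
  rw [div_rpow hη.le ht0.le, rpow_neg ht0.le, div_inv_eq_mul, ENNReal.ofReal_mul hC.le,
    ENNReal.ofReal_mul (by positivity), ENNReal.ofReal_rpow_of_pos hη,
    ENNReal.ofReal_rpow_of_pos ht0]
  ring

theorem exists_high_band_le {β : ℝ} (hβ : 0 < β) : ∃ C : ℝ, 0 < C ∧ ∀ h : ℝ, h ≠ 0 → |h| ≤ 1 →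
    ∀ g : ℝ → ℝ, PeriodicL1 g → ∀ x, ∀ n : ℕ,
      ENNReal.ofReal |lineConv (dilate (|h| / 2 ^ n) lowKer) g x| ≤
        ENNReal.ofReal |lineConv (dilate |h| lowKer) g x| + ENNReal.ofReal C *
        ∑' k : ℕ, convMeas (cauchyMeas (|h| / 2 ^ k))
            (fun y => ENNReal.ofReal |diffOne β (h / 2 ^ k) g y|) x := by
  obtain ⟨C, hC, H⟩ := exists_band_le hβ
  refine ⟨C, hC, fun h hh hh1 g hg x n => ?_⟩
  have hη : 0 < |h| := abs_pos.2 hh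
  have h1 := ofReal_abs_sum_range_sub_le (fun i => lineConv (dilate (|h| / 2 ^ i) lowKer) g x) n
  simp only [pow_zero, div_one] at h1
  refine h1.trans (add_le_add le_rfl ?_)
  rw [← ENNReal.tsum_mul_left]
  refine le_trans (Finset.sum_le_sum fun i _ => ?_) (ENNReal.sum_le_tsum (Finset.range n))
  have e : |h / 2 ^ i| = |h| / 2 ^ i := by rw [abs_div, abs_of_pos (by positivity : (0:ℝ) < 2 ^ i)]
  have h2 := H (|h| / 2 ^ i) (h / 2 ^ i) (by positivity)
    ((div_le_self hη.le (one_le_pow₀ one_le_two)).trans (by linarith)) (by positivity) e.le g hg x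
  rw [div_div, ← pow_succ, e, div_self (by positivity), one_rpow, mul_one] at h2
  exact h2

/-- Pointwise domination of a periodic function with zero mean by its fractional differences. -/
theorem exists_ae_le_majOp {θ β : ℝ} (hθ : 0 < θ) (hβ : 0 < β) : ∃ D : ℝ≥0∞, D ≠ ⊤ ∧
    ∀ h : ℝ, h ≠ 0 → |h| ≤ 1 → ∀ g : ℝ → ℝ, PeriodicL1 g → ∫ x, g x ∂perMeas = 0 →
      ∀ᵐ x ∂perMeas, ENNReal.ofReal |g x| ≤ D * majOp θ |h| (diffSeq θ β h g) x := by
  obtain ⟨C1, -, H1⟩ := exists_low_band_le hθ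
  obtain ⟨C2, -, H2⟩ := exists_high_band_le hβ
  refine ⟨ENNReal.ofReal C1 + ENNReal.ofReal C2, by simp, fun h hh hh1 g hg h0 => ?_⟩
  have hη : 0 < |h| := abs_pos.2 hh
  obtain ⟨φ, -, hφ⟩ := exists_seq_tendsto_lineConv hg (t := fun n => |h| / 2 ^ n)
    (fun n => by positivity)
    (fun n => (div_le_self hη.le (one_le_pow₀ one_le_two)).trans (by linarith))
    (by
      have := (tendsto_pow_atTop_nhds_zero_of_lt_one (r := (1/2:ℝ)) (by norm_num)
        (by norm_num)).const_mul |h|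
      simpa [div_eq_mul_inv] using this)
  filter_upwards [hφ] with x hx
  have hx' := ENNReal.tendsto_ofReal hx.abs
  refine le_of_tendsto hx' (Filter.Eventually.of_forall fun n => ?_)
  refine (H2 h hh hh1 g hg x (φ n)).trans ?_
  refine (add_le_add (H1 h hh hh1 g hg h0 x) le_rfl).trans ?_
  rw [majOp, mul_add]
  refine add_le_add (mul_le_mul_left le_self_add _) (mul_le_mul_left le_add_self _)

/-- Lebesgue measure on a period square. -/
def perMeas2 : Measure (ℝ × ℝ) := perMeas.prod perMeas

instance : IsFiniteMeasure perMeas2 := by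
  unfold perMeas2
  infer_instance

/-- Functions on the plane which are periodic in both variables. -/
def Periodic2 {E : Type*} (u : ℝ × ℝ → E) : Prop :=
  (∀ x y, u (x + 2 * π, y) = u (x, y)) ∧ ∀ x y, u (x, y + 2 * π) = u (x, y)

theorem Periodic2.shift {E : Type*} {u : ℝ × ℝ → E} (hu : Periodic2 u) (v : ℝ × ℝ) :
    Periodic2 fun z => u (z + v) := by
  refine ⟨fun x y => ?_, fun x y => ?_⟩
  · simp only [show (x + 2 * π, y) + v
      = (x + v.1 + 2 * π, y + v.2) by ext <;> simp; ring, hu.1]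
    rfl
  · simp only [show (x, y + 2 * π) + v
      = (x + v.1, y + v.2 + 2 * π) by ext <;> simp; ring, hu.2]
    rfl

theorem lintegral_perMeas2_add {w : ℝ × ℝ → ℝ≥0∞} (hw : Measurable w) (hper : Periodic2 w)
    (v : ℝ × ℝ) : ∫⁻ z, w (z + v) ∂perMeas2 = ∫⁻ z, w z ∂perMeas2 := by
  unfold perMeas2
  rw [lintegral_prod _ (by fun_prop), lintegral_prod _ (by fun_prop)]
  have e1 : ∀ x, ∫⁻ y, w ((x, y) + v) ∂perMeas = ∫⁻ y, w (x + v.1, y) ∂perMeas := fun x =>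
    lintegral_perMeas_add (v := fun y => w (x + v.1, y)) (fun y => hper.2 _ _) v.2
  simp_rw [e1]
  refine lintegral_perMeas_add (v := fun x => ∫⁻ y, w (x, y) ∂perMeas) (fun x => ?_) v.1
  simp only [hper.1]

/-- Functions on the plane, periodic in both variables and integrable on a period square. -/
structure PeriodicL12 (u : ℝ × ℝ → ℝ) : Prop where
  meas : Measurable u
  per : Periodic2 u
  fin : ∫⁻ z, ‖u z‖ₑ ∂perMeas2 ≠ ⊤

/-- The `L_r` norm over a period square. -/
def sqNorm (r : ℝ) (u : ℝ × ℝ → ℝ) : ℝ≥0∞ := (∫⁻ z, ‖u z‖ₑ ^ r ∂perMeas2) ^ (1 / r)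

theorem sqNorm_congr {r : ℝ} {u w : ℝ × ℝ → ℝ} (h : u =ᵐ[perMeas2] w) :
    sqNorm r u = sqNorm r w := by
  unfold sqNorm
  congr 1
  refine lintegral_congr_ae ?_
  filter_upwards [h] with z hz
  rw [hz]

theorem sqNorm_shift {r : ℝ} {u : ℝ × ℝ → ℝ} (hm : Measurable u) (hu : Periodic2 u) (v : ℝ × ℝ) :
    sqNorm r (fun z => u (z + v)) = sqNorm r u := by
  unfold sqNorm
  congr 1
  refine lintegral_perMeas2_add (w := fun z => ‖u z‖ₑ ^ r) (by fun_prop) ⟨fun x y => ?_, fun x y => ?_⟩ v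
  · simp only [hu.1]
  · simp only [hu.2]

/-- Superpositions of translates. -/
def transSum {ι : Type*} (c : ι → ℝ) (v : ι → ℝ × ℝ) (u : ℝ × ℝ → ℝ) (z : ℝ × ℝ) : ℝ :=
  ∑' i, c i * u (z + v i)

theorem measurable_transSum {ι : Type*} [Countable ι] (c : ι → ℝ) (v : ι → ℝ × ℝ)
    {u : ℝ × ℝ → ℝ} (hu : Measurable u) : Measurable (transSum c v u) := by
  unfold transSum
  exact Measurable.tsum fun i => by fun_prop

theorem periodic2_transSum {ι : Type*} (c : ι → ℝ) (v : ι → ℝ × ℝ)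
    {u : ℝ × ℝ → ℝ} (hu : Periodic2 u) : Periodic2 (transSum c v u) := by
  unfold transSum
  exact ⟨fun x y => tsum_congr fun i => congrArg (c i * ·) ((hu.shift (v i)).1 x y),
    fun x y => tsum_congr fun i => congrArg (c i * ·) ((hu.shift (v i)).2 x y)⟩

theorem enorm_tsum_le {ι : Type*} (f : ι → ℝ) : ‖∑' i, f i‖ₑ ≤ ∑' i, ‖f i‖ₑ := by
  by_cases h : Summable f
  · have hn : Summable fun i => ‖f i‖ := summable_norm_iff.2 h
    have h1 : ∑' i, ‖f i‖ₑ = ENNReal.ofReal (∑' i, ‖f i‖) := by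
      rw [ENNReal.ofReal_tsum_of_nonneg (fun i => norm_nonneg _) hn]
      simp only [ofReal_norm]
    rw [h1, ← ofReal_norm]
    exact ENNReal.ofReal_le_ofReal (norm_tsum_le_tsum_norm hn)
  · rw [tsum_eq_zero_of_not_summable h, enorm_zero]
    exact bot_le

theorem summable_of_tsum_enorm_ne_top {ι : Type*} {f : ι → ℝ} (h : ∑' i, ‖f i‖ₑ ≠ ⊤) :
    Summable f := by
  have h1 := ENNReal.summable_toReal h
  simp only [toReal_enorm] at h1
  exact summable_norm_iff.1 h1

theorem lintegral_tsum_enorm_trans {ι : Type*} [Countable ι] (c : ι → ℝ) (v : ι → ℝ × ℝ)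
    {u : ℝ × ℝ → ℝ} (hu : PeriodicL12 u) :
    ∫⁻ z, ∑' i, ‖c i * u (z + v i)‖ₑ ∂perMeas2 = (∑' i, ‖c i‖ₑ) * ∫⁻ z, ‖u z‖ₑ ∂perMeas2 := by
  have hm := hu.meas
  rw [lintegral_tsum fun i => by fun_prop, ← ENNReal.tsum_mul_right]
  refine tsum_congr fun i => ?_
  simp only [enorm_mul]
  rw [lintegral_const_mul _ (by fun_prop)]
  congr 1
  exact lintegral_perMeas2_add (w := fun z => ‖u z‖ₑ) (by fun_prop)
    ⟨fun x y => by simp only [hu.per.1], fun x y => by simp only [hu.per.2]⟩ (v i)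

theorem ae_summable_trans {ι : Type*} [Countable ι] {c : ι → ℝ} (hc : Summable fun i => |c i|)
    (v : ι → ℝ × ℝ) {u : ℝ × ℝ → ℝ} (hu : PeriodicL12 u) :
    ∀ᵐ z ∂perMeas2, Summable fun i => c i * u (z + v i) := by
  have hm := hu.meas
  have h := lintegral_tsum_enorm_trans c v hu
  have hc' : ∑' i, ‖c i‖ₑ ≠ ⊤ := by
    simp only [← ofReal_norm]
    exact hc.tsum_ofReal_ne_top
  have h2 := ae_lt_top (μ := perMeas2) (f := fun z => ∑' i, ‖c i * u (z + v i)‖ₑ)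
    (by fun_prop) (by rw [h]; exact ENNReal.mul_ne_top hc' hu.fin)
  filter_upwards [h2] with z hz
  exact summable_of_tsum_enorm_ne_top hz.ne

theorem PeriodicL12.transSum {ι : Type*} [Countable ι] {c : ι → ℝ} (hc : Summable fun i => |c i|)
    (v : ι → ℝ × ℝ) {u : ℝ × ℝ → ℝ} (hu : PeriodicL12 u) : PeriodicL12 (transSum c v u) := by
  refine ⟨measurable_transSum c v hu.meas, periodic2_transSum c v hu.per, ?_⟩
  have hc' : ∑' i, ‖c i‖ₑ ≠ ⊤ := by
    simp only [← ofReal_norm]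
    exact hc.tsum_ofReal_ne_top
  refine ne_top_of_le_ne_top (ENNReal.mul_ne_top hc' hu.fin) ?_
  rw [← lintegral_tsum_enorm_trans c v hu]
  exact lintegral_mono fun z => enorm_tsum_le _

theorem sqNorm_transSum_le (c : ℕ → ℝ) (v : ℕ → ℝ × ℝ) {r : ℝ}
    (hr : 1 < r) {u : ℝ × ℝ → ℝ} (hm : Measurable u) (hu : Periodic2 u) :
    sqNorm r (transSum c v u) ≤ (∑' i, ‖c i‖ₑ) * sqNorm r u := by
  have hr0 : 0 < r := by linarith
  have h1 : sqNorm r (transSum c v u)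
      ≤ (∫⁻ z, (∑' i, ‖c i‖ₑ * ‖u (z + v i)‖ₑ) ^ r ∂perMeas2) ^ (1 / r) := by
    unfold sqNorm
    refine ENNReal.rpow_le_rpow (lintegral_mono fun z => ENNReal.rpow_le_rpow ?_ hr0.le)
      (by positivity)
    refine (enorm_tsum_le _).trans (le_of_eq ?_)
    simp only [enorm_mul]
  refine h1.trans ((tsum_Lp_le perMeas2 hr (F := fun i z => ‖c i‖ₑ * ‖u (z + v i)‖ₑ)
    fun i => by fun_prop).trans (le_of_eq ?_))
  rw [← ENNReal.tsum_mul_right]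
  refine tsum_congr fun i => ?_
  rw [← sqNorm_shift hm hu (v i)]
  exact const_mul_Lp perMeas2 hr0 (by fun_prop) _

theorem transSum_congr_ae {ι : Type*} [Countable ι] (c : ι → ℝ) (v : ι → ℝ × ℝ)
    {u w : ℝ × ℝ → ℝ} (hum : Measurable u) (hup : Periodic2 u) (hwm : Measurable w)
    (hwp : Periodic2 w) (h : u =ᵐ[perMeas2] w) : transSum c v u =ᵐ[perMeas2] transSum c v w := by
  have h0 : ∀ i, ∀ᵐ z ∂perMeas2, u (z + v i) = w (z + v i) := fun i => by
    have e := lintegral_perMeas2_add (w := fun z => ‖u z - w z‖ₑ) (by fun_prop)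
      ⟨fun x y => by simp only [hup.1, hwp.1], fun x y => by simp only [hup.2, hwp.2]⟩ (v i)
    have e0 : ∫⁻ z, ‖u z - w z‖ₑ ∂perMeas2 = 0 := by
      rw [lintegral_eq_zero_iff (by fun_prop)]
      filter_upwards [h] with z hz
      simp [hz]
    rw [e0, lintegral_eq_zero_iff (by fun_prop)] at e
    filter_upwards [e] with z hz
    simpa [sub_eq_zero] using hz
  filter_upwards [ae_all_iff.2 h0] with z hz
  exact tsum_congr fun i => by rw [hz i]

theorem transSum_transSum {ι κ : Type*} [Countable ι] [Countable κ] {c : ι → ℝ} {d : κ → ℝ}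
    (hc : Summable fun i => |c i|) (hd : Summable fun i => |d i|) (v : ι → ℝ × ℝ)
    (w : κ → ℝ × ℝ) {u : ℝ × ℝ → ℝ} (hu : PeriodicL12 u) :
    transSum c v (transSum d w u) =ᵐ[perMeas2]
      transSum (fun i : ι × κ => c i.1 * d i.2) (fun i => v i.1 + w i.2) u := by
  have hcd : Summable fun i : ι × κ => |c i.1 * d i.2| := by
    simp only [abs_mul]
    exact hc.mul_of_nonneg hd (fun _ => abs_nonneg _) fun _ => abs_nonneg _
  filter_upwards [ae_summable_trans hcd (fun i => v i.1 + w i.2) hu] with z hz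
  unfold transSum
  rw [hz.tsum_prod]
  refine tsum_congr fun i => ?_
  rw [← tsum_mul_left]
  exact tsum_congr fun j => by rw [mul_assoc, add_assoc]

theorem transSum_comm {ι κ : Type*} [Countable ι] [Countable κ] {c : ι → ℝ} {d : κ → ℝ}
    (hc : Summable fun i => |c i|) (hd : Summable fun i => |d i|) (v : ι → ℝ × ℝ)
    (w : κ → ℝ × ℝ) {u : ℝ × ℝ → ℝ} (hu : PeriodicL12 u) :
    transSum c v (transSum d w u) =ᵐ[perMeas2] transSum d w (transSum c v u) := by
  filter_upwards [transSum_transSum hc hd v w hu, transSum_transSum hd hc w v hu] with z h1 h2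
  rw [h1, h2]
  unfold transSum
  rw [← (Equiv.prodComm κ ι).tsum_eq]
  exact tsum_congr fun i => by simp [mul_comm, add_comm]

theorem transSum_antidiagonal {c d : ℕ → ℝ}
    (hc : Summable fun i => |c i|) (hd : Summable fun i => |d i|) (a : ℕ → ℝ × ℝ)
    {u : ℝ × ℝ → ℝ} (hu : PeriodicL12 u) :
    transSum (fun i : ℕ × ℕ => c i.1 * d i.2) (fun i => a (i.1 + i.2)) u =ᵐ[perMeas2]
      transSum (fun n => ∑ i ∈ Finset.HasAntidiagonal.antidiagonal n, c i.1 * d i.2) a u := by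
  have hcd : Summable fun i : ℕ × ℕ => |c i.1 * d i.2| := by
    simp only [abs_mul]
    exact hc.mul_of_nonneg hd (fun _ => abs_nonneg _) fun _ => abs_nonneg _
  filter_upwards [ae_summable_trans hcd (fun i => a (i.1 + i.2)) hu] with z hz
  unfold transSum
  rw [← Finset.HasAntidiagonal.sigmaAntidiagonalEquivProd.tsum_eq]
  refine (((Finset.HasAntidiagonal.sigmaAntidiagonalEquivProd.summable_iff).2 hz).tsum_sigma).trans ?_
  refine tsum_congr fun n => ?_
  rw [tsum_fintype, Finset.univ_eq_attach, Finset.sum_mul,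
    ← Finset.sum_attach (Finset.HasAntidiagonal.antidiagonal n)]
  refine Finset.sum_congr rfl fun i _ => ?_
  have := Finset.HasAntidiagonal.mem_antidiagonal.1 i.2
  simp [this]

/-- The fractional difference of order `γ` with vector step `v`. -/
def diffV (γ : ℝ) (v : ℝ × ℝ) : (ℝ × ℝ → ℝ) → ℝ × ℝ → ℝ :=
  transSum (diffCoeff γ) fun ν => (γ - (ν : ℝ)) • v

theorem PeriodicL12.diffV {γ : ℝ} (hγ : 0 < γ) (v : ℝ × ℝ) {u : ℝ × ℝ → ℝ} (hu : PeriodicL12 u) :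
    PeriodicL12 (diffV γ v u) :=
  hu.transSum (summable_abs_diffCoeff hγ) _

theorem diffV_congr (γ : ℝ) (v : ℝ × ℝ) {u w : ℝ × ℝ → ℝ} (hu : PeriodicL12 u)
    (hw : PeriodicL12 w) (h : u =ᵐ[perMeas2] w) : diffV γ v u =ᵐ[perMeas2] diffV γ v w :=
  transSum_congr_ae _ _ hu.meas hu.per hw.meas hw.per h

theorem diffV_comm {γ γ' : ℝ} (hγ : 0 < γ) (hγ' : 0 < γ') (v v' : ℝ × ℝ) {u : ℝ × ℝ → ℝ}
    (hu : PeriodicL12 u) : diffV γ v (diffV γ' v' u) =ᵐ[perMeas2] diffV γ' v' (diffV γ v u) :=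
  transSum_comm (summable_abs_diffCoeff hγ) (summable_abs_diffCoeff hγ') _ _ hu

theorem exists_sqNorm_diffV_le {γ r : ℝ} (hγ : 0 < γ) (hr : 1 < r) : ∃ C : ℝ≥0∞, C ≠ ⊤ ∧
    ∀ (v : ℝ × ℝ) (u : ℝ × ℝ → ℝ), PeriodicL12 u → sqNorm r (diffV γ v u) ≤ C * sqNorm r u := by
  refine ⟨∑' i, ‖diffCoeff γ i‖ₑ, ?_, fun v u hu => sqNorm_transSum_le _ _ hr hu.meas hu.per⟩
  simp only [← ofReal_norm]
  exact (summable_abs_diffCoeff hγ).tsum_ofReal_ne_top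

/-- Fractional differences compose additively in the order. -/
theorem diffV_diffV {θ α : ℝ} (hθ : 0 < θ) (hα : 0 < α) (v : ℝ × ℝ) {u : ℝ × ℝ → ℝ}
    (hu : PeriodicL12 u) : diffV θ v (diffV α v u) =ᵐ[perMeas2] diffV (α + θ) v u := by
  have h1 := transSum_transSum (summable_abs_diffCoeff hθ) (summable_abs_diffCoeff hα)
    (fun ν => (θ - (ν : ℝ)) • v) (fun ν => (α - (ν : ℝ)) • v) hu
  have h2 := transSum_antidiagonal (summable_abs_diffCoeff hθ) (summable_abs_diffCoeff hα)
    (fun ν => (α + θ - (ν : ℝ)) • v) hu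
  refine h1.trans (Filter.EventuallyEq.trans (Filter.EventuallyEq.of_eq ?_)
    (h2.trans (Filter.EventuallyEq.of_eq ?_)))
  · congr 1
    funext i
    rw [← add_smul]
    congr 1
    push_cast
    ring
  · unfold diffV
    congr 1
    funext n
    rw [add_comm α θ, sum_diffCoeff_mul hθ hα]

/-- A difference with doubled step is a superposition of differences. -/
theorem diffV_two_smul {α : ℝ} (hα : 0 < α) (v : ℝ × ℝ) {u : ℝ × ℝ → ℝ} (hu : PeriodicL12 u) :
    transSum (fracBinom α) (fun ν => (α - (ν : ℝ)) • v) (diffV α v u)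
      =ᵐ[perMeas2] diffV α ((2 : ℝ) • v) u := by
  have hs : Summable fun i => |fracBinom α i| := by
    simpa only [abs_fracBinom] using summable_abs_diffCoeff hα
  have h1 := transSum_transSum hs (summable_abs_diffCoeff hα)
    (fun ν => (α - (ν : ℝ)) • v) (fun ν => (α - (ν : ℝ)) • v) hu
  have h2 := transSum_antidiagonal hs (summable_abs_diffCoeff hα)
    (fun ν => (2 * α - (ν : ℝ)) • v) hu
  refine h1.trans (Filter.EventuallyEq.trans (Filter.EventuallyEq.of_eq ?_)
    (h2.trans (Filter.EventuallyEq.of_eq ?_)))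
  · congr 1
    funext i
    rw [← add_smul]
    congr 1
    push_cast
    ring
  · funext z
    unfold diffV transSum
    simp only [sum_fracBinom_mul_diffCoeff hα]
    have hinj : Function.Injective fun m : ℕ => 2 * m := fun a b h => by simpa using h
    rw [← hinj.tsum_eq]
    · refine tsum_congr fun m => ?_
      have e : (2 * α - ((2 * m : ℕ) : ℝ)) • v = (α - (m : ℝ)) • (2 : ℝ) • v := by
        rw [smul_smul]
        congr 1
        push_cast
        ring
      simp only [e, even_two_mul, if_true, mul_div_cancel_left₀ m two_ne_zero]
    · intro n hn
      by_cases hn' : Even n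
      · obtain ⟨m, rfl⟩ := hn'
        exact ⟨m, by simp; ring⟩
      · simp [hn'] at hn

theorem exists_sqNorm_diffV_two_smul_le {α r : ℝ} (hα : 0 < α) (hr : 1 < r) : ∃ C : ℝ≥0∞, C ≠ ⊤ ∧
    ∀ (v : ℝ × ℝ) (u : ℝ × ℝ → ℝ), PeriodicL12 u →
      sqNorm r (diffV α ((2 : ℝ) • v) u) ≤ C * sqNorm r (diffV α v u) := by
  refine ⟨∑' i, ‖fracBinom α i‖ₑ, ?_, fun v u hu => ?_⟩
  · simp only [← ofReal_norm, norm_eq_abs, abs_fracBinom]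
    exact (summable_abs_diffCoeff hα).tsum_ofReal_ne_top
  · rw [← sqNorm_congr (diffV_two_smul hα v hu)]
    exact sqNorm_transSum_le _ _ hr (hu.diffV hα v).meas (hu.diffV hα v).per

theorem PeriodicL1.integral_shift {g : ℝ → ℝ} (hg : PeriodicL1 g) (a : ℝ) :
    ∫ x, g (x + a) ∂perMeas = ∫ x, g x ∂perMeas := by
  have h : ∀ w : ℝ → ℝ, ∫ x, w x ∂perMeas = ∫ x in (0:ℝ)..(2 * π), w x := fun w => by
    rw [intervalIntegral.integral_of_le (by positivity)]
    rfl
  rw [h, h, intervalIntegral.integral_comp_add_right, zero_add, add_comm (2 * π) a,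
    hg.per.intervalIntegral_add_eq a 0, zero_add]

theorem integral_diffOne {γ : ℝ} (hγ : 0 < γ) (h : ℝ) {g : ℝ → ℝ} (hg : PeriodicL1 g) :
    ∫ x, diffOne γ h g x ∂perMeas = 0 := by
  unfold diffOne
  have hi : ∀ ν : ℕ, Integrable (fun x => diffCoeff γ ν * g (x + (γ - ν) * h)) perMeas :=
    fun ν => (hg.shift _).1.integrableOn.const_mul _
  have hn : ∀ a, ∫ x, ‖g (x + a)‖ ∂perMeas = ∫ x, ‖g x‖ ∂perMeas := fun a => by
    rw [integral_norm_eq_lintegral_enorm (hg.shift a).1.integrableOn.aestronglyMeasurable,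
      integral_norm_eq_lintegral_enorm hg.integrableOn.aestronglyMeasurable]
    simp only [enorm_eq_ofReal_abs, (hg.shift a).2]
  rw [← integral_tsum_of_summable_integral_norm hi]
  · simp only [integral_const_mul, hg.integral_shift]
    rw [tsum_mul_right, tsum_diffCoeff hγ, zero_mul]
  · simp only [norm_mul, integral_const_mul, hn]
    exact (summable_abs_diffCoeff hγ).mul_right _

theorem diffV_slice_left (γ h : ℝ) (u : ℝ × ℝ → ℝ) (x y : ℝ) :
    diffV γ (h, 0) u (x, y) = diffOne γ h (fun x => u (x, y)) x := by
  unfold diffV transSum diffOne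
  refine tsum_congr fun ν => ?_
  simp

theorem diffV_slice_right (γ h : ℝ) (u : ℝ × ℝ → ℝ) (x y : ℝ) :
    diffV γ (0, h) u (x, y) = diffOne γ h (fun y => u (x, y)) y := by
  unfold diffV transSum diffOne
  refine tsum_congr fun ν => ?_
  simp

theorem PeriodicL12.ae_left {u : ℝ × ℝ → ℝ} (hu : PeriodicL12 u) :
    ∀ᵐ y ∂perMeas, PeriodicL1 fun x => u (x, y) := by
  have hm := hu.meas
  have h := hu.fin
  unfold perMeas2 at h
  rw [lintegral_prod_symm _ (by fun_prop)] at h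
  filter_upwards [ae_lt_top (by fun_prop) h] with y hy
  exact ⟨by fun_prop, fun x => hu.per.1 x y, by simpa only [enorm_eq_ofReal_abs] using hy.ne⟩

theorem PeriodicL12.ae_right {u : ℝ × ℝ → ℝ} (hu : PeriodicL12 u) :
    ∀ᵐ x ∂perMeas, PeriodicL1 fun y => u (x, y) := by
  have hm := hu.meas
  have h := hu.fin
  unfold perMeas2 at h
  rw [lintegral_prod _ (by fun_prop)] at h
  filter_upwards [ae_lt_top (by fun_prop) h] with x hx
  exact ⟨by fun_prop, fun y => hu.per.2 x y, by simpa only [enorm_eq_ofReal_abs] using hx.ne⟩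

theorem ae_integral_left_eq_zero {γ h : ℝ} (hγ : 0 < γ) {u w : ℝ × ℝ → ℝ} (hw : PeriodicL12 w)
    (hu : u =ᵐ[perMeas2] diffV γ (h, 0) w) : ∀ᵐ y ∂perMeas, ∫ x, u (x, y) ∂perMeas = 0 := by
  have h1 : ∀ᵐ z ∂perMeas.prod perMeas, u z.swap = diffV γ (h, 0) w z.swap := by
    exact (Measure.measurePreserving_swap (μ := perMeas) (ν := perMeas)).quasiMeasurePreserving.ae hu
  filter_upwards [Measure.ae_ae_of_ae_prod h1, hw.ae_left] with y h2 h3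
  rw [← integral_diffOne hγ h h3]
  refine integral_congr_ae ?_
  filter_upwards [h2] with x hx
  rw [← diffV_slice_left]
  exact hx

theorem ae_integral_right_eq_zero {γ h : ℝ} (hγ : 0 < γ) {u w : ℝ × ℝ → ℝ} (hw : PeriodicL12 w)
    (hu : u =ᵐ[perMeas2] diffV γ (0, h) w) : ∀ᵐ x ∂perMeas, ∫ y, u (x, y) ∂perMeas = 0 := by
  filter_upwards [Measure.ae_ae_of_ae_prod hu, hw.ae_right] with x h2 h3
  rw [← integral_diffOne hγ h h3]
  refine integral_congr_ae ?_
  filter_upwards [h2] with y hy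
  rw [← diffV_slice_right]
  exact hy

/-- The differences of order `θ` with step `v` and of order `β` with steps `v / 2 ^ k`. -/
def diffVSeq (θ β : ℝ) (v : ℝ × ℝ) (u : ℝ × ℝ → ℝ) : ℕ → ℝ × ℝ → ℝ
  | 0 => diffV θ v u
  | k + 1 => diffV β ((2 ^ k : ℝ)⁻¹ • v) u

theorem PeriodicL12.diffVSeq {θ β : ℝ} (hθ : 0 < θ) (hβ : 0 < β) (v : ℝ × ℝ)
    {u : ℝ × ℝ → ℝ} (hu : PeriodicL12 u) (k : ℕ) : PeriodicL12 (diffVSeq θ β v u k) := by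
  cases k with
  | zero => exact hu.diffV hθ v
  | succ k => exact hu.diffV hβ _

theorem enorm_diffVSeq_left (θ β h : ℝ) (u : ℝ × ℝ → ℝ) (k : ℕ) (x y : ℝ) :
    ‖diffVSeq θ β (h, 0) u k (x, y)‖ₑ = diffSeq θ β h (fun x => u (x, y)) k x := by
  cases k with
  | zero => simp only [diffVSeq, diffSeq, diffV_slice_left, enorm_eq_ofReal_abs]
  | succ k =>
    simp only [diffVSeq, diffSeq, enorm_eq_ofReal_abs, Prod.smul_mk, smul_eq_mul, mul_zero,
      diffV_slice_left]
    rw [div_eq_inv_mul]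

theorem enorm_diffVSeq_right (θ β h : ℝ) (u : ℝ × ℝ → ℝ) (k : ℕ) (x y : ℝ) :
    ‖diffVSeq θ β (0, h) u k (x, y)‖ₑ = diffSeq θ β h (fun y => u (x, y)) k y := by
  cases k with
  | zero => simp only [diffVSeq, diffSeq, diffV_slice_right, enorm_eq_ofReal_abs]
  | succ k =>
    simp only [diffVSeq, diffSeq, enorm_eq_ofReal_abs, Prod.smul_mk, smul_eq_mul, mul_zero,
      diffV_slice_right]
    rw [div_eq_inv_mul]

theorem measurable_majOp_prod (θ η : ℝ) {F : ℕ → ℝ → ℝ → ℝ≥0∞}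
    (hF : ∀ k, Measurable (Function.uncurry (F k))) :
    Measurable fun z : ℝ × ℝ => majOp θ η (fun k => F k z.1) z.2 := by
  have hc : ∀ t k, Measurable fun z : ℝ × ℝ => convMeas (cauchyMeas t) (F k z.1) z.2 := by
    intro t k
    unfold convMeas
    exact Measurable.lintegral_prod_right'
      (f := fun w : (ℝ × ℝ) × ℝ => Function.uncurry (F k) (w.1.1, w.1.2 - w.2))
      ((hF k).comp (by fun_prop))
  unfold majOp
  exact ((Measurable.tsum fun _ => (hc _ _).const_mul _).const_mul _).add
    (Measurable.tsum fun _ => hc _ _)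

/-- Passage from `L_p` to `L_q` in the first variable. -/
theorem exists_lintegral_left_le {p q β : ℝ} (hp : 1 < p) (hpq : p < q) (hβ : 0 < β) :
    ∃ C : ℝ≥0∞, C ≠ ⊤ ∧ ∀ (h : ℝ) (g : ℝ × ℝ → ℝ), h ≠ 0 → |h| ≤ 1 → PeriodicL12 g →
      (∀ᵐ y ∂perMeas, ∫ x, g (x, y) ∂perMeas = 0) →
      ∫⁻ z, ‖g z‖ₑ ^ q ∂perMeas2 ≤ C * ∑' k, scaleWeight (q / p - 1) |h| k *
        ∫⁻ y, (∫⁻ x, ‖diffVSeq (1 / p - 1 / q) β (h, 0) g k (x, y)‖ₑ ^ p ∂perMeas) ^ (q / p)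
          ∂perMeas := by
  have hp0 : 0 < p := by linarith
  have hq0 : 0 < q := by linarith
  have hθ : 0 < 1 / p - 1 / q := sub_pos.2 (one_div_lt_one_div_of_lt hp0 hpq)
  obtain ⟨D, hD, HD⟩ := exists_ae_le_majOp hθ hβ
  obtain ⟨C, hC, HC⟩ := exists_majOp_bound hp hpq
  refine ⟨D ^ q * C, ENNReal.mul_ne_top (ENNReal.rpow_ne_top_of_nonneg hq0.le hD) hC,
    fun h g hh hh1 hg h0 => ?_⟩
  have hm := hg.meas
  have hη : 0 < |h| := abs_pos.2 hh
  have hs := fun k => (hg.diffVSeq hθ hβ (h, 0) k).meas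
  have key : ∀ᵐ y ∂perMeas, ∫⁻ x, ‖g (x, y)‖ₑ ^ q ∂perMeas ≤ D ^ q * (C *
      ∑' k, scaleWeight (q / p - 1) |h| k *
        (∫⁻ x, ‖diffVSeq (1 / p - 1 / q) β (h, 0) g k (x, y)‖ₑ ^ p ∂perMeas) ^ (q / p)) := by
    filter_upwards [h0, hg.ae_left] with y hy0 hy
    have e : ∀ k, diffSeq (1 / p - 1 / q) β h (fun x => g (x, y)) k
        = fun x => ‖diffVSeq (1 / p - 1 / q) β (h, 0) g k (x, y)‖ₑ := fun k => by
      funext x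
      rw [enorm_diffVSeq_left]
    have hv : ∀ k, Measurable (diffSeq (1 / p - 1 / q) β h (fun x => g (x, y)) k) := fun k => by
      rw [e]
      have := hs k
      fun_prop
    have h2 := HC |h| (diffSeq (1 / p - 1 / q) β h (fun x => g (x, y))) hη hh1 hv
      (fun k => by
        rw [e]
        intro x
        simp only [(hg.diffVSeq hθ hβ (h, 0) k).per.1])
    simp only [enorm_diffVSeq_left]
    refine le_trans ?_ (mul_le_mul_right h2 _)
    rw [← lintegral_const_mul _ ((measurable_majOp _ _ hv).pow_const _)]
    refine lintegral_mono_ae ?_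
    filter_upwards [HD h hh hh1 _ hy hy0] with x hx
    rw [← ENNReal.mul_rpow_of_nonneg _ _ hq0.le, enorm_eq_ofReal_abs]
    exact ENNReal.rpow_le_rpow hx hq0.le
  have hin : ∀ k, Measurable fun y =>
      ∫⁻ x, ‖diffVSeq (1 / p - 1 / q) β (h, 0) g k (x, y)‖ₑ ^ p ∂perMeas := fun k => by
    have := hs k
    exact Measurable.lintegral_prod_left'
      (f := fun z => ‖diffVSeq (1 / p - 1 / q) β (h, 0) g k z‖ₑ ^ p) (by fun_prop)
  unfold perMeas2
  rw [lintegral_prod_symm _ (by fun_prop)]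
  refine (lintegral_mono_ae key).trans (le_of_eq ?_)
  rw [lintegral_const_mul, lintegral_const_mul, lintegral_tsum, mul_assoc]
  · congr 3
    funext k
    rw [lintegral_const_mul]
    exact (hin k).pow_const _
  · exact fun k => (((hin k).pow_const _).const_mul _).aemeasurable
  · exact Measurable.tsum fun k => ((hin k).pow_const _).const_mul _
  · exact (Measurable.tsum fun k => ((hin k).pow_const _).const_mul _).const_mul _

/-- Passage from `L_p` to `L_q` in the second variable. -/
theorem exists_lintegral_right_le {p q β : ℝ} (hp : 1 < p) (hpq : p < q) (hβ : 0 < β) :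
    ∃ C : ℝ≥0∞, C ≠ ⊤ ∧ ∀ (h : ℝ) (g : ℝ × ℝ → ℝ), h ≠ 0 → |h| ≤ 1 → PeriodicL12 g →
      (∀ᵐ x ∂perMeas, ∫ y, g (x, y) ∂perMeas = 0) →
      ∫⁻ y, (∫⁻ x, ‖g (x, y)‖ₑ ^ p ∂perMeas) ^ (q / p) ∂perMeas ≤
        C * ∑' l, scaleWeight (q / p - 1) |h| l *
          sqNorm p (diffVSeq (1 / p - 1 / q) β (0, h) g l) ^ q := by
  have hp0 : 0 < p := by linarith
  have hq0 : 0 < q := by linarith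
  have hθ : 0 < 1 / p - 1 / q := sub_pos.2 (one_div_lt_one_div_of_lt hp0 hpq)
  obtain ⟨D, hD, HD⟩ := exists_ae_le_majOp hθ hβ
  obtain ⟨C, hC, HC⟩ := exists_majOp_bound hp hpq
  refine ⟨D ^ q * C, ENNReal.mul_ne_top (ENNReal.rpow_ne_top_of_nonneg hq0.le hD) hC,
    fun h g hh hh1 hg h0 => ?_⟩
  have hm := hg.meas
  have hη : 0 < |h| := abs_pos.2 hh
  have hs := fun k => (hg.diffVSeq hθ hβ (0, h) k).meas
  set S : ℕ → ℝ × ℝ → ℝ := diffVSeq (1 / p - 1 / q) β (0, h) g with hS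
  set F : ℕ → ℝ → ℝ → ℝ≥0∞ := fun k x y => ‖S k (x, y)‖ₑ with hF
  have hFm : ∀ k, Measurable (Function.uncurry (F k)) := fun k => by
    have := hs k
    exact (by fun_prop : Measurable fun z : ℝ × ℝ => ‖S k z‖ₑ)
  have hM := measurable_majOp_prod (1 / p - 1 / q) |h| hFm
  have h1 : ∀ᵐ x ∂perMeas, ∀ᵐ y ∂perMeas,
      ‖g (x, y)‖ₑ ≤ D * majOp (1 / p - 1 / q) |h| (fun k => F k x) y := by
    filter_upwards [h0, hg.ae_right] with x hx0 hx
    filter_upwards [HD h hh hh1 _ hx hx0] with y hy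
    rw [enorm_eq_ofReal_abs]
    refine hy.trans (le_of_eq ?_)
    congr 2
    funext k y
    rw [hF, hS, ← enorm_diffVSeq_right]
  have h2 := (Measure.ae_ae_comm (μ := perMeas) (ν := perMeas)
    (p := fun x y => ‖g (x, y)‖ₑ ≤ D * majOp (1 / p - 1 / q) |h| (fun k => F k x) y)
    (measurableSet_le (f := fun z : ℝ × ℝ => ‖g z‖ₑ) (by fun_prop) (hM.const_mul D))).1 h1
  set V : ℕ → ℝ → ℝ≥0∞ := fun k y => (∫⁻ x, F k x y ^ p ∂perMeas) ^ (1 / p) with hV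
  have hVm : ∀ k, Measurable (V k) := fun k =>
    (Measurable.lintegral_prod_left' (f := fun z : ℝ × ℝ => Function.uncurry (F k) z ^ p)
      ((hFm k).pow_const _)).pow_const _
  have h3 : ∀ᵐ y ∂perMeas, (∫⁻ x, ‖g (x, y)‖ₑ ^ p ∂perMeas) ^ (q / p)
      ≤ D ^ q * majOp (1 / p - 1 / q) |h| V y ^ q := by
    filter_upwards [h2] with y hy
    rw [← ENNReal.mul_rpow_of_nonneg _ _ hq0.le, show q / p = (1 / p) * q by ring,
      ENNReal.rpow_mul]
    refine ENNReal.rpow_le_rpow ?_ hq0.le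
    refine le_trans ?_ (mul_le_mul_right (majOp_Lp_le hp hFm y) D)
    have hMy : Measurable fun x => majOp (1 / p - 1 / q) |h| (fun k => F k x) y :=
      Measurable.of_uncurry_right (f := fun x y => majOp (1 / p - 1 / q) |h| (fun k => F k x) y) hM
    rw [← const_mul_Lp perMeas hp0 hMy]
    refine ENNReal.rpow_le_rpow (lintegral_mono_ae ?_) (by positivity)
    filter_upwards [hy] with x hx
    exact ENNReal.rpow_le_rpow hx hp0.le
  refine (lintegral_mono_ae h3).trans ?_
  rw [lintegral_const_mul _ ((measurable_majOp _ _ hVm).pow_const _), mul_assoc]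
  refine mul_le_mul_right ((HC |h| V hη hh1 hVm fun k y => ?_).trans (le_of_eq ?_)) _
  · simp only [hV, hF, (hg.diffVSeq hθ hβ (0, h) k).per.2, hS]
  · congr 2
    funext k
    congr 1
    unfold sqNorm
    rw [← ENNReal.rpow_mul, show 1 / p * q = q / p by ring]
    congr 1
    unfold perMeas2
    have := hs k
    rw [lintegral_prod_symm _ (by fun_prop)]
    refine lintegral_congr fun y => ?_
    rw [hV]
    simp only
    rw [← ENNReal.rpow_mul, one_div, inv_mul_cancel₀ hp0.ne', ENNReal.rpow_one]

theorem exists_diffVSeq_eq {θ β : ℝ} (hθ : 0 < θ) (hβ : 0 < β) (v : ℝ × ℝ) (k : ℕ) :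
    ∃ τ : ℝ, 0 < τ ∧ ∃ w : ℝ × ℝ, ∀ u, diffVSeq θ β v u k = diffV τ w u := by
  cases k with
  | zero => exact ⟨θ, hθ, v, fun u => rfl⟩
  | succ k => exact ⟨β, hβ, (2 ^ k : ℝ)⁻¹ • v, fun u => rfl⟩

theorem exists_sqNorm_diffVSeq_le {θ α p : ℝ} (hθ : 0 < θ) (hα : 0 < α) (hp : 1 < p) :
    ∃ C : ℝ≥0∞, C ≠ ⊤ ∧ ∀ (τ : ℝ) (w v : ℝ × ℝ) (u : ℝ × ℝ → ℝ) (k : ℕ), 0 < τ →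
      PeriodicL12 u → sqNorm p (diffV τ w (diffVSeq θ (α + θ) v (diffV α v u) k)) ≤
        C * sqNorm p (diffV τ w (diffV (α + θ) ((2 ^ (k - 1) : ℝ)⁻¹ • v) u)) := by
  obtain ⟨C, hC, H⟩ := exists_sqNorm_diffV_le (r := p) hα hp
  have hβ : 0 < α + θ := by linarith
  refine ⟨1 + C, by simp [hC], fun τ w v u k hτ hu => ?_⟩
  cases k with
  | zero =>
    simp only [diffVSeq, Nat.zero_sub, pow_zero, inv_one, one_smul]
    rw [sqNorm_congr (diffV_congr τ w ((hu.diffV hα v).diffV hθ v) (hu.diffV hβ v)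
      (diffV_diffV hθ hα v hu))]
    exact le_mul_of_one_le_left bot_le le_self_add
  | succ k =>
    simp only [diffVSeq, Nat.add_sub_cancel]
    set v' := (2 ^ k : ℝ)⁻¹ • v
    have h1 := diffV_congr τ w ((hu.diffV hα v).diffV hβ v') ((hu.diffV hβ v').diffV hα v)
      (diffV_comm hβ hα v' v hu)
    rw [sqNorm_congr (h1.trans (diffV_comm hτ hα w v (hu.diffV hβ v')))]
    exact (H v _ ((hu.diffV hβ v').diffV hτ w)).trans (mul_le_mul_left le_add_self _)

/-- The `L_q` norm of a mixed difference is controlled by `L_p` norms of mixed differences of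
higher order with dyadically decreasing steps. -/
theorem exists_lintegral_mixed_le {p q α₁ α₂ : ℝ} (hp : 1 < p) (hpq : p < q) (hα₁ : 0 < α₁)
    (hα₂ : 0 < α₂) : ∃ C : ℝ≥0∞, C ≠ ⊤ ∧ ∀ (h₁ h₂ : ℝ) (f : ℝ × ℝ → ℝ), h₁ ≠ 0 → |h₁| ≤ 1 →
      h₂ ≠ 0 → |h₂| ≤ 1 → PeriodicL12 f →
      ∫⁻ z, ‖diffV α₁ (h₁, 0) (diffV α₂ (0, h₂) f) z‖ₑ ^ q ∂perMeas2 ≤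
        C * ∑' k, scaleWeight (q / p - 1) |h₁| k * ∑' l, scaleWeight (q / p - 1) |h₂| l *
          sqNorm p (diffV (α₁ + (1 / p - 1 / q)) ((2 ^ (k - 1) : ℝ)⁻¹ • (h₁, 0))
            (diffV (α₂ + (1 / p - 1 / q)) ((2 ^ (l - 1) : ℝ)⁻¹ • (0, h₂)) f)) ^ q := by
  have hp0 : 0 < p := by linarith
  have hq0 : 0 < q := by linarith
  have hθ : 0 < 1 / p - 1 / q := sub_pos.2 (one_div_lt_one_div_of_lt hp0 hpq)
  set θ := 1 / p - 1 / q with hθd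
  have hβ₁ : 0 < α₁ + θ := by linarith
  have hβ₂ : 0 < α₂ + θ := by linarith
  obtain ⟨C₁, hC₁, H₁⟩ := exists_lintegral_left_le hp hpq hβ₁
  obtain ⟨C₂, hC₂, H₂⟩ := exists_lintegral_right_le hp hpq hβ₂
  obtain ⟨K₁, hK₁, L₁⟩ := exists_sqNorm_diffVSeq_le (p := p) hθ hα₁ hp
  obtain ⟨K₂, hK₂, L₂⟩ := exists_sqNorm_diffVSeq_le (p := p) hθ hα₂ hp
  refine ⟨C₁ * (C₂ * (K₁ * K₂) ^ q), ENNReal.mul_ne_top hC₁ (ENNReal.mul_ne_top hC₂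
    (ENNReal.rpow_ne_top_of_nonneg hq0.le (ENNReal.mul_ne_top hK₁ hK₂))),
    fun h₁ h₂ f h₁0 h₁1 h₂0 h₂1 hf => ?_⟩
  have hBf := hf.diffV hα₂ (0, h₂)
  have hAf := hf.diffV hα₁ (h₁, 0)
  have hg := hBf.diffV hα₁ (h₁, 0)
  set g := diffV α₁ (h₁, 0) (diffV α₂ (0, h₂) f) with hgd
  have step1 := H₁ h₁ g h₁0 h₁1 hg
    (ae_integral_left_eq_zero hα₁ hBf (Filter.EventuallyEq.refl _ _))
  refine step1.trans ?_
  rw [mul_assoc C₁, ← ENNReal.tsum_mul_left (a := C₂ * (K₁ * K₂) ^ q)]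
  refine mul_le_mul_right (ENNReal.tsum_le_tsum fun k => ?_) C₁
  rw [mul_left_comm]
  refine mul_le_mul_right ?_ _
  have hG := hg.diffVSeq hθ hβ₁ (h₁, 0) k
  have hmean : ∀ᵐ x ∂perMeas, ∫ y, diffVSeq θ (α₁ + θ) (h₁, 0) g k (x, y) ∂perMeas = 0 := by
    obtain ⟨τ, hτ, w, e⟩ := exists_diffVSeq_eq hθ hβ₁ (h₁, 0) k
    refine ae_integral_right_eq_zero hα₂ (hAf.diffV hτ w) (h := h₂) ?_
    rw [e]
    exact (diffV_congr τ w hg (hAf.diffV hα₂ _) (diffV_comm hα₁ hα₂ _ _ hf)).trans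
      (diffV_comm hτ hα₂ _ _ hAf)
  refine (H₂ h₂ _ h₂0 h₂1 hG hmean).trans ?_
  rw [mul_assoc C₂, ← ENNReal.tsum_mul_left (a := (K₁ * K₂) ^ q)]
  refine mul_le_mul_right (ENNReal.tsum_le_tsum fun l => ?_) C₂
  rw [mul_left_comm]
  refine mul_le_mul_right ?_ _
  rw [← ENNReal.mul_rpow_of_nonneg _ _ hq0.le]
  refine ENNReal.rpow_le_rpow ?_ hq0.le
  obtain ⟨τ, hτ, w, e⟩ := exists_diffVSeq_eq hθ hβ₂ (0, h₂) l
  have s1 := L₁ τ w (h₁, 0) _ k hτ hBf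
  have s2 := L₂ (α₁ + θ) ((2 ^ (k - 1) : ℝ)⁻¹ • (h₁, 0)) (0, h₂) f l hβ₁ hf
  rw [e] at s2 ⊢
  rw [sqNorm_congr (diffV_comm hτ hβ₁ _ _ hBf)] at s1
  rw [mul_assoc]
  exact s1.trans (mul_le_mul_right s2 K₁)

theorem Lp2Norm_eq_sqNorm (p : ℝ) {f : ℝ → ℝ → ℝ} (hf : Measurable (Function.uncurry f))
    (hp : 0 < p) : Lp2Norm p f = sqNorm p (Function.uncurry f) := by
  unfold Lp2Norm sqNorm perMeas2
  rw [lintegral_prod _ (by fun_prop)]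
  congr 1
  refine lintegral_congr fun x => lintegral_congr fun y => ?_
  rw [enorm_eq_ofReal_abs, ENNReal.ofReal_rpow_of_nonneg (abs_nonneg _) hp.le]
  rfl

theorem uncurry_diffX (γ h : ℝ) (f : ℝ → ℝ → ℝ) :
    Function.uncurry (diffX γ h f) = diffV γ (h, 0) (Function.uncurry f) := by
  funext ⟨x, y⟩
  rw [diffV_slice_left]
  rfl

theorem uncurry_diffY (γ h : ℝ) (f : ℝ → ℝ → ℝ) :
    Function.uncurry (diffY γ h f) = diffV γ (0, h) (Function.uncurry f) := by
  funext ⟨x, y⟩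
  rw [diffV_slice_right]
  rfl

theorem measurable_diffV (γ : ℝ) (v : ℝ × ℝ) {u : ℝ × ℝ → ℝ} (hu : Measurable u) :
    Measurable (diffV γ v u) :=
  measurable_transSum _ _ hu

theorem Lp2Norm_diffX_diffY {p : ℝ} (hp : 0 < p) (γ₁ γ₂ h₁ h₂ : ℝ) {f : ℝ → ℝ → ℝ}
    (hf : Measurable (Function.uncurry f)) : Lp2Norm p (diffX γ₁ h₁ (diffY γ₂ h₂ f)) =
      sqNorm p (diffV γ₁ (h₁, 0) (diffV γ₂ (0, h₂) (Function.uncurry f))) := by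
  have e : Function.uncurry (diffX γ₁ h₁ (diffY γ₂ h₂ f))
      = diffV γ₁ (h₁, 0) (diffV γ₂ (0, h₂) (Function.uncurry f)) := by
    rw [uncurry_diffX, uncurry_diffY]
  rw [Lp2Norm_eq_sqNorm p (by
    rw [e]
    exact measurable_diffV _ _ (measurable_diffV _ _ hf)) hp, e]

theorem MemLp0.periodicL12 {p : ℝ} (hp : 1 < p) {f : ℝ → ℝ → ℝ} (hf : MemLp0 p f) :
    PeriodicL12 (Function.uncurry f) := by
  have hm := hf.meas
  have hp0 : 0 < p := by linarith
  refine ⟨hm, ⟨fun x y => hf.periodic_x y x, fun x y => hf.periodic_y x y⟩, ?_⟩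
  have h := hf.norm_ne_top
  rw [Lp2Norm_eq_sqNorm p hm hp0] at h
  have hfin : ∫⁻ z, ‖Function.uncurry f z‖ₑ ^ p ∂perMeas2 ≠ ⊤ := fun h' => h (by
    unfold sqNorm
    rw [h', ENNReal.top_rpow_of_pos (by positivity)])
  refine ne_top_of_le_ne_top (b := (perMeas2 Set.univ) + ∫⁻ z, ‖Function.uncurry f z‖ₑ ^ p ∂perMeas2)
    (by simp [hfin]) ?_
  rw [← lintegral_one, ← lintegral_add_left (by fun_prop)]
  refine lintegral_mono fun z => ?_
  rcases le_total ‖Function.uncurry f z‖ₑ 1 with h1 | h1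
  · exact h1.trans le_self_add
  · refine le_trans ?_ le_add_self
    conv_lhs => rw [← ENNReal.rpow_one ‖Function.uncurry f z‖ₑ]
    exact ENNReal.rpow_le_rpow_of_exponent_le h1 hp.le

theorem mixedMod_mono (p γ₁ γ₂ : ℝ) {s₁ s₂ t₁ t₂ : ℝ} (h₁ : s₁ ≤ t₁) (h₂ : s₂ ≤ t₂)
    (f : ℝ → ℝ → ℝ) : mixedMod p γ₁ γ₂ s₁ s₂ f ≤ mixedMod p γ₁ γ₂ t₁ t₂ f := by
  unfold mixedMod
  refine iSup_mono fun a => iSup_mono' fun ha => ⟨ha.trans h₁, ?_⟩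
  exact iSup_mono fun b => iSup_mono' fun hb => ⟨hb.trans h₂, le_rfl⟩

theorem sqNorm_diffV_le_mixedMod {p : ℝ} (hp : 0 < p) (γ₁ γ₂ h₁ h₂ : ℝ) {f : ℝ → ℝ → ℝ}
    (hf : Measurable (Function.uncurry f)) {s₁ s₂ : ℝ} (hs₁ : |h₁| ≤ s₁) (hs₂ : |h₂| ≤ s₂) :
    sqNorm p (diffV γ₁ (h₁, 0) (diffV γ₂ (0, h₂) (Function.uncurry f)))
      ≤ mixedMod p γ₁ γ₂ s₁ s₂ f := by
  rw [← Lp2Norm_diffX_diffY hp _ _ _ _ hf]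
  exact le_iSup₂_of_le h₁ hs₁ (le_iSup₂_of_le h₂ hs₂ le_rfl)

/-- The `L_q` norm of a mixed difference is controlled by a double dyadic sum of mixed moduli. -/
theorem exists_lintegral_le_mixedMod {p q α₁ α₂ : ℝ} (hp : 1 < p) (hpq : p < q) (hα₁ : 0 < α₁)
    (hα₂ : 0 < α₂) : ∃ C : ℝ≥0∞, C ≠ ⊤ ∧ ∀ (h₁ h₂ : ℝ) (f : ℝ → ℝ → ℝ), h₁ ≠ 0 → |h₁| ≤ 1 →
      h₂ ≠ 0 → |h₂| ≤ 1 → MemLp0 p f →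
      Lp2Norm q (diffX α₁ h₁ (diffY α₂ h₂ f)) ^ q ≤
        C * ∑' k, scaleWeight (q / p - 1) |h₁| k * ∑' l, scaleWeight (q / p - 1) |h₂| l *
          mixedMod p (α₁ + (1 / p - 1 / q)) (α₂ + (1 / p - 1 / q))
            (|h₁| / 2 ^ (k - 1)) (|h₂| / 2 ^ (l - 1)) f ^ q := by
  have hp0 : 0 < p := by linarith
  have hq0 : 0 < q := by linarith
  obtain ⟨C, hC, H⟩ := exists_lintegral_mixed_le hp hpq hα₁ hα₂
  refine ⟨C, hC, fun h₁ h₂ f h₁0 h₁1 h₂0 h₂1 hf => ?_⟩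
  have hf' := hf.periodicL12 hp
  have e0 : Lp2Norm q (diffX α₁ h₁ (diffY α₂ h₂ f)) ^ q =
      ∫⁻ z, ‖diffV α₁ (h₁, 0) (diffV α₂ (0, h₂) (Function.uncurry f)) z‖ₑ ^ q ∂perMeas2 := by
    rw [Lp2Norm_diffX_diffY hq0 _ _ _ _ hf.meas]
    unfold sqNorm
    rw [← ENNReal.rpow_mul, one_div, inv_mul_cancel₀ hq0.ne', ENNReal.rpow_one]
  have hm := hf.meas
  have e : ∀ (n : ℕ) (h : ℝ), |(2 ^ n : ℝ)⁻¹ * h| ≤ |h| / 2 ^ n := fun n h => by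
    rw [abs_mul, abs_of_pos (by positivity : (0:ℝ) < (2 ^ n)⁻¹), div_eq_inv_mul]
  have h1 := H h₁ h₂ _ h₁0 h₁1 h₂0 h₂1 hf'
  simp only [Prod.smul_mk, smul_eq_mul, mul_zero] at h1
  rw [e0]
  refine h1.trans (mul_le_mul_right (ENNReal.tsum_le_tsum fun k => mul_le_mul_right
    (ENNReal.tsum_le_tsum fun l => mul_le_mul_right (ENNReal.rpow_le_rpow ?_ hq0.le) _) _) _)
  exact sqNorm_diffV_le_mixedMod hp0 _ _ _ _ hm (e _ _) (e _ _)

theorem tsum_le_lintegral_Ioo {δ s : ℝ} (hs : 0 < s) (hsδ : 2 * s ≤ δ) {F : ℝ → ℝ≥0∞}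
    {m : ℕ → ℝ≥0∞} (H : ∀ k t, s / 2 ^ k < t → t < 2 * (s / 2 ^ k) → m k ≤ F t) :
    ∑' k : ℕ, ENNReal.ofReal (s / 2 ^ k) * m k ≤ ∫⁻ t in Set.Ioo 0 δ, F t := by
  set I : ℕ → Set ℝ := fun k => Set.Ioo (s / 2 ^ k) (2 * (s / 2 ^ k)) with hI
  have hd : Pairwise (Function.onFun Disjoint I) := by
    refine (pairwise_disjoint_on I).2 fun k l hkl => ?_
    rw [Set.disjoint_left]
    rintro t ⟨h1, -⟩ ⟨-, h2⟩
    have e : 2 * (s / 2 ^ l) ≤ s / 2 ^ k := by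
      have h3 : (2:ℝ) ^ (k + 1) ≤ 2 ^ l := pow_le_pow_right₀ one_le_two hkl
      rw [pow_succ] at h3
      rw [← mul_div_assoc, div_le_div_iff₀ (by positivity) (by positivity)]
      nlinarith
    linarith
  have hsub : (⋃ k, I k) ⊆ Set.Ioo 0 δ := by
    refine Set.iUnion_subset fun k t ht => ⟨?_, ?_⟩
    · have : 0 < s / 2 ^ k := by positivity
      exact this.trans ht.1
    · have : s / 2 ^ k ≤ s := div_le_self hs.le (one_le_pow₀ one_le_two)
      linarith [ht.2]
  refine le_trans ?_ (lintegral_mono_set hsub)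
  rw [lintegral_iUnion (fun k => measurableSet_Ioo) hd]
  refine ENNReal.tsum_le_tsum fun k => ?_
  calc ENNReal.ofReal (s / 2 ^ k) * m k = ∫⁻ _ in I k, m k := by
        rw [setLIntegral_const, hI, volume_Ioo, mul_comm]
        congr 2
        ring
    _ ≤ _ := setLIntegral_mono' measurableSet_Ioo fun t ht => H k t ht.1 ht.2

theorem tsum_pred_le (a : ℕ → ℝ≥0∞) : ∑' k, a (k - 1) ≤ 2 * ∑' k, a k := by
  rw [tsum_eq_zero_add' ENNReal.summable, two_mul]
  exact add_le_add (ENNReal.le_tsum 0) (le_of_eq (by simp))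

theorem cell_weight_le {γ s r t₁ t₂ : ℝ} (hγ : 0 < γ) (hs : 0 < s) (hr : 0 < r) (h₁ : s < t₁)
    (h₁' : t₁ < 2 * s) (h₂ : r < t₂) (h₂' : t₂ < 2 * r) {θ q : ℝ} (hθq : θ * q = γ) :
    (4 * (s * r)) ^ (-(γ + 1)) ≤ ((t₁ * t₂) ^ (-θ)) ^ q / (t₁ * t₂) := by
  have ht₁ : 0 < t₁ := hs.trans h₁
  have ht₂ : 0 < t₂ := hr.trans h₂
  have hT : 0 < t₁ * t₂ := mul_pos ht₁ ht₂
  have e : ((t₁ * t₂) ^ (-θ)) ^ q / (t₁ * t₂) = (t₁ * t₂) ^ (-(γ + 1)) := by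
    rw [← rpow_mul hT.le, div_eq_mul_inv, ← rpow_neg_one (t₁ * t₂), ← rpow_add hT, ← hθq]
    congr 1
    ring
  rw [e]
  refine rpow_le_rpow_of_nonpos hT ?_ (by linarith)
  nlinarith

theorem ofReal_cell {γ s r : ℝ} (hs : 0 < s) (hr : 0 < r) :
    ENNReal.ofReal ((4:ℝ) ^ (γ + 1)) * (ENNReal.ofReal s * (ENNReal.ofReal r *
      ENNReal.ofReal ((4 * (s * r)) ^ (-(γ + 1))))) =
      (ENNReal.ofReal s)⁻¹ ^ γ * (ENNReal.ofReal r)⁻¹ ^ γ := by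
  rw [← ENNReal.ofReal_inv_of_pos hs, ← ENNReal.ofReal_inv_of_pos hr,
    ENNReal.ofReal_rpow_of_pos (by positivity), ENNReal.ofReal_rpow_of_pos (by positivity),
    ← ENNReal.ofReal_mul hr.le, ← ENNReal.ofReal_mul hs.le, ← ENNReal.ofReal_mul (by positivity),
    ← ENNReal.ofReal_mul (by positivity)]
  congr 1
  rw [mul_rpow (by norm_num) (by positivity), mul_rpow hs.le hr.le, inv_rpow hs.le, inv_rpow hr.le,
    rpow_neg (by norm_num), rpow_neg hs.le, rpow_neg hr.le, rpow_add_one (by norm_num),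
    rpow_add_one hs.ne', rpow_add_one hr.ne']
  have h4 : (0:ℝ) < 4 ^ γ := by positivity
  have hsγ : 0 < s ^ γ := by positivity
  have hrγ : 0 < r ^ γ := by positivity
  field_simp

/-- A double dyadic sum is controlled by the corresponding double integral. -/
theorem exists_tsum_le_lintegral {γ : ℝ} (hγ : 0 < γ) : ∃ C : ℝ≥0∞, C ≠ ⊤ ∧
    ∀ (θ q s r δ₁ δ₂ : ℝ) (M : ℝ → ℝ → ℝ≥0∞), θ * q = γ → 0 < s → 0 < r → 2 * s ≤ δ₁ → 2 * r ≤ δ₂ →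
      (∀ s₁ s₂ t₁ t₂, s₁ ≤ t₁ → s₂ ≤ t₂ → M s₁ s₂ ≤ M t₁ t₂) →
      ∑' k, scaleWeight γ s k * ∑' l, scaleWeight γ r l * M (s / 2 ^ (k - 1)) (r / 2 ^ (l - 1)) ≤
        C * ∫⁻ t₁ in Set.Ioo 0 δ₁, ∫⁻ t₂ in Set.Ioo 0 δ₂,
          ENNReal.ofReal (((t₁ * t₂) ^ (-θ)) ^ q / (t₁ * t₂)) * M t₁ t₂ := by
  refine ⟨4 * ENNReal.ofReal ((4:ℝ) ^ (γ + 1)),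
    ENNReal.mul_ne_top (by simp) ENNReal.ofReal_ne_top,
    fun θ q s r δ₁ δ₂ M hθq hs hr hsδ hrδ hM => ?_⟩
  set S : ℕ → ℝ := fun k => s / 2 ^ k with hS
  set R : ℕ → ℝ := fun k => r / 2 ^ k with hR
  have hS0 : ∀ k, 0 < S k := fun k => by positivity
  have hR0 : ∀ k, 0 < R k := fun k => by positivity
  set b : ℕ → ℕ → ℝ≥0∞ := fun k l =>
    ENNReal.ofReal ((4 * (S k * R l)) ^ (-(γ + 1))) * M (S k) (R l) with hb
  have low : ∑' k, ENNReal.ofReal (S k) * ∑' l, ENNReal.ofReal (R l) * b k l ≤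
      ∫⁻ t₁ in Set.Ioo 0 δ₁, ∫⁻ t₂ in Set.Ioo 0 δ₂,
        ENNReal.ofReal (((t₁ * t₂) ^ (-θ)) ^ q / (t₁ * t₂)) * M t₁ t₂ := by
    refine tsum_le_lintegral_Ioo hs hsδ fun k t₁ h₁ h₁' =>
      tsum_le_lintegral_Ioo hr hrδ fun l t₂ h₂ h₂' => ?_
    exact mul_le_mul' (ENNReal.ofReal_le_ofReal
      (cell_weight_le hγ (hS0 k) (hR0 l) h₁ h₁' h₂ h₂' hθq)) (hM _ _ _ _ h₁.le h₂.le)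
  refine le_trans ?_ (mul_le_mul_right low _)
  set A : ℕ → ℕ → ℝ≥0∞ := fun k l =>
    (ENNReal.ofReal (S k))⁻¹ ^ γ * ((ENNReal.ofReal (R l))⁻¹ ^ γ * M (S k) (R l)) with hA
  have e1 : ∑' k, scaleWeight γ s k * ∑' l, scaleWeight γ r l *
      M (s / 2 ^ (k - 1)) (r / 2 ^ (l - 1)) = ∑' k : ℕ, ∑' l : ℕ, A (k - 1) (l - 1) := by
    refine tsum_congr fun k => ?_
    rw [← ENNReal.tsum_mul_left]
    rfl
  have e2 : ENNReal.ofReal ((4:ℝ) ^ (γ + 1)) *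
      ∑' k, ENNReal.ofReal (S k) * ∑' l, ENNReal.ofReal (R l) * b k l = ∑' k, ∑' l, A k l := by
    rw [← ENNReal.tsum_mul_left]
    refine tsum_congr fun k => ?_
    rw [← ENNReal.tsum_mul_left, ← ENNReal.tsum_mul_left]
    refine tsum_congr fun l => ?_
    rw [hA, hb]
    simp only
    rw [← mul_assoc ((ENNReal.ofReal (S k))⁻¹ ^ γ), ← ofReal_cell (hS0 k) (hR0 l)]
    ring
  rw [e1, mul_assoc, e2]
  calc ∑' k : ℕ, ∑' l : ℕ, A (k - 1) (l - 1) ≤ ∑' k : ℕ, 2 * ∑' l, A (k - 1) l :=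
        ENNReal.tsum_le_tsum fun k => tsum_pred_le (A (k - 1))
    _ = 2 * ∑' k : ℕ, (fun n => ∑' l, A n l) (k - 1) := ENNReal.tsum_mul_left
    _ ≤ 2 * (2 * ∑' k, ∑' l, A k l) := mul_le_mul_right (tsum_pred_le _) _
    _ = 4 * ∑' k, ∑' l, A k l := by rw [← mul_assoc]; norm_num

theorem exists_sqNorm_mixed_two_smul_le {α₁ α₂ r : ℝ} (hα₁ : 0 < α₁) (hα₂ : 0 < α₂) (hr : 1 < r) :
    ∃ C : ℝ≥0∞, C ≠ ⊤ ∧ ∀ (v w : ℝ × ℝ) (u : ℝ × ℝ → ℝ), PeriodicL12 u →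
      sqNorm r (diffV α₁ ((2 : ℝ) • v) (diffV α₂ ((2 : ℝ) • w) u)) ≤
        C * sqNorm r (diffV α₁ v (diffV α₂ w u)) := by
  obtain ⟨C₁, hC₁, H₁⟩ := exists_sqNorm_diffV_two_smul_le hα₁ hr
  obtain ⟨C₂, hC₂, H₂⟩ := exists_sqNorm_diffV_two_smul_le hα₂ hr
  refine ⟨C₁ * C₂, ENNReal.mul_ne_top hC₁ hC₂, fun v w u hu => ?_⟩
  refine (H₁ v _ (hu.diffV hα₂ _)).trans ?_
  rw [mul_assoc, sqNorm_congr (diffV_comm hα₁ hα₂ v _ hu), sqNorm_congr (diffV_comm hα₁ hα₂ v w hu)]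
  exact mul_le_mul_right (H₂ w _ (hu.diffV hα₁ v)) C₁

theorem diffV_zero_vec {γ : ℝ} (hγ : 0 < γ) (u : ℝ × ℝ → ℝ) : diffV γ (0, 0) u = 0 := by
  funext z
  unfold diffV transSum
  simp only [Prod.mk_zero_zero, smul_zero, add_zero, tsum_mul_right, tsum_diffCoeff hγ, zero_mul,
    Pi.zero_apply]

theorem diffV_zero (γ : ℝ) (v : ℝ × ℝ) : diffV γ v 0 = 0 := by
  funext z
  simp [diffV, transSum]

theorem sqNorm_zero {r : ℝ} (hr : 0 < r) : sqNorm r 0 = 0 := by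
  simp [sqNorm, hr]

theorem exists_Lp2Norm_le {p q α₁ α₂ : ℝ} (hp : 1 < p) (hpq : p < q)
    (hα₁ : 0 < α₁) (hα₂ : 0 < α₂) :
    ∃ C : ℝ≥0∞, C ≠ ⊤ ∧ ∀ (f : ℝ → ℝ → ℝ) (δ₁ δ₂ : ℝ), MemLp0 p f →
      δ₁ ∈ Set.Ioo (0:ℝ) 1 → δ₂ ∈ Set.Ioo (0:ℝ) 1 → ∀ h₁ h₂, |h₁| ≤ δ₁ → |h₂| ≤ δ₂ →
      Lp2Norm q (diffX α₁ h₁ (diffY α₂ h₂ f)) ≤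
        C * (∫⁻ t₁ in Set.Ioo (0:ℝ) δ₁, ∫⁻ t₂ in Set.Ioo (0:ℝ) δ₂,
            ENNReal.ofReal (((t₁*t₂) ^ (-(1/p - 1/q))) ^ q / (t₁*t₂)) *
              mixedMod p (α₁ + (1/p - 1/q)) (α₂ + (1/p - 1/q)) t₁ t₂ f ^ q) ^ (1/q) := by
  have hp0 : 0 < p := by linarith
  have hq0 : 0 < q := by linarith
  have hγ : 0 < q / p - 1 := by rw [sub_pos, one_lt_div hp0]; exact hpq
  obtain ⟨K, hK, HK⟩ := exists_sqNorm_mixed_two_smul_le hα₁ hα₂ (hp.trans hpq)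
  obtain ⟨C, hC, HC⟩ := exists_lintegral_le_mixedMod hp hpq hα₁ hα₂
  obtain ⟨B, hB, HB⟩ := exists_tsum_le_lintegral hγ
  refine ⟨K * (C * B) ^ (1 / q), ENNReal.mul_ne_top hK (ENNReal.rpow_ne_top_of_nonneg
    (by positivity) (ENNReal.mul_ne_top hC hB)), fun f δ₁ δ₂ hf hδ₁ hδ₂ h₁ h₂ hh₁ hh₂ => ?_⟩
  have hm := hf.meas
  by_cases h₁0 : h₁ = 0
  · rw [Lp2Norm_diffX_diffY hq0 _ _ _ _ hm, h₁0, diffV_zero_vec hα₁, sqNorm_zero hq0]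
    exact bot_le
  by_cases h₂0 : h₂ = 0
  · rw [Lp2Norm_diffX_diffY hq0 _ _ _ _ hm, h₂0, diffV_zero_vec hα₂, diffV_zero, sqNorm_zero hq0]
    exact bot_le
  have hη : ∀ h : ℝ, |h / 2| = |h| / 2 := fun h => by rw [abs_div, abs_two]
  have hdouble : Lp2Norm q (diffX α₁ h₁ (diffY α₂ h₂ f)) ≤
      K * Lp2Norm q (diffX α₁ (h₁ / 2) (diffY α₂ (h₂ / 2) f)) := by
    have h := HK (h₁ / 2, 0) (0, h₂ / 2) _ (hf.periodicL12 hp)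
    simp only [Prod.smul_mk, smul_eq_mul, mul_zero, mul_div_cancel₀ _ (two_ne_zero (α := ℝ))] at h
    rw [Lp2Norm_diffX_diffY hq0 _ _ _ _ hm, Lp2Norm_diffX_diffY hq0 _ _ _ _ hm]
    exact h
  refine hdouble.trans ?_
  rw [mul_assoc]
  refine mul_le_mul_right ?_ K
  have hmain := HC (h₁ / 2) (h₂ / 2) f (by simpa using h₁0)
    (by rw [hη]; linarith [hδ₁.2, abs_nonneg h₁]) (by simpa using h₂0)
    (by rw [hη]; linarith [hδ₂.2, abs_nonneg h₂]) hf
  have hsum := HB (1 / p - 1 / q) q |h₁ / 2| |h₂ / 2| δ₁ δ₂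
    (fun t₁ t₂ => mixedMod p (α₁ + (1 / p - 1 / q)) (α₂ + (1 / p - 1 / q)) t₁ t₂ f ^ q)
    (by field_simp) (by positivity) (by positivity) (by rw [hη]; linarith)
    (by rw [hη]; linarith)
    (fun _ _ _ _ a b => ENNReal.rpow_le_rpow (mixedMod_mono _ _ _ a b f) hq0.le)
  have h := hmain.trans (mul_le_mul_right hsum C)
  rw [← mul_assoc] at h
  rw [← ENNReal.mul_rpow_of_nonneg _ _ (by positivity : 0 ≤ 1 / q), one_div q,
    ENNReal.le_rpow_inv_iff hq0, ← one_div q]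
  exact h

/-- Sharp Ul'yanov inequality for the mixed moduli of smoothness (Theorem 11.1). -/
theorem sharp_ulyanov (p q α₁ α₂ : ℝ) (hp : 1 < p) (hpq : p < q)
    (hα₁ : 0 < α₁) (hα₂ : 0 < α₂) :
    ∃ C : ℝ, 0 < C ∧ ∀ (f : ℝ → ℝ → ℝ) (δ₁ δ₂ : ℝ), MemLp0 p f →
      δ₁ ∈ Set.Ioo (0:ℝ) 1 → δ₂ ∈ Set.Ioo (0:ℝ) 1 →
      mixedMod q α₁ α₂ δ₁ δ₂ f ≤
        ENNReal.ofReal C *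
          (∫⁻ t₁ in Set.Ioo (0:ℝ) δ₁, ∫⁻ t₂ in Set.Ioo (0:ℝ) δ₂,
            ENNReal.ofReal (((t₁*t₂) ^ (-(1/p - 1/q))) ^ q / (t₁*t₂)) *
              mixedMod p (α₁ + (1/p - 1/q)) (α₂ + (1/p - 1/q)) t₁ t₂ f ^ q) ^ (1/q) := by
  obtain ⟨C, hC, H⟩ := exists_Lp2Norm_le hp hpq hα₁ hα₂
  refine ⟨C.toReal + 1, by positivity, fun f δ₁ δ₂ hf hδ₁ hδ₂ => ?_⟩
  refine iSup₂_le fun h₁ hh₁ => iSup₂_le fun h₂ hh₂ =>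
    (H f δ₁ δ₂ hf hδ₁ hδ₂ h₁ h₂ hh₁ hh₂).trans (mul_le_mul_left ?_ _)
  rw [ENNReal.ofReal_add ENNReal.toReal_nonneg zero_le_one, ENNReal.ofReal_toReal hC]
  exact le_self_add

end
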